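/- arXiv:2507.19617 — 4 statements merged into one kernel-verified Lean document; each statement's English description precedes it below -/
import Mathlib

section
/- Let d ≥ 2. Suppose D: ℤ_{>0} → ℤ_{>0} is increasing and satisfies property PD_{d−1}: every minimal prime of an ideal of R generated by a homogeneous regular sequence of length at most k with degrees at most d−1 is generated by at most D(k) elements. Suppose 𝓑: ℤ_{>0}×ℤ_{>0} → ℤ_{>0} is ascending (weakly increasing in each coordinate) and satisfies property PcB_{d−1}: every graded K-vector space of homogeneous forms of degrees at most d−1 and total dimension n in R is contained in a K-subalgebra of R generated by an R_η-sequence of forms of degrees at most d−1 and of length at most 𝓑(η,n). Define A(η) = 𝓑(3, D(η+1)) + 1. Then A is increasing and satisfies property PAa_d: for every η ≥ 1 and every nonzero homogeneous form F of positive degree at most d with str(F) ≥ A(η), the ring R/FR satisfies Serre's condition R_η. -/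
open MvPolynomial

/-- A (Noetherian) local ring is regular iff its maximal ideal can be generated by
`ringKrullDim` many elements. -/
def IsRegularLocal (S : Type*) [CommRing S] : Prop :=
  IsNoetherianRing S ∧ IsLocalRing S ∧
    ∃ s : Finset S, (Ideal.span (s : Set S)).IsMaximal ∧
      (s.card : WithBot (WithTop ℕ)) = ringKrullDim S

/-- Serre's condition `R_η`: the localization at every prime of height at most `η`
is a regular local ring. -/
def SerreReg (η : ℕ) (S : Type*) [CommRing S] : Prop :=
  ∀ p : PrimeSpectrum S, Order.height p ≤ (η : ℕ∞) →
    IsRegularLocal (Localization.AtPrime p.asIdeal)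

/-- `y` is an `R_η`-sequence: it generates a proper ideal and the quotient by each
initial segment satisfies Serre's condition `R_η`. -/
def IsSerreSeq (η : ℕ) {S : Type*} [CommRing S] {n : ℕ} (y : Fin n → S) : Prop :=
  Ideal.span (Set.range y) ≠ ⊤ ∧
    ∀ m : ℕ, m ≤ n →
      SerreReg η (S ⧸ Ideal.span (y '' {j : Fin n | (j : ℕ) < m}))

/-- `F` has a `k`-collapse: `F = Σ_{i=1}^k f_i g_i` with all `f_i, g_i`
homogeneous of positive degree.  The strength of `F` is `≥ k` iff `F` has no
`k`-collapse. -/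
def HasCollapse {K : Type*} [CommSemiring K] {N : ℕ} (k : ℕ)
    (F : MvPolynomial (Fin N) K) : Prop :=
  ∃ f g : Fin k → MvPolynomial (Fin N) K,
    (∀ i, ∃ d > 0, (f i).IsHomogeneous d) ∧
    (∀ i, ∃ d > 0, (g i).IsHomogeneous d) ∧
    F = ∑ i, f i * g i

/-- `a` is a nonzerodivisor modulo the ideal `I`. -/
def RegularMod {R : Type*} [CommRing R] (I : Ideal R) (a : R) : Prop :=
  ∀ x, a * x ∈ I → x ∈ I

/-- `P` is a prime of the form `(I : z)`. -/
def AssocMod {R : Type*} [CommRing R] (I P : Ideal R) : Prop :=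
  P.IsPrime ∧ ∃ z, ∀ x, x ∈ P ↔ x * z ∈ I

/-- Inside a local ring, `DepthMod n I` says that `n` successive elements of the maximal ideal
are regular modulo `I`, after which the maximal ideal kills a nonzero class. -/
def DepthMod {R : Type*} [CommRing R] [IsLocalRing R] : ℕ → Ideal R → Prop
  | 0, I => ∃ z, z ∉ I ∧ ∀ x ∈ IsLocalRing.maximalIdeal R, x * z ∈ I
  | n + 1, I => ∃ x ∈ IsLocalRing.maximalIdeal R, RegularMod I x ∧ DepthMod n (I ⊔ Ideal.span {x})

section Assoc

variable {R : Type*} [CommRing R]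

theorem mem_sup_span_singleton {I : Ideal R} {a x : R} :
    x ∈ I ⊔ Ideal.span {a} ↔ ∃ c, x - c * a ∈ I := by
  rw [sup_comm, Ideal.mem_span_singleton_sup]
  constructor
  · rintro ⟨c, b, hb, rfl⟩
    exact ⟨c, by simpa using hb⟩
  · rintro ⟨c, hc⟩
    exact ⟨c, _, hc, by ring⟩

theorem assocMod_iff_mem_associatedPrimes [IsNoetherianRing R] {I P : Ideal R} :
    AssocMod I P ↔ P ∈ associatedPrimes R (R ⧸ I) := by
  rw [AssociatedPrimes.mem_iff, isAssociatedPrime_iff]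
  refine and_congr_right fun _ => ?_
  constructor
  · rintro ⟨z, hz⟩
    refine ⟨Ideal.Quotient.mk I z, ?_⟩
    ext x
    rw [hz, Submodule.mem_colon_singleton, Submodule.mem_bot, Algebra.smul_def,
      Ideal.Quotient.algebraMap_eq, ← map_mul, Ideal.Quotient.eq_zero_iff_mem]
  · rintro ⟨z, hz⟩
    obtain ⟨z, rfl⟩ := Ideal.Quotient.mk_surjective z
    refine ⟨z, fun x => ?_⟩
    rw [hz, Submodule.mem_colon_singleton, Submodule.mem_bot, Algebra.smul_def,
      Ideal.Quotient.algebraMap_eq, ← map_mul, Ideal.Quotient.eq_zero_iff_mem]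

theorem finite_assocMod [IsNoetherianRing R] (I : Ideal R) : {P | AssocMod I P}.Finite := by
  simp_rw [assocMod_iff_mem_associatedPrimes]
  exact associatedPrimes.finite R (R ⧸ I)

theorem exists_assocMod [IsNoetherianRing R] {I : Ideal R} {z : R} (hz : z ∉ I) :
    ∃ P, AssocMod I P ∧ ∀ x, x * z ∈ I → x ∈ P := by
  obtain ⟨P, hP, h⟩ := exists_le_isAssociatedPrime_of_isNoetherianRing R
    (Ideal.Quotient.mk I z) (by rwa [Ne, Ideal.Quotient.eq_zero_iff_mem])
  refine ⟨P, assocMod_iff_mem_associatedPrimes.2 hP, fun x hx => h ?_⟩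
  rwa [Submodule.mem_colon_singleton, Submodule.mem_bot, Algebra.smul_def,
      Ideal.Quotient.algebraMap_eq, ← map_mul, Ideal.Quotient.eq_zero_iff_mem]

theorem AssocMod.le {I P : Ideal R} (h : AssocMod I P) : I ≤ P := by
  obtain ⟨_, z, hz⟩ := h
  exact fun x hx => (hz x).2 (I.mul_mem_right _ hx)

theorem AssocMod.not_regularMod {I P : Ideal R} (h : AssocMod I P) {a : R} (ha : a ∈ P) :
    ¬ RegularMod I a := by
  obtain ⟨hP, z, hz⟩ := h
  intro hr
  have := hr z ((hz a).1 ha)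
  exact hP.ne_top ((Ideal.eq_top_iff_one _).2 ((hz 1).2 (by simpa using this)))

theorem regularMod_of_forall_notMem [IsNoetherianRing R] {I : Ideal R} {a : R}
    (h : ∀ P, AssocMod I P → a ∉ P) : RegularMod I a := by
  intro x hx
  by_contra hxI
  obtain ⟨P, hP, hPx⟩ := exists_assocMod hxI
  exact h P hP (hPx a hx)

theorem assocMod_of_mem_minimalPrimes [IsNoetherianRing R] {I P : Ideal R}
    (h : P ∈ I.minimalPrimes) : AssocMod I P := by
  rw [assocMod_iff_mem_associatedPrimes]
  have := Module.associatedPrimes.minimalPrimes_annihilator_subset_associatedPrimes R (R ⧸ I)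
  apply this
  rwa [Ideal.annihilator_quotient]

end Assoc

section Depth

variable {R : Type*} [CommRing R] [IsLocalRing R]

open IsLocalRing

theorem depthMod_zero_of_assocMod {I : Ideal R} (h : AssocMod I (maximalIdeal R)) :
    DepthMod 0 I := by
  obtain ⟨hP, z, hz⟩ := h
  refine ⟨z, fun hzI => ?_, fun x hx => (hz x).1 hx⟩
  exact hP.ne_top ((Ideal.eq_top_iff_one _).2 ((hz 1).2 (by simpa using hzI)))

theorem DepthMod.not_regularMod {I : Ideal R} (h : DepthMod 0 I) {a : R}
    (ha : a ∈ maximalIdeal R) : ¬ RegularMod I a := by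
  obtain ⟨z, hz, h⟩ := h
  exact fun hr => hz (hr z (h a ha))

theorem DepthMod.zero_exchange {I : Ideal R} {x y : R}
    (hy : y ∈ maximalIdeal R) (hxI : RegularMod I x) (hyI : RegularMod I y)
    (h : DepthMod 0 (I ⊔ Ideal.span {x})) : DepthMod 0 (I ⊔ Ideal.span {y}) := by
  obtain ⟨z, hz, h⟩ := h
  obtain ⟨w, hw⟩ := mem_sup_span_singleton.1 (h y hy)
  refine ⟨w, fun hwy => hz ?_, fun t ht => ?_⟩
  · obtain ⟨v, hv⟩ := mem_sup_span_singleton.1 hwy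
    refine mem_sup_span_singleton.2 ⟨v, hyI _ ?_⟩
    have : y * (z - v * x) = (y * z - w * x) + x * (w - v * y) := by ring
    rw [this]
    exact I.add_mem hw (I.mul_mem_left _ hv)
  · obtain ⟨u, hu⟩ := mem_sup_span_singleton.1 (h t ht)
    refine mem_sup_span_singleton.2 ⟨u, hxI _ ?_⟩
    have : x * (t * w - u * y) = y * (t * z - u * x) - t * (y * z - w * x) := by ring
    rw [this]
    exact I.sub_mem (I.mul_mem_left _ hu) (I.mul_mem_left _ hw)

theorem RegularMod.swap {R : Type*} [CommRing R] {I : Ideal R} {y w : R}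
    (hy : RegularMod I y)
    (h : RegularMod (I ⊔ Ideal.span {y}) w) : RegularMod (I ⊔ Ideal.span {w}) y := by
  intro u hu
  obtain ⟨v, hv⟩ := mem_sup_span_singleton.1 hu
  have : w * v ∈ I ⊔ Ideal.span {y} :=
    mem_sup_span_singleton.2 ⟨u, by simpa [mul_comm] using I.neg_mem hv⟩
  obtain ⟨v', hv'⟩ := mem_sup_span_singleton.1 (h v this)
  refine mem_sup_span_singleton.2 ⟨v', hy _ ?_⟩
  have : y * (u - v' * w) = (y * u - v * w) + w * (v - v' * y) := by ring
  rw [this]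
  exact I.add_mem hv (I.mul_mem_left _ hv')

theorem exists_regularMod_of_forall_not_depthMod [IsNoetherianRing R] (s : Finset (Ideal R))
    (h : ∀ I ∈ s, ¬ DepthMod 0 I) : ∃ w ∈ maximalIdeal R, ∀ I ∈ s, RegularMod I w := by
  have hfin : (⋃ I ∈ s, {P | AssocMod I P}).Finite :=
    s.finite_toSet.biUnion fun I _ => finite_assocMod I
  have key : ¬ ((maximalIdeal R : Set R) ⊆ ⋃ P ∈ (⋃ I ∈ s, {P | AssocMod I P}), (P : Set R)) := by
    rw [Ideal.subset_union_prime_finite hfin (f := fun P => P) ⊤ ⊤]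
    · rintro ⟨P, hP, hle⟩
      simp only [Set.mem_iUnion] at hP
      obtain ⟨I, hI, hP⟩ := hP
      have := (maximalIdeal.isMaximal R).eq_of_le hP.1.ne_top hle
      exact h I hI (depthMod_zero_of_assocMod (this ▸ hP))
    · intro P hP _ _
      simp only [Set.mem_iUnion] at hP
      obtain ⟨I, hI, hP⟩ := hP
      exact hP.1
  obtain ⟨w, hw, hwP⟩ := Set.not_subset.1 key
  refine ⟨w, hw, fun I hI => regularMod_of_forall_notMem fun P hP hwP' => hwP ?_⟩
  simp only [Set.mem_iUnion]
  exact ⟨P, ⟨I, hI, hP⟩, hwP'⟩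

theorem DepthMod.quotient_regular [IsNoetherianRing R] {n : ℕ} {I : Ideal R} (h : DepthMod n I)
    {x : R} (hx : x ∈ maximalIdeal R) (hxI : RegularMod I x) :
    ∃ k, n = k + 1 ∧ DepthMod k (I ⊔ Ideal.span {x}) := by
  induction n generalizing I x with
  | zero => exact absurd hxI (h.not_regularMod hx)
  | succ n ih =>
    refine ⟨n, rfl, ?_⟩
    obtain ⟨y, hy, hyI, h⟩ := h
    cases n with
    | zero => exact h.zero_exchange hx hyI hxI
    | succ n =>
      have hny : ¬ DepthMod 0 (I ⊔ Ideal.span {y}) := by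
        obtain ⟨z, hz, hzI, -⟩ := h
        exact fun h0 => h0.not_regularMod hz hzI
      have hnx : ¬ DepthMod 0 (I ⊔ Ideal.span {x}) :=
        fun h0 => hny (h0.zero_exchange hy hxI hyI)
      have hnI : ¬ DepthMod 0 I := fun h0 => h0.not_regularMod hx hxI
      classical
      obtain ⟨w, hw, hwr⟩ := exists_regularMod_of_forall_not_depthMod
        {I, I ⊔ Ideal.span {x}, I ⊔ Ideal.span {y}} (by simp [hny, hnx, hnI])
      simp only [Finset.mem_insert, Finset.mem_singleton, forall_eq_or_imp, forall_eq] at hwr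
      obtain ⟨hwI, hwx, hwy⟩ := hwr
      obtain ⟨k, hk, h1⟩ := ih h hw hwy
      obtain rfl : n = k := by omega
      rw [sup_right_comm] at h1
      have h2 : DepthMod (n + 1) (I ⊔ Ideal.span {w}) := ⟨y, hy, hyI.swap hwy, h1⟩
      obtain ⟨k, hk, h3⟩ := ih h2 hx (hxI.swap hwx)
      obtain rfl : n = k := by omega
      rw [sup_right_comm] at h3
      exact ⟨w, hw, hwx, h3⟩

theorem DepthMod.comap {S : Type*} [CommRing S] [IsLocalRing S] {f : R →+* S}
    (hf : Function.Surjective f) {n : ℕ} {J : Ideal S} (h : DepthMod n J) :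
    DepthMod n (J.comap f) := by
  have : IsLocalHom f := IsLocalHom.of_surjective f hf
  induction n generalizing J with
  | zero =>
    obtain ⟨z, hz, h⟩ := h
    obtain ⟨z, rfl⟩ := hf z
    refine ⟨z, hz, fun x hx => ?_⟩
    have := h (f x) (by simpa using hx)
    simpa using this
  | succ n ih =>
    obtain ⟨y, hy, hyJ, h⟩ := h
    obtain ⟨y, rfl⟩ := hf y
    refine ⟨y, by simpa using hy, fun x hx => hyJ _ (by simpa using hx), ?_⟩
    convert ih h using 1
    ext x
    rw [mem_sup_span_singleton, Ideal.mem_comap, mem_sup_span_singleton]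
    constructor
    · rintro ⟨c, hc⟩
      exact ⟨f c, by simpa using hc⟩
    · rintro ⟨c, hc⟩
      obtain ⟨c, rfl⟩ := hf c
      exact ⟨c, by simpa using hc⟩

end Depth

section RegularLocal

open IsLocalRing

variable {A : Type*} [CommRing A]

theorem exists_finset_insert_span_eq_maximalIdeal [IsLocalRing A] [IsNoetherianRing A] {x : A}
    (hx : x ∈ maximalIdeal A) (hx2 : x ∉ maximalIdeal A ^ 2) :
    ∃ t : Finset A, t.card + 1 ≤ (maximalIdeal A).spanFinrank ∧
      Ideal.span (insert x (t : Set A)) = maximalIdeal A := by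
  classical
  obtain ⟨s, hs, hspan⟩ := Submodule.FG.exists_span_finset_card_eq_spanFinrank
    (IsNoetherian.noetherian (maximalIdeal A))
  have hsm : ∀ i ∈ s, i ∈ maximalIdeal A := fun i hi => hspan ▸ Submodule.subset_span hi
  obtain ⟨c, -, hc⟩ := Submodule.mem_span_finset.1 (hspan ▸ hx : x ∈ Submodule.span A (s : Set A))
  have : ∃ i ∈ s, IsUnit (c i) := by
    by_contra! h
    refine hx2 (hc ▸ Ideal.sum_mem _ fun i hi => ?_)
    rw [pow_two, smul_eq_mul]
    exact Ideal.mul_mem_mul ((mem_maximalIdeal _).2 (h i hi)) (hsm i hi)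
  obtain ⟨i, hi, hu⟩ := this
  refine ⟨s.erase i, ?_, ?_⟩
  · rw [← hs, Finset.card_erase_add_one hi]
  · apply le_antisymm
    · rw [Ideal.span_le]
      rintro y (rfl | hy)
      · exact hx
      · exact hsm y (Finset.mem_of_mem_erase hy)
    · rw [← hspan, Submodule.span_le]
      intro y hy
      by_cases hyi : y = i
      · subst hyi
        rw [← Finset.add_sum_erase _ _ hi, smul_eq_mul] at hc
        have hmem : c y * y ∈ Ideal.span (insert x ((s.erase y : Finset A) : Set A)) := by
          rw [eq_sub_of_add_eq hc]
          refine Ideal.sub_mem _ (Ideal.subset_span (Set.mem_insert _ _)) (Ideal.sum_mem _ ?_)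
          intro j hj
          exact Ideal.mul_mem_left _ _ (Ideal.subset_span (Set.mem_insert_of_mem _ hj))
        exact (Ideal.unit_mul_mem_iff_mem _ hu).1 hmem
      · exact Ideal.subset_span (Set.mem_insert_of_mem _ (Finset.mem_erase.2 ⟨hyi, hy⟩))

theorem map_maximalIdeal_of_surjective [IsLocalRing A] {B : Type*} [CommRing B] [IsLocalRing B]
    {f : A →+* B} (hf : Function.Surjective f) : (maximalIdeal A).map f = maximalIdeal B := by
  have : IsLocalHom f := IsLocalHom.of_surjective f hf
  apply le_antisymm
  · exact ((local_hom_TFAE f).out 0 2).1 this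
  · intro y hy
    obtain ⟨y, rfl⟩ := hf y
    exact Ideal.mem_map_of_mem _ (by simpa using hy)

theorem isRegularLocalRing_quotient [IsRegularLocalRing A] {x : A}
    (hx : x ∈ maximalIdeal A) (hx2 : x ∉ maximalIdeal A ^ 2) :
    IsRegularLocalRing (A ⧸ Ideal.span {x}) ∧
      ringKrullDim (A ⧸ Ideal.span {x}) + 1 = ringKrullDim A := by
  classical
  have : Nontrivial (A ⧸ Ideal.span {x}) := Ideal.Quotient.nontrivial_iff.2 fun h =>
    (maximalIdeal.isMaximal A).ne_top (top_le_iff.1 (h ▸ (Ideal.span_singleton_le_iff_mem _).2 hx))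
  have hsurj := Ideal.Quotient.mk_surjective (I := Ideal.span {x})
  have : IsLocalRing (A ⧸ Ideal.span {x}) := IsLocalRing.of_surjective' _ hsurj
  obtain ⟨t, ht, hspan⟩ := exists_finset_insert_span_eq_maximalIdeal hx hx2
  have h1 : (maximalIdeal (A ⧸ Ideal.span {x})).spanFinrank + 1 ≤ (maximalIdeal A).spanFinrank := by
    refine le_trans (Nat.succ_le_succ ?_) ht
    rw [← map_maximalIdeal_of_surjective hsurj, ← hspan, Ideal.map_span, Set.image_insert_eq,
      Ideal.Quotient.eq_zero_iff_mem.2 (Ideal.mem_span_singleton_self x), Ideal.span_insert_zero]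
    refine (Submodule.spanFinrank_span_le_ncard_of_finite (t.finite_toSet.image _)).trans ?_
    exact (Set.ncard_image_le t.finite_toSet).trans (Set.ncard_coe_finset t).le
  have h2 := ringKrullDim_le_ringKrullDim_quotient_add_card {x}
    (by simpa [IsLocalRing.ringJacobson_eq_maximalIdeal] using hx)
  rw [Finset.coe_singleton, Finset.card_singleton, Nat.cast_one] at h2
  have h3 := ringKrullDim_le_spanFinrank_maximalIdeal (A ⧸ Ideal.span {x})
  have h4 : ((maximalIdeal A).spanFinrank : WithBot ℕ∞) = ringKrullDim A :=
    IsRegularLocalRing.spanFinrank_maximalIdeal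
  have h5 : ((maximalIdeal (A ⧸ Ideal.span {x})).spanFinrank : WithBot ℕ∞) + 1 ≤
    ringKrullDim A := by rw [← h4]; exact_mod_cast h1
  have h6 : ((maximalIdeal (A ⧸ Ideal.span {x})).spanFinrank : WithBot ℕ∞) ≤
      ringKrullDim (A ⧸ Ideal.span {x}) :=
    ENat.WithBot.add_le_add_one_right_iff.1 (h5.trans h2)
  refine ⟨IsRegularLocalRing.of_spanFinrank_maximalIdeal_le _ h6, le_antisymm ?_ h2⟩
  exact le_trans (add_le_add_left h3 1) h5

theorem exists_notMem_maximalIdeal_sq [IsLocalRing A] [IsNoetherianRing A]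
    (h : maximalIdeal A ≠ ⊥) : ∃ x ∈ maximalIdeal A, x ∉ maximalIdeal A ^ 2 := by
  by_contra! hc
  refine h (Submodule.eq_bot_of_le_smul_of_le_jacobson_bot (maximalIdeal A) _
    (IsNoetherian.noetherian _) ?_ (IsLocalRing.maximalIdeal_le_jacobson _))
  intro x hx
  simpa [pow_two] using hc x hx

theorem IsRegularLocalRing.isDomain [IsRegularLocalRing A] : IsDomain A := by
  obtain ⟨n, hn⟩ : ∃ n, (maximalIdeal A).spanFinrank = n := ⟨_, rfl⟩
  induction n generalizing A with
  | zero =>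
    have := (Submodule.spanFinrank_eq_zero_iff_eq_bot (IsNoetherian.noetherian _)).1 hn
    exact (isField_iff_maximalIdeal_eq.2 this).isDomain
  | succ n ih =>
    have hne : maximalIdeal A ≠ ⊥ := fun h => by
      rw [(Submodule.spanFinrank_eq_zero_iff_eq_bot (IsNoetherian.noetherian _)).2 h] at hn
      omega
    have hquot : ∀ x ∈ maximalIdeal A, x ∉ maximalIdeal A ^ 2 → (Ideal.span {x}).IsPrime := by
      intro x hx hx2
      obtain ⟨h1, h2⟩ := isRegularLocalRing_quotient hx hx2
      rw [← Ideal.Quotient.isDomain_iff_prime]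
      apply ih
      rw [← IsRegularLocalRing.spanFinrank_maximalIdeal,
        ← IsRegularLocalRing.spanFinrank_maximalIdeal, hn] at h2
      have : (maximalIdeal (A ⧸ Ideal.span {x})).spanFinrank + 1 = n + 1 := by exact_mod_cast h2
      omega
    have hfin := minimalPrimes.finite_of_isNoetherianRing A
    obtain ⟨x, hx, hx2⟩ := exists_notMem_maximalIdeal_sq hne
    by_cases hsub : (maximalIdeal A : Set A) ⊆
        ⋃ P ∈ insert (maximalIdeal A ^ 2) (minimalPrimes A), (P : Set A)
    · rw [Ideal.subset_union_prime_finite (hfin.insert _) (f := fun P => P)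
        (maximalIdeal A ^ 2) (maximalIdeal A ^ 2)] at hsub
      · obtain ⟨P, rfl | hP, hle⟩ := hsub
        · exact absurd (hle hx) hx2
        · exfalso
          have hPm : P = maximalIdeal A :=
            ((maximalIdeal.isMaximal A).eq_of_le hP.1.1.ne_top hle).symm
          have h0 : (maximalIdeal A).height = 0 := by
            have := hP.1.1
            rw [← hPm, Ideal.height_eq_zero_iff]
            exact hP
          have h1 := IsLocalRing.maximalIdeal_height_eq_ringKrullDim (R := A)
          rw [h0, ← IsRegularLocalRing.spanFinrank_maximalIdeal, hn] at h1
          have : (0 : ℕ) = n + 1 := by exact_mod_cast h1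
          omega
      · rintro P (rfl | hP) h1 _
        · exact absurd rfl h1
        · exact hP.1.1
    · obtain ⟨y, hy, hyP⟩ := Set.not_subset.1 hsub
      simp only [Set.mem_iUnion, not_exists] at hyP
      have hy2 : y ∉ maximalIdeal A ^ 2 := hyP _ (Set.mem_insert _ _)
      have hyp := hquot y hy hy2
      obtain ⟨q, hq, hle⟩ := Ideal.exists_minimalPrimes_le (bot_le : ⊥ ≤ Ideal.span {y})
      have hqp : q.IsPrime := hq.1.1
      have hyq : y ∉ q := hyP _ (Set.mem_insert_of_mem _ hq)
      have hq0 : q = ⊥ := by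
        refine Submodule.eq_bot_of_le_smul_of_le_jacobson_bot (maximalIdeal A) _
          (IsNoetherian.noetherian _) ?_ (IsLocalRing.maximalIdeal_le_jacobson _)
        intro z hz
        obtain ⟨w, rfl⟩ := Ideal.mem_span_singleton'.1 (hle hz)
        rw [mul_comm, smul_eq_mul]
        exact Ideal.mul_mem_mul hy ((hqp.mem_or_mem hz).resolve_right hyq)
      rw [hq0] at hqp
      exact IsDomain.of_bot_isPrime A

theorem IsRegularLocalRing.depthMod_bot [IsRegularLocalRing A] :
    DepthMod (maximalIdeal A).spanFinrank (⊥ : Ideal A) := by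
  obtain ⟨n, hn⟩ : ∃ n, (maximalIdeal A).spanFinrank = n := ⟨_, rfl⟩
  induction n generalizing A with
  | zero =>
    rw [hn]
    have := (Submodule.spanFinrank_eq_zero_iff_eq_bot (IsNoetherian.noetherian _)).1 hn
    exact ⟨1, by simp, fun x hx => by simpa [this] using hx⟩
  | succ n ih =>
    have hne : maximalIdeal A ≠ ⊥ := fun h => by
      rw [(Submodule.spanFinrank_eq_zero_iff_eq_bot (IsNoetherian.noetherian _)).2 h] at hn
      omega
    obtain ⟨x, hx, hx2⟩ := exists_notMem_maximalIdeal_sq hne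
    obtain ⟨h1, h2⟩ := isRegularLocalRing_quotient hx hx2
    rw [← IsRegularLocalRing.spanFinrank_maximalIdeal,
      ← IsRegularLocalRing.spanFinrank_maximalIdeal, hn] at h2
    have h3 : (maximalIdeal (A ⧸ Ideal.span {x})).spanFinrank + 1 = n + 1 := by exact_mod_cast h2
    have h4 : (maximalIdeal (A ⧸ Ideal.span {x})).spanFinrank = n := by omega
    have := (ih h4).comap (Ideal.Quotient.mk_surjective (I := Ideal.span {x}))
    rw [hn]
    refine ⟨x, hx, fun y hy => ?_, ?_⟩
    · have := IsRegularLocalRing.isDomain (A := A)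
      have hx0 : x ≠ 0 := fun h => hx2 (h ▸ Ideal.zero_mem _)
      simpa [hx0] using hy
    · rwa [bot_sup_eq, ← Ideal.mk_ker (I := Ideal.span {x}), ← h4]

end RegularLocal

/-- The entries of `l`, read from the end, form a weakly regular sequence. -/
def RegList {R : Type*} [CommRing R] : List R → Prop
  | [] => True
  | a :: l => RegList l ∧ RegularMod (Ideal.ofList l) a

section RegList

variable {R : Type*} [CommRing R]

theorem RegList.length_le_height [IsNoetherianRing R] {l : List R} (h : RegList l) {P : Ideal R}
    [hP : P.IsPrime] (hle : Ideal.ofList l ≤ P) : (l.length : ℕ∞) ≤ P.height := by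
  induction l generalizing P with
  | nil => simp
  | cons a l ih =>
    rw [Ideal.ofList_cons, sup_le_iff, Ideal.span_singleton_le_iff_mem] at hle
    obtain ⟨Q, hQ, hQP⟩ := Ideal.exists_minimalPrimes_le hle.2
    have hQp : Q.IsPrime := hQ.1.1
    have haQ : a ∉ Q := fun haQ => (assocMod_of_mem_minimalPrimes hQ).not_regularMod haQ h.2
    have hlt : Q < P := lt_of_le_of_ne hQP fun h => haQ (h ▸ hle.1)
    refine le_trans ?_ (Ideal.height_add_one_le_of_lt_of_isPrime hlt)
    rw [List.length_cons, Nat.cast_add, Nat.cast_one]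
    gcongr
    exact ih h.1 hQ.1.2

theorem algebraMap_mem_map_iff (M : Submonoid R) {S : Type*} [CommRing S] [Algebra R S]
    [IsLocalization M S] {I : Ideal R} {x : R} :
    algebraMap R S x ∈ I.map (algebraMap R S) ↔ ∃ s ∈ M, s * x ∈ I := by
  rw [← IsLocalization.mk'_one (M := M) S x, IsLocalization.mk'_mem_map_algebraMap_iff]

theorem RegularMod.map (M : Submonoid R) {S : Type*} [CommRing S] [Algebra R S]
    [IsLocalization M S] {I : Ideal R} {a : R} (h : RegularMod I a) :
    RegularMod (I.map (algebraMap R S)) (algebraMap R S a) := by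
  intro x hx
  obtain ⟨x, s, rfl⟩ := IsLocalization.exists_mk'_eq M x
  rw [IsLocalization.mul_mk'_eq_mk'_of_mul, IsLocalization.mk'_mem_map_algebraMap_iff] at hx
  obtain ⟨s, hs, hx⟩ := hx
  rw [IsLocalization.mk'_mem_map_algebraMap_iff]
  exact ⟨s, hs, h _ (by rwa [mul_left_comm])⟩

theorem AssocMod.map {I P : Ideal R} [hP : P.IsPrime] (h : AssocMod I P) :
    AssocMod (I.map (algebraMap R (Localization.AtPrime P)))
      (IsLocalRing.maximalIdeal (Localization.AtPrime P)) := by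
  obtain ⟨-, z, hz⟩ := h
  refine ⟨inferInstance, algebraMap _ _ z, fun x => ?_⟩
  obtain ⟨x, s, rfl⟩ := IsLocalization.exists_mk'_eq P.primeCompl x
  rw [IsLocalization.AtPrime.mk'_mem_maximal_iff _ P, hz, mul_comm (IsLocalization.mk' _ _ _),
    IsLocalization.mul_mk'_eq_mk'_of_mul, IsLocalization.mk'_mem_map_algebraMap_iff]
  constructor
  · intro hx
    exact ⟨1, one_mem _, by simpa [mul_comm] using hx⟩
  · rintro ⟨t, ht, htx⟩
    rw [← hz]
    refine (hP.mem_or_mem ((hz (t * x)).2 ?_)).resolve_left ht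
    convert htx using 1; ring

theorem RegList.depthMod_map [IsNoetherianRing R] {P : Ideal R} [P.IsPrime]
    [IsRegularLocalRing (Localization.AtPrime P)] {l : List R} (h : RegList l)
    (hle : Ideal.ofList l ≤ P) :
    ∃ k : ℕ, P.height = (k + l.length : ℕ) ∧
      DepthMod k ((Ideal.ofList l).map (algebraMap R (Localization.AtPrime P))) := by
  induction l with
  | nil =>
    refine ⟨(IsLocalRing.maximalIdeal (Localization.AtPrime P)).spanFinrank, ?_, ?_⟩
    · have h1 := IsRegularLocalRing.spanFinrank_maximalIdeal (R := Localization.AtPrime P)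
      rw [IsLocalization.AtPrime.ringKrullDim_eq_height P] at h1
      rw [List.length_nil, add_zero]
      exact_mod_cast h1.symm
    · rw [Ideal.ofList_nil, Ideal.map_bot]
      exact IsRegularLocalRing.depthMod_bot
  | cons a l ih =>
    rw [Ideal.ofList_cons, sup_le_iff, Ideal.span_singleton_le_iff_mem] at hle
    obtain ⟨k, hk, hd⟩ := ih h.1 hle.2
    obtain ⟨j, rfl, hd⟩ := hd.quotient_regular
      ((IsLocalization.AtPrime.to_map_mem_maximal_iff _ P a).2 hle.1) (h.2.map P.primeCompl)
    refine ⟨j, by rw [hk, List.length_cons]; congr 1; ring, ?_⟩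
    rwa [Ideal.ofList_cons, Ideal.map_sup, Ideal.map_span, Set.image_singleton, sup_comm]

theorem RegList.height_eq_of_assocMod [IsRegularRing R] {l : List R} (h : RegList l)
    {P : Ideal R} (hP : AssocMod (Ideal.ofList l) P) : P.height = l.length := by
  have := hP.1
  obtain ⟨k, hk, hd⟩ := h.depthMod_map hP.le
  have h0 := depthMod_zero_of_assocMod hP.map
  cases k with
  | zero => simpa using hk
  | succ k =>
    obtain ⟨x, hx, hr, -⟩ := hd
    exact absurd hr (h0.not_regularMod hx)

theorem RegList.isWeaklyRegular {l : List R} (h : RegList l) :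
    RingTheory.Sequence.IsWeaklyRegular R l.reverse := by
  induction l with
  | nil => exact RingTheory.Sequence.IsWeaklyRegular.nil R R
  | cons a l ih =>
    rw [List.reverse_cons, RingTheory.Sequence.isWeaklyRegular_append_iff,
      RingTheory.Sequence.isWeaklyRegular_singleton_iff]
    refine ⟨ih h.1, ?_⟩
    have heq : (Ideal.ofList l.reverse • ⊤ : Submodule R R) = Ideal.ofList l := by
      simp [Ideal.ofList]
    rw [heq, isSMulRegular_iff_right_eq_zero_of_smul]
    intro x hx
    obtain ⟨x, rfl⟩ := Submodule.Quotient.mk_surjective _ x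
    rw [← Submodule.Quotient.mk_smul, Submodule.Quotient.mk_eq_zero] at hx
    rw [Submodule.Quotient.mk_eq_zero]
    exact h.2 x hx

end RegList

section Serre

theorem IsRegularLocal.isRegularLocalRing {A : Type*} [CommRing A] (h : IsRegularLocal A) :
    IsRegularLocalRing A := by
  obtain ⟨_, _, s, hs, hcard⟩ := h
  refine IsRegularLocalRing.of_spanFinrank_maximalIdeal_le A ?_
  rw [← hcard, ← IsLocalRing.eq_maximalIdeal hs]
  have h1 := Submodule.spanFinrank_span_le_ncard_of_finite (R := A) s.finite_toSet
  rw [Set.ncard_coe_finset] at h1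
  exact WithBot.coe_le_coe.2 (Nat.cast_le.2 h1)

theorem IsRegularLocalRing.valuationRing {A : Type*} [CommRing A] [IsRegularLocalRing A]
    [IsDomain A] (h : ringKrullDim A ≤ 1) : ValuationRing A := by
  refine ((tfae_of_isNoetherianRing_of_isLocalRing_of_isDomain A).out 4 1).1 ?_
  rw [← IsRegularLocalRing.spanFinrank_maximalIdeal] at h
  have h1 : (IsLocalRing.maximalIdeal A).spanFinrank ≤ 1 := by exact_mod_cast h
  rcases h1.lt_or_eq with h1 | h1
  · rw [(Submodule.spanFinrank_eq_zero_iff_eq_bot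
      (IsNoetherian.noetherian (IsLocalRing.maximalIdeal A))).1 (by omega)]
    infer_instance
  · exact ((Submodule.spanFinrank_eq_one_iff _).1 h1).1

variable {R : Type*} [CommRing R]

theorem RegList.mem_of_forall_prime [IsRegularRing R] {l : List R}
    (h : RegList l) {a : R}
    (ha : ∀ P : Ideal R, P.IsPrime → Ideal.ofList l ≤ P → P.height = l.length →
      ∃ s ∉ P, s * a ∈ Ideal.ofList l) : a ∈ Ideal.ofList l := by
  by_contra hal
  obtain ⟨P, hP, hPa⟩ := exists_assocMod hal
  obtain ⟨s, hs, hsa⟩ := ha P hP.1 hP.le (h.height_eq_of_assocMod hP)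
  exact hs (hPa s hsa)

/-- In a quotient by a regular sequence satisfying Serre's condition `R_1`, the local rings at
primes of small height are valuation domains. -/
theorem RegList.exists_notMem_of_serreReg [IsNoetherianRing R] {l : List R} (h : RegList l)
    (hS : SerreReg 1 (R ⧸ Ideal.ofList l)) {P : Ideal R} (hP : P.IsPrime)
    (hle : Ideal.ofList l ≤ P) (hht : P.height ≤ (l.length + 1 : ℕ)) (a b : R) :
    (a * b ∈ Ideal.ofList l → ∃ s ∉ P, s * a ∈ Ideal.ofList l ∨ s * b ∈ Ideal.ofList l) ∧
    ∃ s ∉ P, ∃ c, s * a - c * b ∈ Ideal.ofList l ∨ s * b - c * a ∈ Ideal.ofList l := by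
  set I := Ideal.ofList l
  set f := Ideal.Quotient.mk I
  have hf : Function.Surjective f := Ideal.Quotient.mk_surjective
  have hPf : (P.map f).comap f = P := by
    rw [Ideal.comap_map_of_surjective' _ hf, Ideal.mk_ker, sup_eq_left.2 hle]
  have hp : (P.map f).IsPrime := Ideal.map_isPrime_of_surjective hf (by rwa [Ideal.mk_ker])
  let p : PrimeSpectrum (R ⧸ I) := ⟨P.map f, hp⟩
  have hpht : Order.height p ≤ 1 := by
    rw [← Nat.cast_one, Order.height_le_coe_iff]
    intro y hy
    rw [Nat.cast_one, Order.lt_one_iff, Order.height_eq_zero]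
    intro z hz
    by_contra hzy
    have hzy : z < y := lt_of_le_not_ge hz hzy
    have hlt : ∀ u v : PrimeSpectrum (R ⧸ I), u < v → u.asIdeal.comap f < v.asIdeal.comap f :=
      fun u v huv => (Ideal.orderEmbeddingOfSurjective f hf).strictMono huv
    have h1 := Ideal.height_add_one_le_of_lt_of_isPrime (hlt z y hzy)
    have h2 := Ideal.height_add_one_le_of_lt_of_isPrime (hlt y p hy)
    have h3 : (l.length : ℕ∞) ≤ (z.asIdeal.comap f).height :=
      h.length_le_height (by
        intro x hx
        rw [Ideal.mem_comap, show f x = 0 from Ideal.Quotient.eq_zero_iff_mem.2 hx]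
        exact Ideal.zero_mem _)
    have h4 : ((l.length + 2 : ℕ) : ℕ∞) ≤ (l.length + 1 : ℕ) := by
      refine le_trans ?_ hht
      rw [← hPf]
      refine le_trans ?_ h2
      refine le_trans ?_ (add_le_add_left h1 1)
      rw [add_assoc, one_add_one_eq_two, Nat.cast_add]
      exact add_le_add_left h3 _
    have : l.length + 2 ≤ l.length + 1 := by exact_mod_cast h4
    omega
  have hreg := (hS p (by simpa using hpht)).isRegularLocalRing
  have hdom := IsRegularLocalRing.isDomain (A := Localization.AtPrime p.asIdeal)
  have hdim : ringKrullDim (Localization.AtPrime p.asIdeal) ≤ 1 := by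
    rw [IsLocalization.AtPrime.ringKrullDim_eq_height p.asIdeal]
    rw [PrimeSpectrum.height_eq_orderHeight]
    exact_mod_cast hpht
  have hval := IsRegularLocalRing.valuationRing hdim
  let g := algebraMap (R ⧸ I) (Localization.AtPrime p.asIdeal)
  have hlift : ∀ x, g (f x) = 0 → ∃ s ∉ P, s * x ∈ I := by
    intro x hx
    obtain ⟨⟨s, hs⟩, hsx⟩ := (IsLocalization.map_eq_zero_iff p.asIdeal.primeCompl _ _).1 hx
    obtain ⟨s, rfl⟩ := hf s
    refine ⟨s, fun hsP => hs (Ideal.mem_map_of_mem _ hsP), ?_⟩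
    rwa [← Ideal.Quotient.eq_zero_iff_mem, map_mul]
  have hdvd : ∀ x y, g (f x) ∣ g (f y) → ∃ s ∉ P, ∃ c, s * y - c * x ∈ I := by
    rintro x y ⟨w, hw⟩
    obtain ⟨c, ⟨t, ht⟩, rfl⟩ := IsLocalization.exists_mk'_eq p.asIdeal.primeCompl w
    obtain ⟨c, rfl⟩ := hf c
    obtain ⟨t, rfl⟩ := hf t
    have : g (f (t * y - c * x)) = 0 := by
      simp only [map_sub, map_mul]
      rw [hw, mul_left_comm, IsLocalization.mk'_spec'_mk]
      ring
    obtain ⟨s, hs, h⟩ := hlift _ this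
    refine ⟨s * t, fun hst => ?_, s * c, by convert h using 1; ring⟩
    exact (hP.mem_or_mem hst).elim hs fun htP => ht (Ideal.mem_map_of_mem _ htP)
  constructor
  · intro hab
    have : g (f a) * g (f b) = 0 := by
      rw [← map_mul, ← map_mul, show f (a * b) = 0 from Ideal.Quotient.eq_zero_iff_mem.2 hab,
        map_zero]
    rcases mul_eq_zero.1 this with h | h
    · obtain ⟨s, hs, h⟩ := hlift _ h
      exact ⟨s, hs, Or.inl h⟩
    · obtain ⟨s, hs, h⟩ := hlift _ h
      exact ⟨s, hs, Or.inr h⟩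
  · rcases ValuationRing.dvd_total (g (f a)) (g (f b)) with h | h
    · obtain ⟨s, hs, c, h⟩ := hdvd _ _ h
      exact ⟨s, hs, c, Or.inr h⟩
    · obtain ⟨s, hs, c, h⟩ := hdvd _ _ h
      exact ⟨s, hs, c, Or.inl h⟩

end Serre

section Prime

variable {R : Type*} [CommRing R]

theorem RegList.isPrime_of_serreReg [IsRegularRing R] {l : List R} (h : RegList l)
    (hS : SerreReg 1 (R ⧸ Ideal.ofList l)) (htop : Ideal.ofList l ≠ ⊤)
    (hconn : ∀ t, t ^ 2 - t ∈ Ideal.ofList l → t ∈ Ideal.ofList l ∨ 1 - t ∈ Ideal.ofList l) :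
    (Ideal.ofList l).IsPrime := by
  refine ⟨htop, fun {x y} hxy => ?_⟩
  by_contra! hne
  classical
  obtain ⟨hx, hy⟩ := hne
  set I := Ideal.ofList l with hI
  let 𝔞 : Ideal R := I.colon {x}
  let 𝔟 : Ideal R := I.colon 𝔞
  have ha' : ∀ {a}, a ∈ 𝔞 ↔ a * x ∈ I := fun {a} => Submodule.mem_colon_singleton
  have hb' : ∀ {b}, b ∈ 𝔟 ↔ ∀ a ∈ 𝔞, b * a ∈ I := fun {b} => Submodule.mem_colon
  have hya : y ∈ 𝔞 := ha'.2 (by rwa [mul_comm])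
  have hnle : ∀ P ∈ {P | AssocMod I P}, ¬ 𝔞 ⊔ 𝔟 ≤ P := by
    intro P hP hle
    have hPp : P.IsPrime := hP.1
    have hht : P.height ≤ (l.length + 1 : ℕ) := by
      rw [h.height_eq_of_assocMod hP]; exact_mod_cast Nat.le_succ _
    have hloc := fun a b => (h.exists_notMem_of_serreReg hS hPp hP.le hht a b).1
    by_cases hsx : ∃ s ∉ P, s * x ∈ I
    · obtain ⟨s, hs, hsx⟩ := hsx
      exact hs (hle (le_sup_left (b := 𝔟) (ha'.2 hsx)))
    · push Not at hsx
      have hs : ∀ a ∈ 𝔞, ∃ s ∉ P, s * a ∈ I := by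
        intro a haa
        obtain ⟨s, hs, h1 | h1⟩ := hloc _ _ (ha'.1 haa)
        · exact ⟨s, hs, h1⟩
        · exact absurd h1 (hsx s hs)
      obtain ⟨S, hS⟩ := (IsNoetherian.noetherian 𝔞 : 𝔞.FG)
      have hS' : ∀ a : R, ∃ s ∉ P, a ∈ S → s * a ∈ I := by
        intro a
        by_cases haS : a ∈ S
        · obtain ⟨s, hs, h1⟩ := hs a (hS ▸ Submodule.subset_span haS)
          exact ⟨s, hs, fun _ => h1⟩
        · exact ⟨1, fun h1 => hPp.ne_top ((Ideal.eq_top_iff_one _).2 h1), fun h1 => absurd h1 haS⟩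
      choose σ hσ hσS using hS'
      have hmem : (∏ a ∈ S, σ a) ∈ 𝔟 := by
        rw [hb']
        intro a haa
        have hle' : 𝔞 ≤ I.colon {∏ a ∈ S, σ a} := by
          rw [← hS, Ideal.span_le]
          intro z hz
          rw [SetLike.mem_coe, Submodule.mem_colon_singleton, smul_eq_mul,
            ← Finset.mul_prod_erase S σ hz, ← mul_assoc, mul_comm z]
          exact I.mul_mem_right _ (hσS z hz)
        have := Submodule.mem_colon_singleton.1 (hle' haa)
        rwa [smul_eq_mul, mul_comm] at this
      have := hle (le_sup_right (a := 𝔞) hmem)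
      obtain ⟨a, -, h1⟩ := (Ideal.IsPrime.prod_mem_iff).1 this
      exact hσ a h1
  have havoid : ¬ (((𝔞 ⊔ 𝔟 : Ideal R) : Set R) ⊆ ⋃ P ∈ {P | AssocMod I P}, (P : Set R)) := by
    rw [Ideal.subset_union_prime_finite (finite_assocMod I) (f := fun P => P) ⊤ ⊤
      fun P hP _ _ => hP.1]
    rintro ⟨P, hP, hle⟩
    exact hnle P hP hle
  obtain ⟨c, hc, hcP⟩ := Set.not_subset.1 havoid
  simp only [Set.mem_iUnion, not_exists] at hcP
  have hcI : RegularMod I c := regularMod_of_forall_notMem fun P hP hcP' => hcP P hP hcP'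
  obtain ⟨a, haa, b, hbb, rfl⟩ := Submodule.mem_sup.1 hc
  have hba : b * a ∈ I := hb'.1 hbb a haa
  have hcl : RegList ((a + b) :: l) := ⟨h, hcI⟩
  have hat : a ∈ I ⊔ Ideal.span {a + b} := by
    rw [sup_comm, hI, ← Ideal.ofList_cons]
    apply hcl.mem_of_forall_prime
    intro P hP hle hht
    rw [Ideal.ofList_cons] at hle ⊢
    obtain ⟨s, hs, h1 | h1⟩ :=
      (h.exists_notMem_of_serreReg hS hP (le_sup_right.trans hle) hht.le b a).1 hba
    · refine ⟨s, hs, ?_⟩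
      have : s * a = s * (a + b) - s * b := by ring
      rw [this]
      exact Ideal.sub_mem _ (Ideal.mul_mem_left _ _
        (le_sup_left (a := Ideal.span {a + b}) (Ideal.mem_span_singleton_self _)))
        (le_sup_right (a := Ideal.span {a + b}) h1)
    · exact ⟨s, hs, le_sup_right (a := Ideal.span {a + b}) h1⟩
  obtain ⟨t, ht⟩ := mem_sup_span_singleton.1 hat
  have htt : t ^ 2 - t ∈ I := by
    apply hcI
    apply hcI
    have : (a + b) * ((a + b) * (t ^ 2 - t)) =
      (a - t * (a + b)) * ((a + b) - a - t * (a + b)) - b * a := by ring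
    rw [this]
    exact I.sub_mem (I.mul_mem_right _ ht) hba
  rcases hconn t htt with h1 | h1
  · refine hy (hcI y ?_)
    have : (a + b) * y = (a - t * (a + b)) * y + t * ((a + b) * y) + b * y := by ring
    rw [this]
    exact I.add_mem (I.add_mem (I.mul_mem_right _ ht) (I.mul_mem_right _ h1)) (hb'.1 hbb y hya)
  · refine hx (hcI x ?_)
    have : (a + b) * x = a * x - (a - t * (a + b)) * x + (1 - t) * ((a + b) * x) := by ring
    rw [this]
    exact I.add_mem (I.sub_mem (ha'.1 haa) (I.mul_mem_right _ ht)) (I.mul_mem_right _ h1)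

end Prime

section Homogeneous

attribute [local instance] MvPolynomial.gradedAlgebra

variable {σ K : Type*} [Field K]

theorem MvPolynomial.mem_of_sub_pow_mem {I : Ideal (MvPolynomial σ K)}
    (hI : I.IsHomogeneous (homogeneousSubmodule σ K)) {t : MvPolynomial σ K}
    (ht0 : constantCoeff t = 0) (ht : t ^ 2 - t ∈ I) : t ∈ I := by
  have hpow : ∀ k, t - t ^ (k + 1) ∈ I := by
    intro k
    induction k with
    | zero => simp
    | succ k ih =>
      have : t - t ^ (k + 1 + 1) = (t - t ^ (k + 1)) - t ^ k * (t ^ 2 - t) := by ring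
      rw [this]
      exact I.sub_mem ih (I.mul_mem_left _ ht)
  have htv : t ∈ idealOfVars σ K ^ 1 := by
    rw [mem_pow_idealOfVars_iff']
    intro x hx
    rw [Nat.lt_one_iff, Finsupp.degree_eq_zero_iff] at hx
    rwa [hx]
  rw [pow_one] at htv
  rw [← sum_homogeneousComponent t]
  refine I.sum_mem fun k _ => ?_
  have h0 : homogeneousComponent k (t ^ (k + 1)) = 0 := by
    refine homogeneousComponent_eq_zero' _ _ fun x hx hxk => ?_
    refine (mem_support_iff.1 hx) ?_
    exact (mem_pow_idealOfVars_iff' _ _).1 (Ideal.pow_mem_pow htv (k + 1)) x (by omega)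
  have := homogeneousComponent_mem_of_mem hI (hpow k) k
  rwa [map_sub, h0, sub_zero] at this

theorem MvPolynomial.mem_or_one_sub_mem {I : Ideal (MvPolynomial σ K)}
    (hI : I.IsHomogeneous (homogeneousSubmodule σ K)) (hI0 : ∀ f ∈ I, constantCoeff f = 0)
    {t : MvPolynomial σ K} (ht : t ^ 2 - t ∈ I) : t ∈ I ∨ 1 - t ∈ I := by
  have h := hI0 _ ht
  have h' : constantCoeff t * (1 - constantCoeff t) = 0 := by
    rw [map_sub, map_pow] at h
    linear_combination -h
  rcases mul_eq_zero.1 h' with h1 | h1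
  · exact Or.inl (mem_of_sub_pow_mem hI h1 ht)
  · refine Or.inr (mem_of_sub_pow_mem hI (by simpa using h1) ?_)
    convert ht using 1; ring

end Homogeneous

section SerreSeq

attribute [local instance] MvPolynomial.gradedAlgebra

theorem SerreReg.mono {η η' : ℕ} (hle : η ≤ η') {S : Type*} [CommRing S] (h : SerreReg η' S) :
    SerreReg η S :=
  fun p hp => h p (hp.trans (by exact_mod_cast hle))

variable {σ K : Type*} [Field K]

theorem MvPolynomial.isHomogeneous_span {s : Set (MvPolynomial σ K)}
    (h : ∀ f ∈ s, ∃ e, f.IsHomogeneous e) :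
    (Ideal.span s).IsHomogeneous (homogeneousSubmodule σ K) :=
  Ideal.homogeneous_span _ _ fun f hf => h f hf

theorem MvPolynomial.constantCoeff_eq_zero_of_mem_span {s : Set (MvPolynomial σ K)}
    (h : ∀ f ∈ s, ∃ e, 0 < e ∧ f.IsHomogeneous e) {f : MvPolynomial σ K}
    (hf : f ∈ Ideal.span s) : constantCoeff f = 0 := by
  have : Ideal.span s ≤ RingHom.ker (constantCoeff (σ := σ) (R := K)) := by
    rw [Ideal.span_le]
    intro f hf
    obtain ⟨e, he, hfe⟩ := h f hf
    exact hfe.coeff_eq_zero (by simpa using he.ne)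
  exact this hf

theorem IsSerreSeq.exists_regList [Finite σ] {n : ℕ} {y : Fin n → MvPolynomial σ K}
    (hy : IsSerreSeq 3 y) (hyh : ∀ j, ∃ e, 0 < e ∧ (y j).IsHomogeneous e) :
    ∃ l : List (MvPolynomial σ K), RegList l ∧ l.length ≤ n ∧ (∀ z ∈ l, z ∈ Set.range y) ∧
      Ideal.ofList l = Ideal.span (Set.range y) ∧ (Ideal.ofList l).IsPrime ∧
      SerreReg 1 (MvPolynomial σ K ⧸ Ideal.ofList l) := by
  have hprime : ∀ m ≤ n, ∀ l : List (MvPolynomial σ K), RegList l →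
      Ideal.ofList l = Ideal.span (y '' {j | (j : ℕ) < m}) →
      (Ideal.ofList l).IsPrime ∧ SerreReg 1 (MvPolynomial σ K ⧸ Ideal.ofList l) := by
    intro m hm l h1 h4
    have hSm := (hy.2 m hm).mono (show 1 ≤ 3 by norm_num)
    have hh : ∀ f ∈ y '' {j | (j : ℕ) < m}, ∃ e, 0 < e ∧ f.IsHomogeneous e := by
      rintro _ ⟨j, -, rfl⟩
      exact hyh j
    have h5 : SerreReg 1 (MvPolynomial σ K ⧸ Ideal.ofList l) := by rwa [h4]
    refine ⟨h1.isPrime_of_serreReg h5 ?_ ?_, h5⟩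
    · rw [h4]
      intro htop
      exact hy.1 (top_le_iff.1 (htop ▸ Ideal.span_mono (Set.image_subset_range _ _)))
    · intro t ht
      rw [h4] at ht ⊢
      refine mem_or_one_sub_mem (isHomogeneous_span fun f hf => ?_)
        (fun f hf => constantCoeff_eq_zero_of_mem_span hh hf) ht
      obtain ⟨e, -, he⟩ := hh f hf
      exact ⟨e, he⟩
  have key : ∀ m ≤ n, ∃ l : List (MvPolynomial σ K), RegList l ∧ l.length ≤ m ∧
      (∀ z ∈ l, z ∈ Set.range y) ∧ Ideal.ofList l = Ideal.span (y '' {j | (j : ℕ) < m}) := by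
    intro m
    induction m with
    | zero => exact fun _ => ⟨[], trivial, le_rfl, by simp, by simp⟩
    | succ m ih =>
      intro hm
      obtain ⟨l, h1, h2, h3, h4⟩ := ih (by omega)
      have hset : {j : Fin n | (j : ℕ) < m + 1} = insert ⟨m, hm⟩ {j : Fin n | (j : ℕ) < m} := by
        ext j
        simp only [Set.mem_ofPred_eq, Set.mem_insert_iff, Fin.ext_iff]
        omega
      have hspan : Ideal.span (y '' {j | (j : ℕ) < m + 1}) =
          Ideal.span {y ⟨m, hm⟩} ⊔ Ideal.ofList l := by
        rw [hset, Set.image_insert_eq, Ideal.span_insert, h4]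
      by_cases hmem : y ⟨m, hm⟩ ∈ Ideal.ofList l
      · exact ⟨l, h1, by omega, h3, by
          rw [hspan, sup_eq_right.2 ((Ideal.span_singleton_le_iff_mem _).2 hmem)]⟩
      · refine ⟨y ⟨m, hm⟩ :: l, ⟨h1, fun x hx => ?_⟩, by simpa using h2, ?_, ?_⟩
        · exact ((hprime m (by omega) l h1 h4).1.mem_or_mem hx).resolve_left hmem
        · simpa using h3
        · rw [hspan, Ideal.ofList_cons]
  obtain ⟨l, h1, h2, h3, h4⟩ := key n le_rfl
  refine ⟨l, h1, h2, h3, ?_, hprime n le_rfl l h1 h4⟩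
  rw [h4]
  congr 1
  ext z
  simp

end SerreSeq

section Differential

theorem minpoly_eq_X_pow_sub_C {M L : Type*} [Field M] [Field L] [Algebra M L] {p : ℕ}
    (hp : p.Prime) [CharP L p] {w : L} {a : M} (ha : w ^ p = algebraMap M L a)
    (hw : w ∉ Set.range (algebraMap M L)) :
    minpoly M w = Polynomial.X ^ p - Polynomial.C a := by
  have := Fact.mk hp
  refine (minpoly.eq_of_irreducible_of_monic (X_pow_sub_C_irreducible_of_prime hp ?_) ?_
    (Polynomial.monic_X_pow_sub_C a hp.ne_zero)).symm
  · intro b hb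
    refine hw ⟨b, frobenius_inj L p ?_⟩
    simp only [frobenius_def]
    rw [ha, ← hb, map_pow]
  · simp [ha]

/-- In characteristic `p`, an element of a field `L` with vanishing differential over a subfield
consisting of `p`-th powers is a `p`-th power. -/
theorem exists_pow_eq_of_D_eq_zero {K L : Type*} [Field K] [Field L] [Algebra K L] {p : ℕ}
    (hp : p.Prime) [CharP L p] (hK : ∀ k : K, ∃ x : L, x ^ p = algebraMap K L k) {z : L}
    (hz : KaehlerDifferential.D K L z = 0) : ∃ w, w ^ p = z := by
  have := Fact.mk hp
  by_contra hcon
  let S : Set (IntermediateField K L) := {M | (∀ w : L, w ^ p ∈ M) ∧ z ∉ M}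
  let M₀ : IntermediateField K L := (frobenius L p).fieldRange.toIntermediateField (by
    intro k
    obtain ⟨x, hx⟩ := hK k
    exact ⟨x, hx⟩)
  have hM₀ : M₀ ∈ S := ⟨fun w => ⟨w, rfl⟩, fun ⟨w, hw⟩ => hcon ⟨w, hw⟩⟩
  obtain ⟨M, -, hM⟩ := zorn_le_nonempty₀ S (by
    intro c hc hchain y hy
    have : Nonempty c := ⟨⟨y, hy⟩⟩
    have hdir : Directed (· ≤ ·) (fun i : c => (i : IntermediateField K L)) :=
      hchain.directed
    have hmem : ∀ x : L, x ∈ (⨆ i : c, (i : IntermediateField K L)) ↔ ∃ i : c, x ∈ i.1 := by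
      intro x
      rw [← SetLike.mem_coe, IntermediateField.coe_iSup_of_directed hdir]
      simp
    refine ⟨⨆ i : c, (i : IntermediateField K L), ⟨fun w => ?_, fun h => ?_⟩, fun i hi => ?_⟩
    · exact (hmem _).2 ⟨⟨y, hy⟩, (hc hy).1 w⟩
    · obtain ⟨i, hi⟩ := (hmem _).1 h
      exact (hc i.2).2 hi
    · exact le_iSup (fun i : c => (i : IntermediateField K L)) ⟨i, hi⟩) M₀ hM₀
  have hpow : ∀ w : L, w ^ p ∈ M := hM.1.1
  have hzM : z ∉ M := hM.1.2
  have hmin : ∀ w : L, w ∉ M →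
      minpoly M w = Polynomial.X ^ p - Polynomial.C (⟨w ^ p, hpow w⟩ : M) := by
    intro w hw
    refine minpoly_eq_X_pow_sub_C hp rfl ?_
    rintro ⟨b, rfl⟩
    exact hw b.2
  have hint : ∀ w : L, IsIntegral M w := by
    intro w
    refine ⟨Polynomial.X ^ p - Polynomial.C (⟨w ^ p, hpow w⟩ : M),
      Polynomial.monic_X_pow_sub_C _ hp.ne_zero, ?_⟩
    simp
  have hfin : ∀ w : L, w ∉ M → Module.finrank M (IntermediateField.adjoin M {w}) = p := by
    intro w hw
    rw [IntermediateField.adjoin.finrank (hint w), hmin w hw, Polynomial.natDegree_X_pow_sub_C]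
  have htop : ∀ w : L, w ∈ IntermediateField.adjoin M {z} := by
    intro w
    by_cases hw : w ∈ M
    · exact (IntermediateField.adjoin M {z}).algebraMap_mem ⟨w, hw⟩
    · have hzw : z ∈ IntermediateField.adjoin M {w} := by
        by_contra hzw
        have hle : M ≤ (IntermediateField.adjoin M {w}).restrictScalars K := fun x hx =>
          (IntermediateField.adjoin M {w}).algebraMap_mem ⟨x, hx⟩
        have := hM.2 (y := (IntermediateField.adjoin M {w}).restrictScalars K)
          ⟨fun x => hle (hpow x), hzw⟩ hle
        exact hw (this (IntermediateField.mem_adjoin_simple_self M w))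
      have := IntermediateField.adjoin.finiteDimensional (hint w)
      have heq : IntermediateField.adjoin M {z} = IntermediateField.adjoin M {w} := by
        refine IntermediateField.eq_of_le_of_finrank_eq ?_ ((hfin z hzM).trans (hfin w hw).symm)
        simpa using hzw
      rw [heq]
      exact IntermediateField.mem_adjoin_simple_self M w
  have hadj : IntermediateField.adjoin M {z} = ⊤ := by
    ext w
    simpa using htop w
  have hadj' : Algebra.adjoin M {z} = ⊤ := by
    rw [← IntermediateField.adjoin_simple_toSubalgebra_of_isAlgebraic (hint z).isAlgebraic, hadj]
    rfl
  have : FiniteDimensional M L := by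
    have := IntermediateField.adjoin.finiteDimensional (hint z)
    rw [hadj] at this
    exact Module.Finite.equiv (IntermediateField.topEquiv (F := M) (E := L)).toLinearEquiv
  have hDz : KaehlerDifferential.D M L z = 0 := by
    have := KaehlerDifferential.map_D K M L L z
    rw [hz, map_zero] at this
    exact this.symm
  have hD : KaehlerDifferential.D M L = 0 :=
    Derivation.ext_of_adjoin_eq_top {z} hadj' (by simpa using hDz)
  have : Subsingleton (Ω[L⁄M]) := by
    rw [← Submodule.subsingleton_iff L, ← subsingleton_iff_bot_eq_top,
      ← KaehlerDifferential.span_range_derivation, hD]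
    symm
    rw [Submodule.span_eq_bot]
    rintro _ ⟨x, rfl⟩
    rfl
  have : Algebra.FormallyUnramified M L := ⟨this⟩
  have := Algebra.FormallyUnramified.isSeparable M L
  have hsep := Algebra.IsSeparable.isSeparable M z
  rw [IsSeparable, hmin z hzM] at hsep
  have hpM : (p : M) = 0 := by
    apply (algebraMap M L).injective
    simp
  have hder : Polynomial.derivative
      (Polynomial.X ^ p - Polynomial.C (⟨z ^ p, hpow z⟩ : M)) = 0 := by
    rw [Polynomial.derivative_sub, Polynomial.derivative_C, Polynomial.derivative_X_pow, hpM]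
    simp
  rw [Polynomial.Separable, hder, isCoprime_zero_right] at hsep
  have hdeg := Polynomial.natDegree_eq_zero_of_isUnit hsep
  rw [Polynomial.natDegree_X_pow_sub_C] at hdeg
  exact hp.ne_zero hdeg

variable {K σ : Type*} [Field K]

theorem MvPolynomial.derivation_eq_zero {M : Type*} [AddCommGroup M]
    [Module (MvPolynomial σ K) M] [Module K M] [IsScalarTower K (MvPolynomial σ K) M]
    [Fintype σ] (δ : Derivation K (MvPolynomial σ K) M) {f : MvPolynomial σ K}
    (hf : ∀ i, pderiv i f • δ (X i) = 0) : δ f = 0 := by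
  classical
  have hsum : ∀ (D : σ → Derivation K (MvPolynomial σ K) M) g, (∑ i, D i) g = ∑ i, D i g :=
    fun D g => by
      change Derivation.coeFnAddMonoidHom (∑ i, D i) g = _
      rw [map_sum, Finset.sum_apply]
      rfl
  have h : δ = ∑ i, ((LinearMap.toSpanSingleton (MvPolynomial σ K) M (δ (X i))).compDer
      (pderiv i)) := by
    refine MvPolynomial.derivation_ext fun j => ?_
    rw [hsum]
    simp [pderiv_X, Pi.single_apply]
  rw [h, hsum]
  exact Finset.sum_eq_zero fun i _ => hf i

theorem MvPolynomial.apply_eq_zero_of_formallySmooth [Fintype σ] {B κ : Type*} [CommRing B]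
    [CommRing κ] [Algebra K B] [Algebra K κ] [Algebra.FormallySmooth K κ] (g : B →ₐ[K] κ)
    (hg : Function.Surjective g) (hker : ∀ x y : B, g x = 0 → g y = 0 → x * y = 0)
    (φ : MvPolynomial σ K →ₐ[K] B) {f : MvPolynomial σ K} (hf : g (φ f) = 0)
    (hd : ∀ i, g (φ (pderiv i f)) = 0) : φ f = 0 := by
  have hnil : IsNilpotent (RingHom.ker (g : B →+* κ)) := by
    refine ⟨2, ?_⟩
    rw [pow_two, Ideal.zero_eq_bot, eq_bot_iff, Ideal.mul_le]
    exact fun x hx y hy => hker x y hx hy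
  let τ : κ →ₐ[K] B := Algebra.FormallySmooth.liftOfSurjective (AlgHom.id K κ) g hg hnil
  have hτ : ∀ x, g (τ x) = x := fun x =>
    Algebra.FormallySmooth.liftOfSurjective_apply (AlgHom.id K κ) g hg hnil x
  let ψ : MvPolynomial σ K →ₐ[K] B := τ.comp (g.comp φ)
  have hφψ : ∀ r, g (φ r - ψ r) = 0 := fun r => by
    rw [map_sub, sub_eq_zero]
    exact (hτ _).symm
  algebraize [φ.toRingHom]
  have : IsScalarTower K (MvPolynomial σ K) B := .of_algHom φ
  let δ : Derivation K (MvPolynomial σ K) B := Derivation.mk'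
    (φ.toLinearMap - ψ.toLinearMap) (by
      intro a b
      have h := hker _ _ (hφψ a) (hφψ b)
      simp only [LinearMap.sub_apply, AlgHom.toLinearMap_apply, map_mul, Algebra.smul_def]
      change φ a * φ b - ψ a * ψ b = φ a * (φ b - ψ b) + φ b * (φ a - ψ a)
      linear_combination (-1 : B) * h)
  have hδf : δ f = 0 := MvPolynomial.derivation_eq_zero δ fun i => by
    rw [Algebra.smul_def]
    exact hker _ _ (hd i) (hφψ _)
  have : φ f - τ (g (φ f)) = 0 := hδf
  rwa [hf, map_zero, sub_zero] at this

theorem MvPolynomial.apply_mem_sq [Fintype σ] {A : Type*} [CommRing A] [Algebra K A]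
    (m : Ideal A) [Algebra.FormallySmooth K (A ⧸ m)] (φ : MvPolynomial σ K →ₐ[K] A)
    {f : MvPolynomial σ K} (hf : φ f ∈ m) (hd : ∀ i, φ (pderiv i f) ∈ m) : φ f ∈ m ^ 2 := by
  have hle : m ^ 2 ≤ m := Ideal.pow_le_self two_ne_zero
  have hker : ∀ x y : A ⧸ m ^ 2, Ideal.Quotient.factorₐ K hle x = 0 →
      Ideal.Quotient.factorₐ K hle y = 0 → x * y = 0 := by
    intro x y hx hy
    obtain ⟨x, rfl⟩ := Ideal.Quotient.mk_surjective x
    obtain ⟨y, rfl⟩ := Ideal.Quotient.mk_surjective y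
    rw [← map_mul, Ideal.Quotient.eq_zero_iff_mem, pow_two]
    exact Ideal.mul_mem_mul ((Ideal.Quotient.eq_zero_iff_mem (I := m)).1 hx)
      ((Ideal.Quotient.eq_zero_iff_mem (I := m)).1 hy)
  exact Ideal.Quotient.eq_zero_iff_mem.1 (MvPolynomial.apply_eq_zero_of_formallySmooth
    (Ideal.Quotient.factorₐ K hle) (Ideal.Quotient.factor_surjective hle) hker
    ((Ideal.Quotient.mkₐ K (m ^ 2)).comp φ) (Ideal.Quotient.eq_zero_iff_mem.2 hf)
    (fun i => Ideal.Quotient.eq_zero_iff_mem.2 (hd i)))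

/-- A form of the Jacobian criterion: over a perfect field, an element of a prime `Q` all of whose
partial derivatives lie in `Q` belongs to the square of `Q` locally at `Q`. -/
theorem MvPolynomial.exists_mul_mem_sq [PerfectField K] [Fintype σ]
    {Q : Ideal (MvPolynomial σ K)} [Q.IsPrime] {f : MvPolynomial σ K} (hf : f ∈ Q)
    (hd : ∀ i, pderiv i f ∈ Q) : ∃ s ∉ Q, s * f ∈ Q ^ 2 := by
  have hmem : ∀ r ∈ Q, algebraMap (MvPolynomial σ K) (Localization.AtPrime Q) r ∈
      IsLocalRing.maximalIdeal (Localization.AtPrime Q) := fun r hr =>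
    (IsLocalization.AtPrime.to_map_mem_maximal_iff _ Q r).2 hr
  have : Algebra.EssFiniteType K (Localization.AtPrime Q) :=
    .comp K (MvPolynomial σ K) _
  have : Algebra.EssFiniteType K (IsLocalRing.ResidueField (Localization.AtPrime Q)) :=
    .comp K (Localization.AtPrime Q) _
  have : Algebra.FormallySmooth K
      (Localization.AtPrime Q ⧸ IsLocalRing.maximalIdeal (Localization.AtPrime Q)) :=
    inferInstanceAs (Algebra.FormallySmooth K
      (IsLocalRing.ResidueField (Localization.AtPrime Q)))
  have hfm := MvPolynomial.apply_mem_sq (IsLocalRing.maximalIdeal (Localization.AtPrime Q))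
    (IsScalarTower.toAlgHom K (MvPolynomial σ K) (Localization.AtPrime Q)) (hmem _ hf)
    (fun i => hmem _ (hd i))
  rw [← Localization.AtPrime.map_eq_maximalIdeal, ← Ideal.map_pow] at hfm
  exact (algebraMap_mem_map_iff Q.primeCompl).1 hfm

theorem MvPolynomial.exists_pow_mul_sub_pow_mem {p : ℕ} (hp : p.Prime) [CharP K p]
    [PerfectField K] [Fintype σ]
    {Q : Ideal (MvPolynomial σ K)} [Q.IsPrime] {f : MvPolynomial σ K}
    (hd : ∀ i, pderiv i f ∈ Q) : ∃ a b, b ∉ Q ∧ b ^ p * f - a ^ p ∈ Q := by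
  let S := MvPolynomial σ K ⧸ Q
  let L := FractionRing S
  have := Fact.mk hp
  have : ExpChar K p := .prime hp
  have : PerfectRing K p := PerfectField.toPerfectRing p
  have : CharP L p := charP_of_injective_algebraMap (algebraMap K L).injective p
  let φ : MvPolynomial σ K →ₐ[K] L := IsScalarTower.toAlgHom K (MvPolynomial σ K) L
  have hφ : ∀ r, φ r = 0 ↔ r ∈ Q := fun r => by
    rw [← Ideal.Quotient.eq_zero_iff_mem]
    exact (FaithfulSMul.algebraMap_eq_zero_iff S L)
  have hz : KaehlerDifferential.D K L (φ f) = 0 := by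
    let δ := (KaehlerDifferential.D K L).compAlgebraMap (MvPolynomial σ K)
    refine MvPolynomial.derivation_eq_zero δ fun i => ?_
    rw [← algebraMap_smul L, show algebraMap (MvPolynomial σ K) L (pderiv i f) = 0 from
      (hφ _).2 (hd i), zero_smul]
  obtain ⟨w, hw⟩ := exists_pow_eq_of_D_eq_zero hp (fun k => by
    obtain ⟨x, hx⟩ := surjective_frobenius K p k
    exact ⟨algebraMap K L x, by rw [← hx, frobenius_def, map_pow]⟩) hz
  obtain ⟨a, b, hb, rfl⟩ := IsFractionRing.div_surjective (A := S) w
  obtain ⟨a, rfl⟩ := Ideal.Quotient.mk_surjective a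
  obtain ⟨b, rfl⟩ := Ideal.Quotient.mk_surjective b
  have hbQ : b ∉ Q := fun h =>
    nonZeroDivisors.ne_zero hb (Ideal.Quotient.eq_zero_iff_mem.2 h)
  refine ⟨a, b, hbQ, (hφ _).1 ?_⟩
  have hb0 : φ b ≠ 0 := fun h => hbQ ((hφ b).1 h)
  have hw' : (φ a / φ b) ^ p = φ f := hw
  rw [map_sub, map_mul, map_pow, map_pow, ← hw', ← mul_pow, mul_div_cancel₀ _ hb0, sub_self]

end Differential

section Hypersurface

theorem IsRegularLocalRing.isRegularLocal {A : Type*} [CommRing A] [IsRegularLocalRing A] :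
    IsRegularLocal A := by
  obtain ⟨s, hs, hspan⟩ := Submodule.FG.exists_span_finset_card_eq_spanFinrank
    (IsNoetherian.noetherian (IsLocalRing.maximalIdeal A))
  have hspan' : Ideal.span (s : Set A) = IsLocalRing.maximalIdeal A := hspan
  refine ⟨inferInstance, inferInstance, s, ?_, ?_⟩
  · rw [hspan']
    infer_instance
  · rw [hs, ← IsRegularLocalRing.spanFinrank_maximalIdeal]
    rfl

theorem isRegularLocal_localization_quotient {R : Type*} [CommRing R] [IsRegularRing R] {F : R}
    (p : Ideal (R ⧸ Ideal.span {F})) [p.IsPrime]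
    (h : ∀ s ∉ p.comap (Ideal.Quotient.mk (Ideal.span {F})),
      s * F ∉ (p.comap (Ideal.Quotient.mk (Ideal.span {F}))) ^ 2) :
    IsRegularLocal (Localization.AtPrime p) := by
  set P := p.comap (Ideal.Quotient.mk (Ideal.span {F})) with hP
  have hPp : P.IsPrime := Ideal.comap_isPrime _ _
  let A := Localization.AtPrime P
  let x : A := algebraMap R A F
  have hFP : F ∈ P := by
    rw [hP, Ideal.mem_comap, Ideal.Quotient.eq_zero_iff_mem.2 (Ideal.mem_span_singleton_self F)]
    exact p.zero_mem
  have hx : x ∈ IsLocalRing.maximalIdeal A :=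
    (IsLocalization.AtPrime.to_map_mem_maximal_iff A P F).2 hFP
  have hx2 : x ∉ IsLocalRing.maximalIdeal A ^ 2 := by
    rw [← Localization.AtPrime.map_eq_maximalIdeal, ← Ideal.map_pow]
    intro hmem
    obtain ⟨s, hs, hsF⟩ := (algebraMap_mem_map_iff P.primeCompl).1 hmem
    exact h s hs hsF
  have hreg : IsRegularLocalRing A := inferInstance
  have hquot := (isRegularLocalRing_quotient hx hx2).1
  have hspan : (Ideal.span {F}).map (algebraMap R A) = Ideal.span {x} := by
    rw [Ideal.map_span, Set.image_singleton]
  rw [← hspan] at hquot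
  have hM : Algebra.algebraMapSubmonoid (R ⧸ Ideal.span {F}) P.primeCompl = p.primeCompl := by
    ext y
    constructor
    · rintro ⟨r, hr, rfl⟩
      exact hr
    · obtain ⟨r, rfl⟩ := Ideal.Quotient.mk_surjective y
      exact fun hr => ⟨r, hr, rfl⟩
  have hloc : IsLocalization p.primeCompl (A ⧸ (Ideal.span {F}).map (algebraMap R A)) := by
    rw [← hM]
    infer_instance
  have e := (IsLocalization.algEquiv p.primeCompl
    (A ⧸ (Ideal.span {F}).map (algebraMap R A)) (Localization.AtPrime p)).toRingEquiv
  have := IsRegularLocalRing.of_ringEquiv e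
  exact IsRegularLocalRing.isRegularLocal

end Hypersurface

section MaximalRegList

variable {R : Type*} [CommRing R]

theorem RegList.mem_minimalPrimes_of_assocMod [IsRegularRing R] {l : List R} (h : RegList l)
    {P : Ideal R} (hP : AssocMod (Ideal.ofList l) P) : P ∈ (Ideal.ofList l).minimalPrimes := by
  have := hP.1
  obtain ⟨p, hp, hpP⟩ := Ideal.exists_minimalPrimes_le hP.le
  have hpp := hp.1.1
  rcases hpP.eq_or_lt with rfl | hlt
  · exact hp
  · have h1 := Ideal.height_add_one_le_of_lt_of_isPrime hlt
    rw [h.height_eq_of_assocMod hP, h.height_eq_of_assocMod (assocMod_of_mem_minimalPrimes hp)]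
      at h1
    norm_cast at h1
    omega

theorem exists_regList_forall_not_regularMod [IsNoetherianRing R] {S : Set R} {P : Ideal R}
    [P.IsPrime] (hS : ∀ v ∈ S, v ∈ P) :
    ∃ l : List R, RegList l ∧ (∀ z ∈ l, z ∈ S) ∧ ∀ v ∈ S, ¬ RegularMod (Ideal.ofList l) v := by
  by_contra! hcon
  have key : ∀ n : ℕ, ∃ l : List R, RegList l ∧ (∀ z ∈ l, z ∈ S) ∧ l.length = n := by
    intro n
    induction n with
    | zero => exact ⟨[], trivial, by simp, rfl⟩
    | succ n ih =>
      obtain ⟨l, h1, h2, h3⟩ := ih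
      obtain ⟨v, hv, hvr⟩ := hcon l h1 h2
      exact ⟨v :: l, ⟨h1, hvr⟩, by simpa using ⟨hv, h2⟩, by simpa using h3⟩
  obtain ⟨n, hn⟩ := ENat.ne_top_iff_exists.1 (Ideal.height_ne_top (I := P) Ideal.IsPrime.ne_top')
  obtain ⟨l, h1, h2, h3⟩ := key (n + 1)
  have := h1.length_le_height (P := P) (Ideal.span_le.2 fun z hz => hS z (h2 z hz))
  rw [h3, ← hn] at this
  norm_cast at this
  omega

theorem exists_assocMod_of_submodule [IsNoetherianRing R] {K : Type*} [Field K] [Infinite K]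
    [Algebra K R] (V : Submodule K R) {I : Ideal R} (h : ∀ v ∈ V, ¬ RegularMod I v) :
    ∃ P, AssocMod I P ∧ ∀ v ∈ V, v ∈ P := by
  let f : Ideal R → Submodule K V := fun P => (P.restrictScalars K).comap V.subtype
  let s : Finset (Submodule K V) := ((finite_assocMod I).image f).toFinset
  have hcov : ⋃ p ∈ s, (p : Set V) = Set.univ := by
    refine Set.eq_univ_of_forall fun v => ?_
    by_contra hv
    simp only [Set.mem_iUnion, not_exists, s, Set.Finite.mem_toFinset] at hv
    exact h v v.2 (regularMod_of_forall_notMem fun P hP hvP => hv (f P) ⟨P, hP, rfl⟩ hvP)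
  have htop : ⊤ ∈ s := by
    by_contra htop
    exact Subspace.biUnion_ne_univ_of_top_notMem htop hcov
  obtain ⟨P, hP, hPt⟩ := (Set.Finite.mem_toFinset _).1 htop
  refine ⟨P, hP, fun v hv => ?_⟩
  have : (⟨v, hv⟩ : V) ∈ f P := by
    rw [hPt]
    trivial
  exact this

end MaximalRegList

section GradedNakayama

attribute [local instance] MvPolynomial.gradedAlgebra

variable {σ K : Type*} [Field K]

theorem MvPolynomial.coe_decompose_homogeneousSubmodule (p : MvPolynomial σ K) (n : ℕ) :
    (DirectSum.decompose (homogeneousSubmodule σ K) p n : MvPolynomial σ K) =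
      homogeneousComponent n p :=
  decomposition.decompose'_apply p n

theorem MvPolynomial.homogeneousComponent_mul_of_le {p q : MvPolynomial σ K} {j n : ℕ}
    (hq : q.IsHomogeneous j) (h : j ≤ n) :
    homogeneousComponent n (p * q) = homogeneousComponent (n - j) p * q := by
  simp only [← coe_decompose_homogeneousSubmodule]
  exact DirectSum.coe_decompose_mul_of_right_mem_of_le (homogeneousSubmodule σ K) (a := p) hq h

theorem MvPolynomial.homogeneousComponent_mul_of_not_le {p q : MvPolynomial σ K} {j n : ℕ}
    (hq : q.IsHomogeneous j) (h : ¬ j ≤ n) :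
    homogeneousComponent n (p * q) = 0 := by
  rw [← coe_decompose_homogeneousSubmodule]
  exact DirectSum.coe_decompose_mul_of_right_mem_of_not_le (homogeneousSubmodule σ K) (a := p) hq h

theorem MvPolynomial.homogeneousComponent_mem_of_mem_mul {P W : Ideal (MvPolynomial σ K)}
    (hP : P.IsHomogeneous (homogeneousSubmodule σ K)) {k : ℕ}
    (hW : ∀ j < k, ∀ g ∈ P, g.IsHomogeneous j → g ∈ W) {x : MvPolynomial σ K}
    (hx : x ∈ RingHom.ker (constantCoeff (σ := σ) (R := K)) * P) :
    homogeneousComponent k x ∈ W := by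
  induction hx using Submodule.mul_induction_on' with
  | mem_mul_mem r hr p hp =>
    rw [← sum_homogeneousComponent p, Finset.mul_sum, map_sum]
    refine Ideal.sum_mem _ fun j _ => ?_
    have hj := homogeneousComponent_isHomogeneous j p
    by_cases hjk : j ≤ k
    · rw [homogeneousComponent_mul_of_le hj hjk]
      rcases hjk.eq_or_lt with rfl | hlt
      · have hr0 : coeff 0 r = 0 := hr
        rw [Nat.sub_self, homogeneousComponent_zero, hr0, C_0, zero_mul]
        exact W.zero_mem
      · exact W.mul_mem_left _ (hW j hlt _ (homogeneousComponent_mem_of_mem hP hp j) hj)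
    · rw [homogeneousComponent_mul_of_not_le hj hjk]
      exact W.zero_mem
  | add x _ y _ hx hy =>
    rw [map_add]
    exact W.add_mem hx hy

/-- A truncated graded Nakayama lemma: if a homogeneous ideal is generated by at most `n` elements,
then its elements of bounded degree lie in an ideal generated by `n` forms of bounded degree. -/
theorem MvPolynomial.exists_forms_of_card_le {P : Ideal (MvPolynomial σ K)}
    (hP : P.IsHomogeneous (homogeneousSubmodule σ K)) (hPtop : P ≠ ⊤)
    {s : Finset (MvPolynomial σ K)} (hs : Ideal.span (s : Set (MvPolynomial σ K)) = P)
    {n d : ℕ} (hn : s.card ≤ n) (hd : 1 ≤ d) :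
    ∃ v : Fin n → MvPolynomial σ K, (∀ i, ∃ e, 0 < e ∧ e ≤ d ∧ (v i).IsHomogeneous e) ∧
      ∀ g ∈ P, ∀ k ≤ d, g.IsHomogeneous k → g ∈ Ideal.span (Set.range v) := by
  classical
  let m := RingHom.ker (constantCoeff (σ := σ) (R := K))
  let T := {g : MvPolynomial σ K // g ∈ P ∧ ∃ e, 0 < e ∧ e ≤ d ∧ g.IsHomogeneous e}
  let q : MvPolynomial σ K →ₗ[K] MvPolynomial σ K ⧸ (m * P) :=
    (Ideal.Quotient.mkₐ K (m * P)).toLinearMap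
  obtain ⟨κ, a, -, hspan, hli⟩ := exists_linearIndependent' K (fun t : T => q t.1)
  have hqC : ∀ r p, p ∈ P → q (r * p) = constantCoeff r • q p := by
    intro r p hp
    rw [← map_smul, ← sub_eq_zero, ← map_sub]
    refine Ideal.Quotient.eq_zero_iff_mem.2 ?_
    rw [smul_eq_C_mul, ← sub_mul]
    refine Ideal.mul_mem_mul ?_ hp
    simp [m, RingHom.mem_ker]
  have hle : Set.range ((fun t : T => q t.1) ∘ a) ≤
      Submodule.span K (s.image q : Set (MvPolynomial σ K ⧸ (m * P))) := by
    rintro _ ⟨k, rfl⟩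
    have hk : (a k).1 ∈ Ideal.span (s : Set (MvPolynomial σ K)) := hs ▸ (a k).2.1
    obtain ⟨c, hc⟩ := Submodule.mem_span_finset'.1 hk
    simp only [Function.comp_apply, ← hc, map_sum, smul_eq_mul]
    refine Submodule.sum_mem _ fun i _ => ?_
    rw [hqC _ _ (hs ▸ Ideal.subset_span i.2)]
    exact Submodule.smul_mem _ _ (Submodule.subset_span
      (Finset.mem_coe.2 (Finset.mem_image_of_mem _ i.2)))
  have hfin : Finite κ := hli.finite_of_le_span_finite _ _ hle
  have := Fintype.ofFinite κ
  have hcard : Fintype.card κ ≤ n := by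
    have h1 := linearIndependent_le_span' _ hli _ hle
    rw [Cardinal.mk_fintype, Nat.cast_le] at h1
    exact (h1.trans (Fintype.card_coe _).le).trans (Finset.card_image_le.trans hn)
  obtain ⟨f⟩ : Nonempty (κ ↪ Fin n) :=
    Function.Embedding.nonempty_of_card_le (by simpa using hcard)
  let v : Fin n → MvPolynomial σ K := Function.extend f (fun k => (a k).1) 0
  have hvf : ∀ k, v (f k) = (a k).1 := fun k => f.injective.extend_apply _ _ k
  have hv : ∀ i, ∃ e, 0 < e ∧ e ≤ d ∧ (v i).IsHomogeneous e := by
    intro i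
    by_cases hi : ∃ k, f k = i
    · obtain ⟨k, rfl⟩ := hi
      rw [hvf]
      exact (a k).2.2
    · refine ⟨1, one_pos, hd, ?_⟩
      rw [show v i = 0 from Function.extend_apply' _ _ _ hi]
      exact isHomogeneous_zero _ _ _
  have hW : (Ideal.span (Set.range v)).IsHomogeneous (homogeneousSubmodule σ K) := by
    refine isHomogeneous_span ?_
    rintro _ ⟨i, rfl⟩
    obtain ⟨e, -, -, he⟩ := hv i
    exact ⟨e, he⟩
  refine ⟨v, hv, fun g hg k => ?_⟩
  induction k using Nat.strong_induction_on generalizing g with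
  | _ k ih =>
    intro hk hgk
    rcases Nat.eq_zero_or_pos k with rfl | hpos
    · have hgC : g = C (coeff 0 g) := by
        rw [← homogeneousComponent_zero, homogeneousComponent_eq_self hgk]
      by_cases h0 : coeff 0 g = 0
      · rw [hgC, h0, C_0]
        exact Ideal.zero_mem _
      · refine absurd (P.eq_top_of_isUnit_mem hg ?_) hPtop
        rw [hgC]
        exact (Ne.isUnit h0).map C
    · have hqg : q g ∈ Submodule.span K (Set.range ((fun t : T => q t.1) ∘ a)) := by
        rw [hspan]
        exact Submodule.subset_span ⟨⟨g, hg, k, hpos, hk, hgk⟩, rfl⟩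
      obtain ⟨c, hc⟩ := (Submodule.mem_span_range_iff_exists_fun K).1 hqg
      let w := ∑ i, c i • (a i).1
      have hw : w ∈ Ideal.span (Set.range v) := by
        refine Ideal.sum_mem _ fun i _ => ?_
        rw [smul_eq_C_mul, ← hvf]
        exact Ideal.mul_mem_left _ _ (Ideal.subset_span ⟨_, rfl⟩)
      have hgw : g - w ∈ m * P := by
        refine Ideal.Quotient.eq_zero_iff_mem.1 (?_ : q (g - w) = 0)
        rw [map_sub, ← hc, sub_eq_zero, map_sum]
        simp
      have h1 := homogeneousComponent_mem_of_mem_mul hP (W := Ideal.span (Set.range v)) (k := k)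
        (fun j hj g hg hgj => ih j hj g hg (hj.le.trans hk) hgj) hgw
      rw [map_sub, homogeneousComponent_eq_self hgk] at h1
      have h2 := homogeneousComponent_mem_of_mem hW hw k
      simpa using Ideal.add_mem _ h1 h2

theorem Ideal.isHomogeneous_of_mem_minimalPrimes {I P : Ideal (MvPolynomial σ K)}
    (hI : I.IsHomogeneous (homogeneousSubmodule σ K)) (hP : P ∈ I.minimalPrimes) :
    P.IsHomogeneous (homogeneousSubmodule σ K) := by
  have h1 : (P.homogeneousCore (homogeneousSubmodule σ K)).toIdeal.IsPrime :=
    Ideal.IsPrime.homogeneousCore hP.1.1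
  have h2 := Ideal.toIdeal_homogeneousCore_le (homogeneousSubmodule σ K) P
  have h3 : I ≤ (P.homogeneousCore (homogeneousSubmodule σ K)).toIdeal := by
    rw [← hI.toIdeal_homogeneousCore_eq_self]
    exact Ideal.homogeneousCore_mono _ hP.1.2
  rw [← h2.antisymm (hP.2 ⟨h1, h3⟩ h2)]
  exact HomogeneousIdeal.isHomogeneous _

end GradedNakayama

section PthPower

theorem RegList.exists_sub_pow_mem {R : Type*} [CommRing R] [IsRegularRing R] {l : List R}
    (h : RegList l) (hQ : (Ideal.ofList l).IsPrime) (hS : SerreReg 1 (R ⧸ Ideal.ofList l))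
    {F a b : R} {p : ℕ} (hp : p ≠ 0) (hb : b ∉ Ideal.ofList l)
    (hab : b ^ p * F - a ^ p ∈ Ideal.ofList l) : ∃ G, F - G ^ p ∈ Ideal.ofList l := by
  set Q := Ideal.ofList l
  have hcancel : ∀ z, b ^ p * z ∈ Q → z ∈ Q := fun z hz =>
    (hQ.mem_or_mem hz).resolve_left fun hbp => hb (hQ.mem_of_pow_mem p hbp)
  have hreg : RegList (b :: l) := ⟨h, fun x hx => (hQ.mem_or_mem hx).resolve_left hb⟩
  have hmem : a ∈ Ideal.ofList (b :: l) := by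
    refine hreg.mem_of_forall_prime fun P hP hle hht => ?_
    rw [Ideal.ofList_cons] at hle
    have hQP : Q ≤ P := le_sup_right.trans hle
    have key : ∀ s c, s * a - c * b ∈ Q → s * a ∈ Ideal.ofList (b :: l) := by
      intro s c hsc
      rw [Ideal.ofList_cons, sup_comm]
      exact mem_sup_span_singleton.2 ⟨c, hsc⟩
    obtain ⟨-, s, hs, c, hsc | hsc⟩ :=
      h.exists_notMem_of_serreReg hS hP hQP (by rw [hht]; rfl) a b
    · exact ⟨s, hs, key s c hsc⟩
    · refine ⟨c, fun hc => hs ?_, key c s (by rw [← neg_sub]; exact Q.neg_mem hsc)⟩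
      have h1 : (s * b) ^ p - (c * a) ^ p ∈ Q :=
        Q.mem_of_dvd (sub_dvd_pow_sub_pow _ _ _) hsc
      have h2 : s ^ p - c ^ p * F ∈ Q := by
        refine hcancel _ ?_
        have := Q.sub_mem h1 (Q.mul_mem_left (c ^ p) hab)
        convert this using 1
        ring
      have h3 : s ^ p ∈ P := by
        have := P.add_mem (hQP h2) (P.mul_mem_right F (P.pow_mem_of_mem hc p (by omega)))
        simpa using this
      exact hP.mem_of_pow_mem p h3
  rw [Ideal.ofList_cons, sup_comm] at hmem
  obtain ⟨G, hG⟩ := mem_sup_span_singleton.1 hmem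
  refine ⟨G, hcancel _ ?_⟩
  have h1 : a ^ p - (G * b) ^ p ∈ Q := Q.mem_of_dvd (sub_dvd_pow_sub_pow _ _ _) hG
  convert Q.add_mem hab h1 using 1
  ring

variable {σ K : Type*} [Field K]

theorem MvPolynomial.homogeneousComponent_pow_char {p : ℕ} [Fact p.Prime] [CharP K p]
    (G : MvPolynomial σ K) (t : ℕ) :
    homogeneousComponent (t * p) (G ^ p) = homogeneousComponent t G ^ p := by
  have hp := (Fact.out : p.Prime).pos
  conv_lhs => rw [← sum_homogeneousComponent G]
  rw [sum_pow_char, map_sum]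
  have h1 : ∀ j, homogeneousComponent (t * p) (homogeneousComponent j G ^ p) =
      if j = t then homogeneousComponent t G ^ p else 0 := by
    intro j
    rw [homogeneousComponent_of_mem ((homogeneousComponent_isHomogeneous j G).pow p)]
    by_cases hj : j = t
    · simp [hj]
    · rw [if_neg hj, if_neg]
      exact fun h => hj (Nat.eq_of_mul_eq_mul_right hp h).symm
  simp only [h1]
  rw [Finset.sum_ite_eq']
  split_ifs with h
  · rfl
  · rw [homogeneousComponent_eq_zero, zero_pow hp.ne']
    simpa [Nat.lt_succ_iff] using h

attribute [local instance] MvPolynomial.gradedAlgebra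

/-- A form whose partial derivatives vanish modulo a prime regular sequence of forms satisfying
Serre's condition `R_1` is, modulo that sequence, a product of two forms with vanishing
derivatives. -/
theorem RegList.exists_forms_sub_mul_mem [PerfectField K] [Fintype σ]
    {l : List (MvPolynomial σ K)} (h : RegList l) (hQ : (Ideal.ofList l).IsPrime)
    (hS : SerreReg 1 (MvPolynomial σ K ⧸ Ideal.ofList l))
    (hQh : (Ideal.ofList l).IsHomogeneous (homogeneousSubmodule σ K))
    {F : MvPolynomial σ K} {e : ℕ} (he : 0 < e) (hF : F.IsHomogeneous e)
    (hd : ∀ i, pderiv i F ∈ Ideal.ofList l) :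
    ∃ g g' : MvPolynomial σ K, (∃ a > 0, g.IsHomogeneous a) ∧ (∃ a > 0, g'.IsHomogeneous a) ∧
      (g * g').IsHomogeneous e ∧ F - g * g' ∈ Ideal.ofList l ∧ ∀ i, pderiv i (g * g') = 0 := by
  by_cases hek : (e : K) = 0
  · obtain ⟨p, hchar⟩ := CharP.exists K
    have hpe : p ∣ e := (CharP.cast_eq_zero_iff K p e).1 hek
    have hp0 : p ≠ 0 := fun h0 => he.ne' (by simpa [h0] using hpe)
    have hp : p.Prime := (CharP.char_is_prime_or_zero K p).resolve_right hp0
    have : Fact p.Prime := ⟨hp⟩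
    obtain ⟨a, b, hb, hab⟩ := MvPolynomial.exists_pow_mul_sub_pow_mem hp hd
    obtain ⟨G, hG⟩ := h.exists_sub_pow_mem hQ hS hp0 hb hab
    obtain ⟨t, rfl⟩ := hpe
    have ht : 0 < t := Nat.pos_of_mul_pos_left he
    set g := homogeneousComponent t G
    have hg : g.IsHomogeneous t := homogeneousComponent_isHomogeneous t G
    have hgg : g * g ^ (p - 1) = g ^ p := by
      rw [← pow_succ', Nat.sub_add_cancel hp.one_le]
    refine ⟨g, g ^ (p - 1), ⟨t, ht, hg⟩,
      ⟨t * (p - 1), Nat.mul_pos ht (Nat.sub_pos_of_lt hp.one_lt), hg.pow _⟩, ?_, ?_, fun i => ?_⟩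
    · rw [hgg, mul_comm p t]
      exact hg.pow p
    · have := homogeneousComponent_mem_of_mem hQh hG (t * p)
      rwa [map_sub, homogeneousComponent_pow_char, mul_comm t p, homogeneousComponent_eq_self hF,
        ← hgg] at this
    · rw [hgg, pderiv_pow]
      simp
  · refine ⟨0, 0, ⟨1, one_pos, isHomogeneous_zero _ _ _⟩, ⟨1, one_pos, isHomogeneous_zero _ _ _⟩,
      ?_, ?_, by simp⟩
    · rw [zero_mul]
      exact isHomogeneous_zero _ _ _
    · have h1 := hF.sum_X_mul_pderiv
      have h2 : (e : MvPolynomial σ K) * F ∈ Ideal.ofList l := by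
        rw [← nsmul_eq_mul, ← h1]
        exact Ideal.sum_mem _ fun i _ => Ideal.mul_mem_left _ _ (hd i)
      have h3 := Ideal.mul_mem_left _ (C (e : K)⁻¹) h2
      rw [← mul_assoc, ← map_natCast (C : K →+* MvPolynomial σ K), ← C_mul, inv_mul_cancel₀ hek,
        C_1, one_mul] at h3
      simpa using h3

end PthPower

section Conormal

theorem Ideal.mem_minimalPrimes_of_le_sup_sq {R : Type*} [CommRing R] [IsNoetherianRing R]
    {J Q : Ideal R} [Q.IsPrime] (hJQ : J ≤ Q) (h : ∀ x ∈ Q, ∃ s ∉ Q, s * x ∈ J ⊔ Q ^ 2) :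
    Q ∈ J.minimalPrimes := by
  let A := Localization.AtPrime Q
  have hm : Q.map (algebraMap R A) = IsLocalRing.maximalIdeal A :=
    Localization.AtPrime.map_eq_maximalIdeal
  have h1 : Q.map (algebraMap R A) ≤ J.map (algebraMap R A) ⊔
      IsLocalRing.maximalIdeal A • Q.map (algebraMap R A) := by
    rw [smul_eq_mul, ← hm, ← pow_two, ← Ideal.map_pow, ← Ideal.map_sup, Ideal.map_le_iff_le_comap]
    intro x hx
    obtain ⟨s, hs, hsx⟩ := h x hx
    exact (algebraMap_mem_map_iff Q.primeCompl).2 ⟨s, hs, hsx⟩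
  have h2 : Q.map (algebraMap R A) ≤ J.map (algebraMap R A) :=
    Submodule.le_of_le_smul_of_le_jacobson_bot (IsNoetherian.noetherian _)
      (IsLocalRing.maximalIdeal_le_jacobson _) h1
  refine ⟨⟨inferInstance, hJQ⟩, fun P hP hPQ x hx => ?_⟩
  obtain ⟨s, hs, hsx⟩ :=
    (algebraMap_mem_map_iff Q.primeCompl).1 (h2 (Ideal.mem_map_of_mem _ hx))
  exact (hP.1.mem_or_mem (hP.2 hsx)).resolve_left fun hsP => hs (hPQ hsP)

/-- The members of a regular sequence generating a prime ideal `Q` are linearly independent in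
`Q / Q ^ 2`, even generically. -/
theorem RegList.mem_of_sum_mem {R : Type*} [CommRing R] [IsNoetherianRing R] {l : List R}
    (h : RegList l) (hQ : (Ideal.ofList l).IsPrime) {c : Fin l.length → R} {s : R}
    (hs : s ∉ Ideal.ofList l) (hc : s * ∑ j, c j * l.get j ∈ Ideal.ofList l ^ 2)
    (k : Fin l.length) : c k ∈ Ideal.ofList l := by
  by_contra hck
  set Q := Ideal.ofList l with hQdef
  have hspan : Q = Ideal.span (Set.range l.get) := by
    rw [Set.range_list_get]
  have hl : ∀ j, l.get j ∈ Q := fun j => Ideal.subset_span (l.get_mem j)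
  set J := Ideal.span (l.get '' {k}ᶜ)
  have hJQ : J ≤ Q := Ideal.span_le.2 (by rintro _ ⟨j, -, rfl⟩; exact hl j)
  have hJ : ∀ j ≠ k, l.get j ∈ J := fun j hj => Ideal.subset_span ⟨j, hj, rfl⟩
  have hk : s * c k * l.get k ∈ J ⊔ Q ^ 2 := by
    rw [← Finset.add_sum_erase _ _ (Finset.mem_univ k)] at hc
    have h1 : s * ∑ j ∈ Finset.univ.erase k, c j * l.get j ∈ J ⊔ Q ^ 2 :=
      Ideal.mul_mem_left _ _ (Ideal.sum_mem _ fun j hj => Ideal.mul_mem_left _ _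
        (Ideal.mem_sup_left (hJ j (Finset.ne_of_mem_erase hj))))
    have := Ideal.sub_mem _ (Ideal.mem_sup_right (S := J) hc) h1
    convert this using 1
    ring
  have hmin : Q ∈ J.minimalPrimes := by
    refine Ideal.mem_minimalPrimes_of_le_sup_sq hJQ fun x hx =>
      ⟨s * c k, fun hsc => (hQ.mem_or_mem hsc).elim hs hck, ?_⟩
    rw [hspan] at hx
    induction hx using Submodule.span_induction with
    | mem x hx =>
      obtain ⟨j, rfl⟩ := hx
      by_cases hj : j = k
      · rwa [hj]
      · exact Ideal.mul_mem_left _ _ (Ideal.mem_sup_left (hJ j hj))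
    | zero => simp
    | add x y _ _ hx hy =>
      rw [mul_add]
      exact Ideal.add_mem _ hx hy
    | smul a x _ hx =>
      rw [smul_eq_mul, mul_left_comm]
      exact Ideal.mul_mem_left _ _ hx
  have h1 := Ideal.height_le_card_of_mem_minimalPrimes_span (Set.toFinite _) hmin
  have h2 := h.length_le_height (P := Q) le_rfl
  have h3 : (l.get '' {k}ᶜ).ncard ≤ l.length - 1 := by
    refine (Set.ncard_image_le (Set.toFinite _)).trans ?_
    rw [Set.ncard_compl, Set.ncard_singleton, Nat.card_eq_fintype_card, Fintype.card_fin]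
  have h4 : l.length ≤ (l.get '' {k}ᶜ).ncard := by exact_mod_cast h2.trans h1
  have := k.pos
  omega

/-- A form in a prime ideal generated by a regular sequence of forms, whose partial derivatives
also lie in that ideal, is a combination of the sequence with coefficients of positive degree. -/
theorem RegList.exists_forms_sum_mul_eq {σ K : Type*} [Fintype σ] [Field K] [PerfectField K]
    {l : List (MvPolynomial σ K)} (h : RegList l) (hQ : (Ideal.ofList l).IsPrime)
    (hl : ∀ z ∈ l, ∃ a > 0, z.IsHomogeneous a) {H : MvPolynomial σ K} {e : ℕ}
    (hHe : H.IsHomogeneous e) (hH : H ∈ Ideal.ofList l)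
    (hd : ∀ i, pderiv i H ∈ Ideal.ofList l) :
    ∃ c : Fin l.length → MvPolynomial σ K, (∀ j, ∃ a > 0, (c j).IsHomogeneous a) ∧
      H = ∑ j, c j * l.get j := by
  choose a ha hla using fun j => hl (l.get j) (l.get_mem j)
  have hspan : Ideal.ofList l = Ideal.span (Set.range l.get) := by
    rw [Set.range_list_get]
  obtain ⟨b, hb⟩ : ∃ b : Fin l.length → MvPolynomial σ K, ∑ j, b j * l.get j = H := by
    rw [hspan] at hH
    exact Submodule.mem_span_range_iff_exists_fun _ |>.1 hH
  let c : Fin l.length → MvPolynomial σ K :=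
    fun j => if a j ≤ e then homogeneousComponent (e - a j) (b j) else 0
  have hc : H = ∑ j, c j * l.get j := by
    conv_lhs => rw [← homogeneousComponent_eq_self hHe, ← hb, map_sum]
    refine Finset.sum_congr rfl fun j _ => ?_
    by_cases hj : a j ≤ e
    · rw [homogeneousComponent_mul_of_le (hla j) hj, show c j = _ from if_pos hj]
    · rw [homogeneousComponent_mul_of_not_le (hla j) hj, show c j = 0 from if_neg hj, zero_mul]
  refine ⟨c, fun j => ?_, hc⟩
  rcases lt_trichotomy (a j) e with hj | hj | hj
  · refine ⟨e - a j, Nat.sub_pos_of_lt hj, ?_⟩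
    rw [show c j = _ from if_pos hj.le]
    exact homogeneousComponent_isHomogeneous _ _
  · obtain ⟨s, hs, hsH⟩ := MvPolynomial.exists_mul_mem_sq hH hd
    rw [hc] at hsH
    have hcj := h.mem_of_sum_mem hQ hs hsH j
    have hCj : c j = C (coeff 0 (b j)) := by
      rw [show c j = _ from if_pos hj.le, hj, Nat.sub_self, homogeneousComponent_zero]
    have h0 : coeff 0 (c j) = 0 :=
      constantCoeff_eq_zero_of_mem_span (fun z hz => hl z hz) hcj
    refine ⟨1, one_pos, ?_⟩
    rw [hCj, coeff_zero_C] at h0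
    rw [hCj, h0, C_0]
    exact isHomogeneous_zero _ _ _
  · refine ⟨1, one_pos, ?_⟩
    rw [show c j = 0 from if_neg hj.not_ge]
    exact isHomogeneous_zero _ _ _

end Conormal

section Collapse

theorem Derivation.apply_mem_of_mem_sq {A R : Type*} [CommRing A] [CommRing R] [Algebra A R]
    (δ : Derivation A R R) {P : Ideal R} {x : R} (hx : x ∈ P ^ 2) : δ x ∈ P := by
  rw [pow_two] at hx
  induction hx using Submodule.mul_induction_on' with
  | mem_mul_mem a ha b hb =>
    rw [δ.leibniz]
    exact P.add_mem (P.mul_mem_right _ ha) (P.mul_mem_right _ hb)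
  | add x _ y _ hx hy =>
    rw [map_add]
    exact P.add_mem hx hy

theorem Derivation.mul_notMem_sq {A R : Type*} [CommRing A] [CommRing R] [Algebra A R]
    (δ : Derivation A R R) {P : Ideal R} (hP : P.IsPrime) {F : R} (hF : δ F ∉ P) {s : R}
    (hs : s ∉ P) : s * F ∉ P ^ 2 := by
  intro hsF
  have hFP : F ∈ P := (hP.mem_or_mem (Ideal.pow_le_self two_ne_zero hsF)).resolve_left hs
  have h := δ.apply_mem_of_mem_sq hsF
  rw [δ.leibniz, smul_eq_mul, smul_eq_mul] at h
  exact (hP.mem_or_mem ((P.add_mem_iff_left (P.mul_mem_right _ hFP)).1 h)).elim hs hF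

theorem MvPolynomial.mem_span_of_mem_adjoin {σ K : Type*} [Field K] {s : Set (MvPolynomial σ K)}
    (hs : ∀ f ∈ s, ∃ e, 0 < e ∧ f.IsHomogeneous e) {v : MvPolynomial σ K}
    (hv : v ∈ Algebra.adjoin K s) (hv0 : constantCoeff v = 0) : v ∈ Ideal.span s := by
  have key : v - C (constantCoeff v) ∈ Ideal.span s := by
    clear hv0
    induction hv using Algebra.adjoin_induction with
    | mem x hx =>
      have hx' := Ideal.subset_span hx
      rwa [constantCoeff_eq_zero_of_mem_span hs hx', C_0, sub_zero]
    | algebraMap r => simp [algebraMap_eq]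
    | add x y _ _ hx hy =>
      convert Ideal.add_mem _ hx hy using 1
      simp only [map_add]
      ring
    | mul x y _ _ hx hy =>
      convert Ideal.add_mem _ (Ideal.mul_mem_right y _ hx)
        (Ideal.mul_mem_left _ (C (constantCoeff x)) hy) using 1
      simp only [map_mul]
      ring
  rwa [hv0, C_0, sub_zero] at key

variable {K : Type*} [Field K] {N : ℕ}

theorem HasCollapse.mul_add {k : ℕ} {f g G : MvPolynomial (Fin N) K}
    (hf : ∃ a > 0, f.IsHomogeneous a) (hg : ∃ a > 0, g.IsHomogeneous a) (hG : HasCollapse k G) :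
    HasCollapse (k + 1) (f * g + G) := by
  obtain ⟨f', g', hf', hg', rfl⟩ := hG
  refine ⟨Fin.cons f f', Fin.cons g g', fun i => ?_, fun i => ?_, ?_⟩
  · induction i using Fin.cases with
    | zero => exact hf
    | succ i => exact hf' i
  · induction i using Fin.cases with
    | zero => exact hg
    | succ i => exact hg' i
  · simp [Fin.sum_univ_succ]

theorem HasCollapse.mono {k k' : ℕ} (hk : k ≤ k') {F : MvPolynomial (Fin N) K}
    (h : HasCollapse k F) : HasCollapse k' F := by
  induction k', hk using Nat.le_induction with
  | base => exact h
  | succ n _ ih =>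
    have h0 : ∃ a > 0, (0 : MvPolynomial (Fin N) K).IsHomogeneous a :=
      ⟨1, one_pos, isHomogeneous_zero _ _ _⟩
    simpa using ih.mul_add h0 h0

attribute [local instance] MvPolynomial.gradedAlgebra

theorem RegList.hasCollapse [PerfectField K] {l : List (MvPolynomial (Fin N) K)} (h : RegList l)
    (hQ : (Ideal.ofList l).IsPrime) (hS : SerreReg 1 (MvPolynomial (Fin N) K ⧸ Ideal.ofList l))
    (hl : ∀ z ∈ l, ∃ a > 0, z.IsHomogeneous a) {F : MvPolynomial (Fin N) K} {e : ℕ} (he : 0 < e)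
    (hF : F.IsHomogeneous e) (hd : ∀ i, pderiv i F ∈ Ideal.ofList l) :
    HasCollapse (l.length + 1) F := by
  have hQh : (Ideal.ofList l).IsHomogeneous (homogeneousSubmodule (Fin N) K) :=
    isHomogeneous_span fun z hz => (hl z hz).imp fun _ ha => ha.2
  obtain ⟨g, g', hg, hg', hgg, hFg, hd0⟩ := h.exists_forms_sub_mul_mem hQ hS hQh he hF hd
  obtain ⟨c, hc, hsum⟩ := h.exists_forms_sum_mul_eq hQ hl (hF.sub hgg) hFg
    fun i => by simpa only [map_sub, hd0, sub_zero] using hd i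
  rw [← add_sub_cancel (g * g') F]
  exact HasCollapse.mul_add hg hg' ⟨c, l.get, hc, fun j => hl _ (l.get_mem j), hsum⟩

/-- Forms of the same degree in a prime ideal of height at most `k` are contained in a minimal prime
of a regular sequence of at most `k` of their linear combinations. -/
theorem MvPolynomial.exists_regList_minimalPrimes [Infinite K] {ι : Type*}
    {f : ι → MvPolynomial (Fin N) K} {e k : ℕ} (hf : ∀ i, (f i).IsHomogeneous e)
    {P : Ideal (MvPolynomial (Fin N) K)} [P.IsPrime] (hP : P.height ≤ k) (hfP : ∀ i, f i ∈ P) :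
    ∃ l : List (MvPolynomial (Fin N) K), RegList l ∧ l.length ≤ k ∧
      (∀ z ∈ l, z.IsHomogeneous e) ∧ Ideal.ofList l ≤ P ∧
      ∃ Q ∈ (Ideal.ofList l).minimalPrimes, ∀ i, f i ∈ Q := by
  let V := Submodule.span K (Set.range f)
  have hVh : ∀ v ∈ V, v.IsHomogeneous e := by
    have : V ≤ homogeneousSubmodule (Fin N) K e := by
      rw [Submodule.span_le]
      rintro _ ⟨i, rfl⟩
      exact hf i
    exact this
  have hVP : ∀ v ∈ V, v ∈ P := by
    have : V ≤ P.restrictScalars K := by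
      rw [Submodule.span_le]
      rintro _ ⟨i, rfl⟩
      exact hfP i
    exact this
  obtain ⟨l, h1, h2, h3⟩ := exists_regList_forall_not_regularMod (S := (V : Set _)) (P := P) hVP
  obtain ⟨Q, hQ, hVQ⟩ := exists_assocMod_of_submodule V h3
  have hlP : Ideal.ofList l ≤ P := Ideal.span_le.2 fun z hz => hVP z (h2 z hz)
  exact ⟨l, h1, by exact_mod_cast (h1.length_le_height hlP).trans hP, fun z hz => hVh z (h2 z hz),
    hlP, Q, h1.mem_minimalPrimes_of_assocMod hQ, fun i => hVQ _ (Submodule.subset_span ⟨i, rfl⟩)⟩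

end Collapse

theorem PD_PcB_implies_PAa {K : Type*} [Field K] [IsAlgClosed K]
    (d : ℕ) (hd : 2 ≤ d)
    (D : ℕ → ℕ) (hDpos : ∀ k, 1 ≤ k → 0 < D k)
    (hDmono : ∀ k k', k ≤ k' → D k ≤ D k')
    (hPD : ∀ (k : ℕ), 1 ≤ k → ∀ (N : ℕ) (c : ℕ), c ≤ k →
      ∀ f : Fin c → MvPolynomial (Fin N) K,
      (∀ i, ∃ e : ℕ, 0 < e ∧ e ≤ d - 1 ∧ (f i).IsHomogeneous e) →
      RingTheory.Sequence.IsRegular (MvPolynomial (Fin N) K) (List.ofFn f) →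
      ∀ P ∈ (Ideal.span (Set.range f)).minimalPrimes,
        ∃ s : Finset (MvPolynomial (Fin N) K),
          s.card ≤ D k ∧ Ideal.span (s : Set (MvPolynomial (Fin N) K)) = P)
    (calB : ℕ → ℕ → ℕ)
    (hBasc : ∀ η η' n n', η ≤ η' → n ≤ n' → calB η n ≤ calB η' n')
    (hPcB : ∀ (η n : ℕ), 1 ≤ η → 1 ≤ n →
      ∀ (N : ℕ) (v : Fin n → MvPolynomial (Fin N) K),
      (∀ i, ∃ e : ℕ, 0 < e ∧ e ≤ d - 1 ∧ (v i).IsHomogeneous e) →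
      ∃ m : ℕ, m ≤ calB η n ∧ ∃ y : Fin m → MvPolynomial (Fin N) K,
        (∀ j, ∃ e : ℕ, 0 < e ∧ e ≤ d - 1 ∧ (y j).IsHomogeneous e) ∧
        IsSerreSeq η y ∧
        ∀ i, v i ∈ Algebra.adjoin K (Set.range y)) :
    (∀ η η', η ≤ η' → calB 3 (D (η + 1)) + 1 ≤ calB 3 (D (η' + 1)) + 1) ∧
    (∀ (η : ℕ), 1 ≤ η → ∀ (N : ℕ) (F : MvPolynomial (Fin N) K), F ≠ 0 →
      ∀ e : ℕ, 0 < e → e ≤ d → F.IsHomogeneous e →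
      ¬ HasCollapse (calB 3 (D (η + 1)) + 1) F →
      SerreReg η (MvPolynomial (Fin N) K ⧸ Ideal.span {F})) := by
  refine ⟨fun η η' hη => Nat.succ_le_succ (hBasc _ _ _ _ le_rfl (hDmono _ _ (by omega))), ?_⟩
  intro η hη N F hF0 e he hed hF hcol p hp
  refine isRegularLocal_localization_quotient p.asIdeal ?_
  set P := p.asIdeal.comap (Ideal.Quotient.mk (Ideal.span {F})) with hPdef
  have hP : P.IsPrime := Ideal.comap_isPrime _ _
  by_cases hex : ∃ i, pderiv i F ∉ P
  · obtain ⟨i, hi⟩ := hex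
    exact fun s hs => (pderiv i).mul_notMem_sq hP hi hs
  push Not at hex
  refine absurd ?_ hcol
  have hpd : ∀ i, (pderiv i F).IsHomogeneous (e - 1) := fun i => hF.pderiv
  have he2 : 1 ≤ e - 1 := by
    by_contra he1
    have h0 : ∀ i, pderiv i F = 0 := by
      intro i
      have h1 := hpd i
      rw [show e - 1 = 0 by omega] at h1
      obtain ⟨c, hc⟩ : ∃ c, pderiv i F = C c :=
        ⟨_, totalDegree_eq_zero_iff_eq_C.1 (Nat.le_zero.1 h1.totalDegree_le)⟩
      by_contra hne
      have hc0 : c ≠ 0 := fun h => hne (by rw [hc, h, C_0])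
      refine hP.ne_top (P.eq_top_of_isUnit_mem (hex i) ?_)
      rw [hc]
      exact (isUnit_iff_ne_zero.2 hc0).map C
    have h2 := hF.sum_X_mul_pderiv
    rw [show e = 1 by omega] at h2
    exact hF0 (by simpa [h0] using h2.symm)
  have hht : P.height ≤ (η + 1 : ℕ) := by
    have hFP : F ∈ P := by
      rw [hPdef, Ideal.mem_comap,
        Ideal.Quotient.eq_zero_iff_mem.2 (Ideal.mem_span_singleton_self F)]
      exact p.asIdeal.zero_mem
    have h1 := Ideal.height_le_height_add_one_of_mem hFP
    rw [hPdef, Ideal.map_comap_of_surjective _ Ideal.Quotient.mk_surjective,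
      PrimeSpectrum.height_eq_orderHeight] at h1
    rw [Nat.cast_add, Nat.cast_one]
    exact h1.trans (add_le_add_left hp 1)
  obtain ⟨l, hl, hlk, hlh, hlP, Q, hQ, hfQ⟩ := exists_regList_minimalPrimes hpd hht hex
  have hrange : Ideal.span (Set.range l.reverse.get) = Ideal.ofList l := by
    rw [Set.range_list_get]
    simp [Ideal.ofList]
  obtain ⟨s, hs, hsQ⟩ := hPD (η + 1) (by omega) N l.reverse.length (by simpa using hlk)
    l.reverse.get
    (fun i => ⟨e - 1, he2, by omega, hlh _ (List.mem_reverse.1 (l.reverse.get_mem i))⟩)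
    ⟨by rw [List.ofFn_get]; exact hl.isWeaklyRegular, by
      have hrev : Ideal.ofList l.reverse = Ideal.ofList l := by simp [Ideal.ofList]
      rw [List.ofFn_get, hrev, smul_eq_mul, Ideal.mul_top]
      exact fun h => hP.ne_top (top_le_iff.1 (h.le.trans hlP))⟩
    Q (by rwa [hrange])
  have hQh := Ideal.isHomogeneous_of_mem_minimalPrimes
    (isHomogeneous_span fun z hz => ⟨e - 1, hlh z hz⟩) hQ
  obtain ⟨v, hv, hvQ⟩ := exists_forms_of_card_le hQh hQ.1.1.ne_top hsQ hs he2
  obtain ⟨m, hm, y, hy, hyS, hvy⟩ := hPcB 3 (D (η + 1)) (by norm_num) (hDpos _ (by omega)) N v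
    fun i => (hv i).imp fun a ha => ⟨ha.1, by omega, ha.2.2⟩
  have hyh : ∀ j, ∃ a, 0 < a ∧ (y j).IsHomogeneous a :=
    fun j => (hy j).imp fun a ha => ⟨ha.1, ha.2.2⟩
  obtain ⟨l', hl', hlm, hly, hspan, hprime, hS⟩ := hyS.exists_regList hyh
  refine (hl'.hasCollapse hprime hS (fun z hz => ?_) he hF fun i => ?_).mono
    (Nat.succ_le_succ (hlm.trans hm))
  · obtain ⟨j, rfl⟩ := hly z hz
    exact hyh j
  · rw [hspan]
    have hvs : Ideal.span (Set.range v) ≤ Ideal.span (Set.range y) := by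
      rw [Ideal.span_le]
      rintro _ ⟨j, rfl⟩
      refine mem_span_of_mem_adjoin (by rintro _ ⟨j, rfl⟩; exact hyh j) (hvy j) ?_
      obtain ⟨a, ha, -, hva⟩ := hv j
      exact constantCoeff_eq_zero_of_mem_span (s := {v j}) (by rintro _ rfl; exact ⟨a, ha, hva⟩)
        (Ideal.mem_span_singleton_self _)
    exact hvs (hvQ _ (hfQ i) (e - 1) le_rfl (hpd i))
end

section
/- Let d ≥ 2 and let A: ℤ_{>0} → ℤ_{>0} be increasing and satisfy property PAa_d: for every η ≥ 1 and every nonzero homogeneous form F of positive degree at most d with str(F) ≥ A(η), the ring R/FR satisfies Serre's condition R_η. Define Ā(η,δ) = |δ| − 1 + A(η + 3|δ|) for (η,δ) ∈ ℤ_{>0}×ℕ^d. Then Ā satisfies property PAb_d: whenever V = ⊕_{i=1}^d V_i ⊆ R is a graded vector space of forms with dimension vector δ such that str(V_j) ≥ Ā(η,δ) for every 1 ≤ j ≤ d with V_j ≠ 0, every sequence of K-linearly independent forms in V is an R_η-sequence. -/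
open MvPolynomial

theorem isRegularLocal_iff (S : Type*) [CommRing S] :
    IsRegularLocal S ↔ IsRegularLocalRing S := by
  constructor
  · rintro ⟨_, _, s, hs, hcard⟩
    apply IsRegularLocalRing.of_spanFinrank_maximalIdeal_le
    rw [← IsLocalRing.eq_maximalIdeal hs]
    have h : (Ideal.span (s : Set S)).spanFinrank ≤ s.card := by
      simpa using Submodule.spanFinrank_span_le_ncard_of_finite (R := S) s.finite_toSet
    have hcard' : ((s.card : ℕ) : WithBot ℕ∞) = ringKrullDim S := hcard
    rw [← hcard']
    exact_mod_cast h
  · intro h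
    have hfg : (IsLocalRing.maximalIdeal S).FG := IsNoetherian.noetherian _
    refine ⟨inferInstance, inferInstance, (Submodule.FG.finite_generators hfg).toFinset, ?_, ?_⟩
    · rw [Set.Finite.coe_toFinset, Ideal.span, Submodule.span_generators]
      infer_instance
    · rw [← Set.ncard_eq_toFinset_card (hs := Submodule.FG.finite_generators hfg),
        Submodule.FG.generators_ncard hfg]
      exact IsRegularLocalRing.spanFinrank_maximalIdeal

open IsLocalRing in
theorem map_mem_maximalIdeal_sq_of_pderiv_mem {K σ : Type*} [Field K] [PerfectField K] [Finite σ]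
    (Q : Ideal (MvPolynomial σ K)) [Q.IsPrime] {G : MvPolynomial σ K} (hG : G ∈ Q)
    (hdG : ∀ i, pderiv i G ∈ Q) (L : Type*) [CommRing L] [IsLocalRing L] [Algebra K L]
    [Algebra (MvPolynomial σ K) L] [IsScalarTower K (MvPolynomial σ K) L]
    [IsLocalization.AtPrime L Q] :
    algebraMap _ L G ∈ maximalIdeal L ^ 2 := by
  cases nonempty_fintype σ
  have : Algebra.FormallySmooth (MvPolynomial σ K) L := .of_isLocalization Q.primeCompl
  have : Algebra.FormallySmooth K L := .comp _ (MvPolynomial σ K) _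
  have : Algebra.EssFiniteType K L :=
    have : Algebra.EssFiniteType (MvPolynomial σ K) L := .of_isLocalization _ Q.primeCompl
    .comp _ (MvPolynomial σ K) _
  have : Algebra.EssFiniteType K (ResidueField L) := .comp _ L _
  have hsurj : Function.Surjective (algebraMap L (ResidueField L)) := residue_surjective
  have hinj := (Algebra.FormallySmooth.kerCotangentToTensor_injective_iff (R := K) hsurj).mpr
    inferInstance
  have hker : RingHom.ker (algebraMap L (ResidueField L)) = maximalIdeal L := ker_residue
  have hmem : ∀ f ∈ Q, algebraMap _ L f ∈ RingHom.ker (algebraMap L (ResidueField L)) := by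
    intro f hf
    rw [hker]
    exact (IsLocalization.AtPrime.to_map_mem_maximal_iff L Q f).mpr hf
  have hD : KaehlerDifferential.D K L (algebraMap _ L G) =
      ∑ i, algebraMap _ L (pderiv i G) •
        KaehlerDifferential.D K L (algebraMap (MvPolynomial σ K) L (X i)) := by
    have key : (KaehlerDifferential.D K L).compAlgebraMap (MvPolynomial σ K) =
        ∑ i, (LinearMap.toSpanSingleton (MvPolynomial σ K) _
          (KaehlerDifferential.D K L (algebraMap (MvPolynomial σ K) L (X i)))).compDer
            (pderiv i) := by
      classical
      refine derivation_ext fun j => ?_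
      rw [← Derivation.coeFnAddMonoidHom_apply, ← Derivation.coeFnAddMonoidHom_apply,
        map_sum, Finset.sum_apply, Finset.sum_eq_single j]
      · simp
      · intro i _ hij
        simp [pderiv_X_of_ne hij.symm]
      · simp
    have := congrFun (congrArg Derivation.coeFnAddMonoidHom key) G
    rw [map_sum, Finset.sum_apply] at this
    simp only [algebraMap_smul]
    simpa using this
  have hz : KaehlerDifferential.kerCotangentToTensor K L (ResidueField L)
      (Ideal.toCotangent _ ⟨algebraMap _ L G, hmem G hG⟩) = 0 := by
    rw [KaehlerDifferential.kerCotangentToTensor_toCotangent]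
    simp only
    rw [hD, TensorProduct.tmul_sum]
    refine Finset.sum_eq_zero fun i _ => ?_
    rw [TensorProduct.tmul_smul, TensorProduct.smul_tmul', ← Algebra.algebraMap_eq_smul_one,
      RingHom.mem_ker.mp (hmem _ (hdG i)), TensorProduct.zero_tmul]
  rw [← map_zero (KaehlerDifferential.kerCotangentToTensor K L (ResidueField L))] at hz
  have := hinj hz
  rw [Ideal.toCotangent_eq_zero] at this
  exact hker ▸ this
 

open IsLocalRing in
theorem not_isRegularLocalRing_quotient {S : Type*} [CommRing S] [IsDomain S] [IsLocalRing S]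
    [IsNoetherianRing S] {G : S} (hG0 : G ≠ 0) (hG : G ∈ maximalIdeal S ^ 2) :
    ¬ IsRegularLocalRing (S ⧸ Ideal.span {G}) := by
  intro h
  have hGm : G ∈ maximalIdeal S := Ideal.pow_le_self two_ne_zero hG
  set π := Ideal.Quotient.mk (Ideal.span {G})
  have hπ : Function.Surjective π := Ideal.Quotient.mk_surjective
  have hfg : (maximalIdeal (S ⧸ Ideal.span {G})).FG := IsNoetherian.noetherian _
  have hgen := Submodule.span_generators (maximalIdeal (S ⧸ Ideal.span {G}))
  have hfin := Submodule.FG.finite_generators hfg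
  have hcard := Submodule.FG.generators_ncard hfg
  set t := (maximalIdeal (S ⧸ Ideal.span {G})).generators
  let u : Set S := Function.surjInv hπ '' t
  have hut : π '' u = t := by
    simp only [u, ← Set.image_comp]
    simp [Function.surjInv_eq]
  have hm : maximalIdeal S ≤ Ideal.span u ⊔ maximalIdeal S • maximalIdeal S := by
    have h1 : maximalIdeal S = (Ideal.map π (Ideal.span u)).comap π := by
      rw [Ideal.map_span, hut]
      refine Eq.trans ?_ (congrArg (Ideal.comap π) hgen.symm)
      exact (eq_maximalIdeal (Ideal.comap_isMaximal_of_surjective π hπ)).symm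
    have h2 : (Ideal.map π (Ideal.span u)).comap π = Ideal.span u ⊔ Ideal.span {G} := by
      rw [Ideal.comap_map_of_surjective π hπ, ← RingHom.ker_eq_comap_bot, Ideal.mk_ker]
    rw [h1.trans h2]
    refine sup_le le_sup_left ?_
    rw [← h2, ← h1]
    refine le_trans ?_ le_sup_right
    rw [Ideal.span_singleton_le_iff_mem, smul_eq_mul, ← sq]
    exact hG
  have hle : maximalIdeal S ≤ Ideal.span u :=
    Submodule.le_of_le_smul_of_le_jacobson_bot (IsNoetherian.noetherian _)
      (jacobson_eq_maximalIdeal ⊥ bot_ne_top).ge hm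
  have heq : maximalIdeal S = Ideal.span u := by
    refine le_antisymm hle (Ideal.span_le.mpr ?_)
    rintro _ ⟨x, hx, rfl⟩
    have hx' : x ∈ maximalIdeal (S ⧸ Ideal.span {G}) := by
      rw [← hgen]; exact Submodule.subset_span hx
    by_contra hc
    have hc' : IsUnit (Function.surjInv hπ x) := by simpa using hc
    have := hc'.map π
    rw [Function.surjInv_eq hπ x] at this
    exact hx' this
  have h1 : ringKrullDim S ≤ ringKrullDim (S ⧸ Ideal.span {G}) := by
    refine (ringKrullDim_le_spanFinrank_maximalIdeal S).trans ?_
    rw [← IsRegularLocalRing.spanFinrank_maximalIdeal, ← hcard, heq]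
    have : (Ideal.span u).spanFinrank ≤ t.ncard :=
      (Submodule.spanFinrank_span_le_ncard_of_finite (hfin.image _)).trans
        (Set.ncard_image_le hfin)
    exact_mod_cast this
  have h2 := ringKrullDim_quotient_succ_le_of_nonZeroDivisor (mem_nonZeroDivisors_of_ne_zero hG0)
  have h3 := h2.trans h1
  rw [← IsRegularLocalRing.spanFinrank_maximalIdeal] at h3
  have h4 : (maximalIdeal (S ⧸ Ideal.span {G})).spanFinrank + 1 ≤
    (maximalIdeal (S ⧸ Ideal.span {G})).spanFinrank := by exact_mod_cast h3
  omega

open IsLocalRing in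
theorem isRegularLocalRing_quotient_span_range {S : Type*} [CommRing S] [IsRegularLocalRing S]
    {ι : Type*} [Fintype ι] (F : ι → S) (hF : ∀ i, F i ∈ maximalIdeal S)
    (hlin : ∀ c : ι → S, ∑ i, c i * F i ∈ maximalIdeal S ^ 2 → ∀ i, c i ∈ maximalIdeal S) :
    IsRegularLocalRing (S ⧸ Ideal.span (Set.range F)) := by
  let v : ι → CotangentSpace S := fun i => (maximalIdeal S).toCotangent ⟨F i, hF i⟩
  have hv : LinearIndependent (ResidueField S) v := by
    rw [Fintype.linearIndependent_iff]
    intro g hg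
    choose c hc using fun i => residue_surjective (g i)
    have : ∀ i, c i ∈ maximalIdeal S := by
      apply hlin
      have h0 : (maximalIdeal S).toCotangent (∑ i, c i • ⟨F i, hF i⟩) = 0 := by
        rw [map_sum, ← hg]
        refine Finset.sum_congr rfl fun i _ => ?_
        rw [map_smul, ← hc i]
        rfl
      rw [Ideal.toCotangent_eq_zero] at h0
      simpa using h0
    intro i
    rw [← hc i, residue_eq_zero_iff]
    exact this i
  obtain ⟨W, hW⟩ := Submodule.exists_isCompl (Submodule.span (ResidueField S) (Set.range v))
  have hWdim : Module.finrank (ResidueField S) W + Fintype.card ι =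
      (maximalIdeal S).spanFinrank := by
    rw [spanFinrank_maximalIdeal_eq_finrank_cotangentSpace, ← finrank_span_eq_card hv, add_comm]
    exact Submodule.finrank_add_eq_of_isCompl hW
  let b := Module.finBasis (ResidueField S) W
  choose t ht using fun j => (maximalIdeal S).toCotangent_surjective (b j : CotangentSpace S)
  let u : Set S := Set.range fun j => (t j : S)
  have hm : maximalIdeal S ≤ (Ideal.span (Set.range F) ⊔ Ideal.span u) ⊔
      maximalIdeal S • maximalIdeal S := by
    intro x hx
    have hmem : (maximalIdeal S).toCotangent ⟨x, hx⟩ ∈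
        Submodule.span (ResidueField S) (Set.range v) ⊔ W := by
      rw [hW.sup_eq_top]; trivial
    obtain ⟨y, hy, w, hw, hyw⟩ := Submodule.mem_sup.mp hmem
    obtain ⟨g, rfl⟩ := (Submodule.mem_span_range_iff_exists_fun _).mp hy
    choose c hc using fun i => residue_surjective (g i)
    choose e he using fun j => residue_surjective (b.repr ⟨w, hw⟩ j)
    have hw' : w = ∑ j, b.repr ⟨w, hw⟩ j • (b j : CotangentSpace S) := by
      have := congrArg W.subtype (b.sum_repr ⟨w, hw⟩)
      rw [map_sum] at this
      exact this.symm
    have h0 : (maximalIdeal S).toCotangent ⟨x, hx⟩ =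
        (maximalIdeal S).toCotangent (∑ i, c i • ⟨F i, hF i⟩ + ∑ j, e j • t j) := by
      rw [← hyw, map_add, map_sum, map_sum]
      congr 1
      · refine Finset.sum_congr rfl fun i _ => ?_
        rw [map_smul, ← hc i]
        rfl
      · rw [hw']
        refine Finset.sum_congr rfl fun j _ => ?_
        rw [map_smul, ht j, ← he j]
        rfl
    rw [Ideal.toCotangent_eq] at h0
    have hx' : x = (∑ i, c i * F i + ∑ j, e j * (t j : S)) +
        (x - (∑ i, c i * F i + ∑ j, e j * (t j : S))) := by ring
    rw [hx']
    refine add_mem (Submodule.mem_sup_left (add_mem (Submodule.mem_sup_left ?_)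
      (Submodule.mem_sup_right ?_))) (Submodule.mem_sup_right ?_)
    · exact sum_mem fun i _ => Ideal.mul_mem_left _ _ (Ideal.subset_span ⟨i, rfl⟩)
    · exact sum_mem fun j _ => Ideal.mul_mem_left _ _ (Ideal.subset_span ⟨j, rfl⟩)
    · rw [smul_eq_mul, ← sq]
      simpa using h0
  have hle : maximalIdeal S ≤ Ideal.span (Set.range F) ⊔ Ideal.span u :=
    Submodule.le_of_le_smul_of_le_jacobson_bot (IsNoetherian.noetherian _)
      (jacobson_eq_maximalIdeal ⊥ bot_ne_top).ge hm
  have hI : Ideal.span (Set.range F) ≤ maximalIdeal S :=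
    Ideal.span_le.mpr (Set.range_subset_iff.mpr hF)
  have : Nontrivial (S ⧸ Ideal.span (Set.range F)) :=
    Ideal.Quotient.nontrivial_iff.mpr (ne_top_of_le_ne_top Ideal.IsPrime.ne_top' hI)
  have : IsLocalRing (S ⧸ Ideal.span (Set.range F)) :=
    .of_surjective' _ Ideal.Quotient.mk_surjective
  apply IsRegularLocalRing.of_spanFinrank_maximalIdeal_le
  have hmax : maximalIdeal (S ⧸ Ideal.span (Set.range F)) =
      Ideal.span (Ideal.Quotient.mk (Ideal.span (Set.range F)) '' u) := by
    have hcomap := eq_maximalIdeal (Ideal.comap_isMaximal_of_surjective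
      (Ideal.Quotient.mk (Ideal.span (Set.range F))) Ideal.Quotient.mk_surjective
      (K := maximalIdeal _))
    refine le_antisymm ?_ (Ideal.span_le.mpr ?_)
    · rw [← Ideal.map_comap_of_surjective _ Ideal.Quotient.mk_surjective (maximalIdeal (S ⧸ _)),
        hcomap]
      refine (Ideal.map_mono hle).trans ?_
      rw [Ideal.map_sup, Ideal.map_quotient_self, bot_sup_eq, Ideal.map_span]
    · rintro _ ⟨_, ⟨j, rfl⟩, rfl⟩
      rw [SetLike.mem_coe, ← Ideal.mem_comap, hcomap]
      exact (t j).2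
  have h1 : (maximalIdeal (S ⧸ Ideal.span (Set.range F))).spanFinrank ≤
      Module.finrank (ResidueField S) W := by
    rw [hmax]
    refine (Submodule.spanFinrank_span_le_ncard_of_finite
      ((Set.finite_range _).image _)).trans ((Set.ncard_image_le (Set.finite_range _)).trans ?_)
    rw [← Set.image_univ]
    refine (Set.ncard_image_le Set.finite_univ).trans ?_
    simp
  have h2 := ringKrullDim_le_ringKrullDim_quotient_add_spanFinrank (Ideal.span (Set.range F))
    (hI.trans (ringJacobson_eq_maximalIdeal S).ge)
  have h3 : (Ideal.span (Set.range F)).spanFinrank ≤ Fintype.card ι := by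
    refine (Submodule.spanFinrank_span_le_ncard_of_finite (Set.finite_range _)).trans ?_
    rw [← Set.image_univ, ← Nat.card_eq_fintype_card, ← Set.ncard_univ]
    exact Set.ncard_image_le
  rw [← IsRegularLocalRing.spanFinrank_maximalIdeal, ← hWdim] at h2
  have h5 := h2.trans (add_le_add_right (Nat.cast_le.mpr h3) _)
  rw [Nat.cast_add] at h5
  refine le_trans (Nat.cast_le.mpr h1) ?_
  generalize ringKrullDim (S ⧸ Ideal.span (Set.range F)) = D at h5
  match D, h5 with
  | ⊥, h5 => simp at h5
  | (D : ℕ∞), h5 =>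
    norm_cast at h5 ⊢
    exact (ENat.add_le_add_iff_right (ENat.natCast_ne_top _)).mp h5

open Order in
theorem exists_subset_height_le_coheight_add_encard {R : Type*} [CommRing R] [IsNoetherianRing R]
    (m : PrimeSpectrum R) (s : Set R) (hs : s ⊆ m.asIdeal) :
    ∃ q : PrimeSpectrum R, s ⊆ q.asIdeal ∧ height m ≤ coheight q + s.encard := by
  have hle := Ideal.height_le_height_add_encard_of_subset s hs
  have hsm : Ideal.span s ≤ m.asIdeal := Ideal.span_le.mpr hs
  have : (m.asIdeal.map (Ideal.Quotient.mk (Ideal.span s))).IsPrime :=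
    Ideal.isPrime_map_quotientMk_of_isPrime hsm
  obtain ⟨l, -, hl⟩ :=
    (m.asIdeal.map (Ideal.Quotient.mk (Ideal.span s))).exists_ltSeries_length_eq_height
  let l' : LTSeries (PrimeSpectrum R) :=
    l.map (PrimeSpectrum.comap (Ideal.Quotient.mk (Ideal.span s)))
      (RingHom.strictMono_comap_of_surjective Ideal.Quotient.mk_surjective)
  refine ⟨l'.head, ?_, ?_⟩
  · intro x hx
    have h0 : Ideal.Quotient.mk (Ideal.span s) x = 0 :=
      Ideal.Quotient.eq_zero_iff_mem.mpr (Ideal.subset_span hx)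
    simp [l', h0]
  · rw [← PrimeSpectrum.height_eq_orderHeight]
    refine hle.trans ?_
    rw [← hl]
    gcongr
    exact length_le_coheight_head (p := l')

open Order in
theorem coheight_comap_quotientMk {R : Type*} [CommRing R] (I : Ideal R)
    (q : PrimeSpectrum (R ⧸ I)) :
    coheight (PrimeSpectrum.comap (Ideal.Quotient.mk I) q) = coheight q := by
  refine (coheight_eq_of_strictMono _
    (RingHom.strictMono_comap_of_surjective Ideal.Quotient.mk_surjective) ?_ q).symm
  intro a b hab
  have hI : I ≤ b.asIdeal := by
    refine le_trans ?_ hab.le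
    intro x hx
    have h0 : Ideal.Quotient.mk I x = 0 := Ideal.Quotient.eq_zero_iff_mem.mpr hx
    simp [h0]
  have hp : (b.asIdeal.map (Ideal.Quotient.mk I)).IsPrime :=
    Ideal.isPrime_map_quotientMk_of_isPrime hI
  have hb : PrimeSpectrum.comap (Ideal.Quotient.mk I) ⟨_, hp⟩ = b := by
    ext1
    simp [Ideal.comap_map_of_surjective _ Ideal.Quotient.mk_surjective,
      ← RingHom.ker_eq_comap_bot, hI]
  refine ⟨⟨_, hp⟩, ?_, hb⟩
  rw [← hb] at hab
  refine lt_of_le_of_ne ?_ ?_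
  · rw [← PrimeSpectrum.asIdeal_le_asIdeal]
    have := hab.le
    rw [← PrimeSpectrum.asIdeal_le_asIdeal] at this
    exact (Ideal.comap_le_comap_iff_of_surjective _ Ideal.Quotient.mk_surjective _ _).mp this
  · rintro rfl
    exact hab.ne rfl

theorem height_eq_of_isMaximal_mvPolynomial {K : Type*} [Field K] (n : ℕ)
    (m : Ideal (MvPolynomial (Fin n) K)) (hm : m.IsMaximal) : m.height = n := by
  induction n with
  | zero =>
    have h := Ideal.height_le_ringKrullDim_of_ne_top hm.ne_top
    rw [MvPolynomial.ringKrullDim_of_isNoetherianRing] at h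
    simpa using h
  | succ n ih =>
    let e := (finSuccEquiv K n).toRingEquiv
    have hm' : (m.comap e.symm).IsMaximal := Ideal.comap_isMaximal_of_equiv e.symm
    rw [← e.symm.height_comap m]
    have h1 : ((m.comap e.symm).comap Polynomial.C).IsMaximal :=
      Polynomial.isMaximal_comap_C_of_isJacobsonRing _
    have h2 : (m.comap e.symm).LiesOver ((m.comap e.symm).comap Polynomial.C) := ⟨rfl⟩
    rw [Polynomial.height_eq_height_add_one ((m.comap e.symm).comap Polynomial.C), ih _ h1]
    simp

open Order in
theorem le_coheight_add_one_mvPolynomial {K : Type*} [Field K] (n : ℕ)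
    (p : PrimeSpectrum (MvPolynomial (Fin n) K)) (hp : height p ≤ 1) :
    (n : ℕ∞) ≤ coheight p + 1 := by
  obtain ⟨m, hm, hpm⟩ := p.asIdeal.exists_le_maximal p.2.ne_top
  obtain ⟨g, hg⟩ : ∃ g, p.asIdeal = Ideal.span {g} := by
    rw [← PrimeSpectrum.height_eq_orderHeight] at hp
    rcases Order.le_one_iff.mp hp with h | h
    · exact ⟨0, by simpa [Ideal.height_eq_zero_iff_eq_bot] using h⟩
    · obtain ⟨g, hg⟩ := (UniqueFactorizationMonoid.isPrincipal_of_height_eq_one h).principal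
      exact ⟨g, hg⟩
  have hgm : g ∈ m := hpm (hg ▸ Ideal.mem_span_singleton_self g)
  obtain ⟨q, hq, hle⟩ := exists_subset_height_le_coheight_add_encard ⟨m, hm.isPrime⟩ {g}
    (by simpa using hgm)
  rw [← PrimeSpectrum.height_eq_orderHeight, height_eq_of_isMaximal_mvPolynomial n m hm,
    Set.encard_singleton] at hle
  refine hle.trans ?_
  gcongr
  rw [← PrimeSpectrum.asIdeal_le_asIdeal, hg]
  simpa using hq

open Order in
theorem exists_coheight_bot_eq (K A : Type*) [Field K] [CommRing A] [IsDomain A] [Algebra K A]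
    [Algebra.FiniteType K A] : ∃ r : ℕ, coheight (⊥ : PrimeSpectrum A) = r ∧
      (∀ m : PrimeSpectrum A, m.asIdeal.IsMaximal → height m = r) ∧
      ∀ p : PrimeSpectrum A, height p ≤ 1 → (r : ℕ∞) ≤ coheight p + 1 := by
  obtain ⟨r, g, hg, hgi⟩ := exists_integral_inj_algHom_of_fg K A
  let := g.toRingHom.toAlgebra
  have : Algebra.IsIntegral (MvPolynomial (Fin r) K) A := ⟨hgi⟩
  have : FaithfulSMul (MvPolynomial (Fin r) K) A :=
    (faithfulSMul_iff_algebraMap_injective _ _).mpr hg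
  let f := PrimeSpectrum.comap (algebraMap (MvPolynomial (Fin r) K) A)
  have hf : StrictMono f := fun p q hpq ↦ Ideal.IsIntegral.comap_lt_comap hpq
  have hco : ∀ p, coheight p = coheight (f p) := by
    refine coheight_eq_of_strictMono f hf fun p q hpq ↦ ?_
    have : p.asIdeal.LiesOver (f p).asIdeal := ⟨rfl⟩
    obtain ⟨Q, hQ, hQp, hQq⟩ := Ideal.exists_ideal_gt_liesOver_of_lt
      (q := q.asIdeal) p.asIdeal (p := (f p).asIdeal) hpq
    exact ⟨⟨Q, hQp⟩, hQ, PrimeSpectrum.ext hQq.over.symm⟩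
  have hht : ∀ p, height p = height (f p) := by
    refine height_eq_of_strictMono f hf fun p q hpq ↦ ?_
    have : p.asIdeal.LiesOver (f p).asIdeal := ⟨rfl⟩
    obtain ⟨Q, hQ, hQp, hQq⟩ := Ideal.exists_ideal_lt_liesOver_of_lt
      (p := q.asIdeal) p.asIdeal (q := (f p).asIdeal) hpq
    exact ⟨⟨Q, hQp⟩, hQ, PrimeSpectrum.ext hQq.over.symm⟩
  refine ⟨r, ?_, fun m hm ↦ ?_, fun p hp ↦ ?_⟩
  · have hbot : f ⊥ = ⊥ := by
      ext1
      exact Ideal.comap_bot_of_injective _ hg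
    rw [hco, hbot, ← WithBot.coe_inj, coheight_bot_eq_krullDim]
    change ringKrullDim _ = _
    simp [MvPolynomial.ringKrullDim_of_isNoetherianRing]
  · rw [hht, ← PrimeSpectrum.height_eq_orderHeight]
    exact height_eq_of_isMaximal_mvPolynomial r _
      (Ideal.isMaximal_comap_of_isIntegral_of_isMaximal m.asIdeal)
  · rw [hco]
    exact le_coheight_add_one_mvPolynomial r _ (hht p ▸ hp)

open Order in
theorem coheight_le_coheight_add_one_of_covBy (K : Type*) {A : Type*} [Field K] [CommRing A]
    [Algebra K A] [Algebra.FiniteType K A] {p q : PrimeSpectrum A} (hpq : p ⋖ q) :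
    coheight p ≤ coheight q + 1 := by
  obtain ⟨r, hbot, -, hr⟩ := exists_coheight_bot_eq K (A ⧸ p.asIdeal)
  have hmono : StrictMono (PrimeSpectrum.comap (Ideal.Quotient.mk p.asIdeal)) :=
    RingHom.strictMono_comap_of_surjective Ideal.Quotient.mk_surjective
  have hp : PrimeSpectrum.comap (Ideal.Quotient.mk p.asIdeal) ⊥ = p := by
    ext1
    simp [← RingHom.ker_eq_comap_bot]
  have hqp : (q.asIdeal.map (Ideal.Quotient.mk p.asIdeal)).IsPrime :=
    Ideal.isPrime_map_quotientMk_of_isPrime hpq.le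
  have hq : PrimeSpectrum.comap (Ideal.Quotient.mk p.asIdeal) ⟨_, hqp⟩ = q := by
    ext1
    have := hpq.le
    rw [← PrimeSpectrum.asIdeal_le_asIdeal] at this
    simp [Ideal.comap_map_of_surjective _ Ideal.Quotient.mk_surjective,
      ← RingHom.ker_eq_comap_bot, this]
  have h := hr ⟨_, hqp⟩ (by
    rw [← Nat.cast_one, height_le_coe_iff]
    intro a ha
    have : a = ⊥ := by
      by_contra hne
      refine hpq.2 ?_ (hq ▸ hmono ha)
      conv_lhs => rw [← hp]
      exact hmono (bot_lt_iff_ne_bot.mpr hne)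
    simp [this])
  rwa [← hbot, ← coheight_comap_quotientMk, ← coheight_comap_quotientMk, hp, hq] at h

open Order in
theorem coheight_bot_le_coheight_add_height (K : Type*) {A : Type*} [Field K] [CommRing A]
    [IsDomain A] [Algebra K A] [Algebra.FiniteType K A] (p : PrimeSpectrum A) :
    coheight (⊥ : PrimeSpectrum A) ≤ coheight p + height p := by
  have : IsNoetherianRing A := Algebra.FiniteType.isNoetherianRing K A
  have hfin : ∀ q : PrimeSpectrum A, height q < ⊤ := fun q ↦ by
    rw [← PrimeSpectrum.height_eq_orderHeight]
    exact Ideal.height_lt_top q.2.ne_top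
  obtain ⟨n, hn⟩ := ENat.ne_top_iff_exists.mp (hfin p).ne
  induction n generalizing p with
  | zero =>
    have : p = ⊥ := by simpa using hn.symm
    simp [this]
  | succ n ih =>
    obtain ⟨-, ⟨q, hqp, hq⟩, -⟩ := height_eq_coe_add_one_iff.mp hn.symm
    have hcov : q ⋖ p := by
      refine ⟨hqp, fun z hqz hzp ↦ ?_⟩
      have h1 := height_strictMono hqz (hfin q)
      have h2 := height_strictMono hzp (hfin z)
      rw [hq] at h1
      rw [← hn, Nat.cast_add, Nat.cast_one] at h2
      exact absurd h1 (ENat.lt_natCast_add_one_iff.mp h2).not_gt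
    calc coheight (⊥ : PrimeSpectrum A) ≤ coheight q + height q := ih q hq.symm
      _ ≤ coheight p + 1 + n := by
        rw [hq]
        gcongr
        exact coheight_le_coheight_add_one_of_covBy K hcov
      _ = coheight p + height p := by
        rw [← hn]
        push_cast
        ring

open Order in
/-- In a finitely generated domain over a field, cutting out `s` from the closed set of a prime `p`
leaves a component whose height exceeds that of `p` by at most the number of elements of `s`. -/
theorem exists_isPrime_height_le_height_add_encard (K : Type*) {A : Type*} [Field K] [CommRing A]
    [IsDomain A] [Algebra K A] [Algebra.FiniteType K A] (p : Ideal A) [hp : p.IsPrime]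
    (s : Set A) (hs : p ⊔ Ideal.span s ≠ ⊤) :
    ∃ q : Ideal A, q.IsPrime ∧ p ≤ q ∧ s ⊆ q ∧ q.height ≤ p.height + s.encard := by
  have : IsNoetherianRing A := Algebra.FiniteType.isNoetherianRing K A
  obtain ⟨m, hm, hpm⟩ := Ideal.exists_le_maximal _ hs
  have hpm' : p ≤ m := le_sup_left.trans hpm
  have hsm : s ⊆ m := Ideal.subset_span.trans (SetLike.coe_subset_coe.mpr (le_sup_right.trans hpm))
  obtain ⟨r, hr, hmax, -⟩ := exists_coheight_bot_eq K (A ⧸ p)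
  have hmp : (m.map (Ideal.Quotient.mk p)).IsMaximal :=
    (Ideal.map_eq_top_or_isMaximal_of_surjective _ Ideal.Quotient.mk_surjective hm).resolve_left
      fun h ↦ hm.ne_top <| by
        have := Ideal.comap_map_of_surjective (Ideal.Quotient.mk p) Ideal.Quotient.mk_surjective m
        rw [h, Ideal.comap_top, ← RingHom.ker_eq_comap_bot, Ideal.mk_ker,
          sup_eq_left.mpr hpm'] at this
        exact this.symm
  obtain ⟨q, hsq, hq⟩ := exists_subset_height_le_coheight_add_encard ⟨_, hmp.isPrime⟩
    (Ideal.Quotient.mk p '' s) (by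
      rintro _ ⟨x, hx, rfl⟩
      exact Ideal.mem_map_of_mem _ (hsm hx))
  have hbot : PrimeSpectrum.comap (Ideal.Quotient.mk p) ⊥ = ⟨p, hp⟩ := by
    ext1
    simp [← RingHom.ker_eq_comap_bot]
  let q' := PrimeSpectrum.comap (Ideal.Quotient.mk p) q
  rw [hmax _ hmp, ← hr, ← coheight_comap_quotientMk, hbot, ← coheight_comap_quotientMk] at hq
  refine ⟨q'.asIdeal, q'.2, ?_, fun x hx ↦ hsq ⟨x, hx, rfl⟩, ?_⟩
  · have : (⟨p, hp⟩ : PrimeSpectrum A) ≤ q' := by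
      rw [← hbot]
      exact (RingHom.strictMono_comap_of_surjective Ideal.Quotient.mk_surjective).monotone bot_le
    exact this
  · obtain ⟨R, hR, -, -⟩ := exists_coheight_bot_eq K A
    have h1 : height q' + coheight q' ≤ R := by
      rw [← hR, ← WithBot.coe_le_coe, coheight_bot_eq_krullDim,
        krullDim_eq_iSup_height_add_coheight_of_nonempty, WithBot.coe_le_coe]
      exact le_iSup (fun a : PrimeSpectrum A ↦ height a + coheight a) q'
    have h2 := coheight_bot_le_coheight_add_height K (⟨p, hp⟩ : PrimeSpectrum A)
    rw [hR] at h2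
    have hfin : coheight q' ≠ ⊤ := by
      intro h
      simp [h] at h1
    rw [← PrimeSpectrum.height_eq_orderHeight] at h1 h2
    refine (ENat.add_le_add_iff_left hfin).mp ?_
    calc coheight q' + q'.asIdeal.height ≤ R := by rwa [add_comm]
      _ ≤ coheight q' + (Ideal.Quotient.mk p '' s).encard + p.height := h2.trans (by gcongr)
      _ ≤ coheight q' + s.encard + p.height := by
        gcongr
        exact Set.encard_image_le _ _
      _ = coheight q' + (p.height + s.encard) := by ring

/-- Localizing a quotient is the quotient of the localization. -/
theorem nonempty_localization_quotient_ringEquiv {R : Type*} [CommRing R] (I : Ideal R)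
    (p : Ideal (R ⧸ I)) [p.IsPrime] (P : Ideal R) [P.IsPrime]
    (hP : P = p.comap (Ideal.Quotient.mk I)) :
    Nonempty ((Localization.AtPrime P ⧸ I.map (algebraMap R (Localization.AtPrime P))) ≃+*
      Localization.AtPrime p) := by
  subst hP
  have h : Algebra.algebraMapSubmonoid (R ⧸ I) (p.comap (Ideal.Quotient.mk I)).primeCompl =
      p.primeCompl := by
    ext x
    obtain ⟨x, rfl⟩ := Ideal.Quotient.mk_surjective x
    constructor
    · rintro ⟨y, hy, hyx⟩
      rw [← hyx]
      exact hy
    · exact fun hx ↦ ⟨x, hx, rfl⟩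
  have : IsLocalization p.primeCompl
      (Localization.AtPrime (p.comap (Ideal.Quotient.mk I)) ⧸
        I.map (algebraMap R (Localization.AtPrime (p.comap (Ideal.Quotient.mk I))))) := by
    rw [← h]
    infer_instance
  exact ⟨(IsLocalization.algEquiv p.primeCompl _ (Localization.AtPrime p)).toRingEquiv⟩

theorem isRegularLocalRing_localization_quotient_iff {R : Type*} [CommRing R] {I : Ideal R}
    {s : Set R} (hs : I = Ideal.span s)
    (p : Ideal (R ⧸ I)) [p.IsPrime] (P : Ideal R) [P.IsPrime]
    (hP : P = p.comap (Ideal.Quotient.mk I)) :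
    IsRegularLocalRing (Localization.AtPrime p) ↔
      IsRegularLocalRing (Localization.AtPrime P ⧸
        Ideal.span (algebraMap R (Localization.AtPrime P) '' s)) := by
  obtain ⟨e⟩ := nonempty_localization_quotient_ringEquiv I p P hP
  rw [← Ideal.map_span, ← hs]
  exact ⟨fun _ ↦ .of_ringEquiv e.symm, fun _ ↦ .of_ringEquiv e⟩

theorem aeval_ite_eq_weightedHomogeneousComponent_zero {K τ : Type*} [CommSemiring K] (w : τ → ℕ)
    (f : MvPolynomial τ K) :
    aeval (fun v ↦ if w v = 0 then (X v : MvPolynomial τ K) else 0) f =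
      weightedHomogeneousComponent w 0 f := by
  classical
  induction f using MvPolynomial.induction_on' with
  | add p q hp hq => rw [map_add, map_add, hp, hq]
  | monomial s c =>
    have hw : Finsupp.weight w s = 0 ↔ ∀ v ∈ s.support, w v = 0 := by
      simp +contextual [Finsupp.weight_apply, Finsupp.sum, Finset.sum_eq_zero_iff]
    by_cases h : Finsupp.weight w s = 0
    · rw [weightedHomogeneousComponent_of_mem (isWeightedHomogeneous_monomial w s c h), if_pos rfl,
        aeval_monomial, monomial_eq]
      congr 1
      refine Finset.prod_congr rfl fun v hv ↦ ?_
      simp [hw.mp h v hv]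
    · rw [weightedHomogeneousComponent_of_mem (isWeightedHomogeneous_monomial w s c rfl),
        if_neg (Ne.symm h), aeval_monomial]
      obtain ⟨v, hv, hv'⟩ : ∃ v ∈ s.support, w v ≠ 0 := by
        by_contra! hc
        exact h (hw.mpr hc)
      rw [Finsupp.prod, Finset.prod_eq_zero hv, mul_zero]
      rw [if_neg hv', zero_pow (Finsupp.mem_support_iff.mp hv)]

/-- A prime ideal degenerates to a weighted homogeneous one with a zero at which all
variables of positive weight vanish and a prescribed variable of weight zero does not. -/
theorem exists_isPrime_le_weightedHomogeneous_eval_eq_zero {K τ : Type*} [Field K] [IsAlgClosed K]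
    [Finite τ] (w : τ → ℕ) (P : Ideal (MvPolynomial τ K)) [hP : P.IsPrime] (v₀ : τ)
    (hw : w v₀ = 0) (hv₀ : X v₀ ∉ P) :
    ∃ P' : Ideal (MvPolynomial τ K), P'.IsPrime ∧ P' ≤ P ∧
      (∀ n, ∀ f ∈ P, IsWeightedHomogeneous w f n → f ∈ P') ∧
      ∃ a : τ → K, a v₀ ≠ 0 ∧ (∀ v, w v ≠ 0 → a v = 0) ∧ ∀ f ∈ P', eval a f = 0 := by
  let := weightedGradedAlgebra K w
  let θ := aeval (R := K) fun v ↦ if w v = 0 then (X v : MvPolynomial τ K) else 0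
  have hprime : (P.comap θ).IsPrime := hP.comap θ
  obtain ⟨a, ha, hav⟩ : ∃ a ∈ zeroLocus K (P.comap θ), a v₀ ≠ 0 := by
    by_contra! hc
    have : X v₀ ∈ vanishingIdeal K (zeroLocus K (P.comap θ)) := by
      exact fun a ha ↦ by simpa using hc a ha
    rw [IsPrime.vanishingIdeal_zeroLocus] at this
    simp [θ, hw, hv₀] at this
  refine ⟨(P.homogeneousCore (weightedHomogeneousSubmodule K w)).toIdeal,
    hP.homogeneousCore, Ideal.toIdeal_homogeneousCore_le _ _, fun n f hf hfn ↦ ?_, a, hav,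
    fun v hv ↦ ?_, fun f hf ↦ ?_⟩
  · exact Ideal.mem_homogeneousCore_of_homogeneous_of_mem ⟨n, hfn⟩ hf
  · simpa using ha (X v) (by simp [θ, hv])
  · refine ha f ?_
    rw [Ideal.mem_comap, aeval_ite_eq_weightedHomogeneousComponent_zero]
    exact Ideal.toIdeal_homogeneousCore_le _ _ (weightedHomogeneousComponent_mem_of_mem K w
      (P.homogeneousCore (weightedHomogeneousSubmodule K w)).isHomogeneous hf 0)

theorem ker_aeval_sumElim_X {K σ ι : Type*} [CommRing K] (c : ι → MvPolynomial σ K) :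
    RingHom.ker (aeval (R := K) (Sum.elim X c)) =
      Ideal.span (Set.range fun i ↦ X (Sum.inr i) - rename Sum.inl (c i)) := by
  refine le_antisymm (fun f hf ↦ ?_) ?_
  · set J := Ideal.span (Set.range fun i ↦
      (X (Sum.inr i) - rename Sum.inl (c i) : MvPolynomial (σ ⊕ ι) K))
    have h : Ideal.Quotient.mkₐ K J = ((Ideal.Quotient.mkₐ K J).comp (rename Sum.inl)).comp
        (aeval (Sum.elim X c)) := by
      ext (j | i)
      · simp
      · simpa using Ideal.Quotient.eq.mpr (Ideal.subset_span ⟨i, rfl⟩ :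
          X (Sum.inr i) - rename Sum.inl (c i) ∈ J)
    have := DFunLike.congr_fun h f
    rw [AlgHom.comp_apply, show aeval (Sum.elim X c) f = 0 from hf, map_zero] at this
    exact Ideal.Quotient.eq_zero_iff_mem.mp this
  · rw [Ideal.span_le]
    rintro _ ⟨i, rfl⟩
    change aeval (Sum.elim X c) (X (Sum.inr i) - rename Sum.inl (c i)) = 0
    rw [map_sub, aeval_X, aeval_rename, Sum.elim_comp_inl, aeval_X_left]
    exact sub_self _

theorem Ideal.height_comap_le_height_add_encard {S T : Type*} [CommRing S] [CommRing T]
    [IsNoetherianRing S] (φ : S →+* T) (hφ : Function.Surjective φ) (s : Set S)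
    (hs : RingHom.ker φ = Ideal.span s) (P : Ideal T) [P.IsPrime] :
    (P.comap φ).height ≤ P.height + s.encard := by
  have hsP : s ⊆ P.comap φ := by
    have : RingHom.ker φ ≤ P.comap φ := Ideal.comap_mono bot_le
    exact Ideal.subset_span.trans (hs ▸ this)
  refine (Ideal.height_le_height_add_encard_of_subset s hsP).trans ?_
  rw [← hs]
  gcongr
  let e := RingHom.quotientKerEquivOfSurjective hφ
  rw [← e.height_comap P]
  refine le_of_eq (congrArg _ ?_)
  ext x
  obtain ⟨x, rfl⟩ := Ideal.Quotient.mk_surjective x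
  have hk : RingHom.ker φ ≤ P.comap φ := Ideal.comap_mono bot_le
  have : Ideal.Quotient.mk (RingHom.ker φ) x ∈ (P.comap φ).map (Ideal.Quotient.mk (RingHom.ker φ))
      ↔ x ∈ P.comap φ := by
    rw [← Ideal.mem_comap, Ideal.comap_map_of_surjective _ Ideal.Quotient.mk_surjective,
      ← RingHom.ker_eq_comap_bot, Ideal.mk_ker, sup_eq_left.mpr hk]
  rw [this]
  rfl

theorem Ideal.height_le_height_comap_of_surjective {S T : Type*} [CommRing S] [CommRing T]
    (φ : S →+* T) (hφ : Function.Surjective φ) (P : Ideal T) [hP : P.IsPrime] :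
    P.height ≤ (P.comap φ).height := by
  have := Order.height_le_height_apply_of_strictMono _
    (RingHom.strictMono_comap_of_surjective hφ) ⟨P, hP⟩
  rwa [← PrimeSpectrum.height_eq_orderHeight, ← PrimeSpectrum.height_eq_orderHeight] at this

theorem MvPolynomial.IsWeightedHomogeneous.rename {K σ τ : Type*} [CommSemiring K] {e : σ → τ}
    {w : τ → ℕ} {f : MvPolynomial σ K} {n : ℕ} (hf : IsWeightedHomogeneous (w ∘ e) f n) :
    IsWeightedHomogeneous w (MvPolynomial.rename e f) n := by
  intro s hs
  obtain ⟨u, rfl, hu⟩ := coeff_rename_ne_zero e f s hs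
  rw [← hf hu, Finsupp.weight_apply, Finsupp.weight_apply, Finsupp.sum_mapDomain_index] <;>
    simp [add_mul]

/-- If the forms `F i` lie in a prime `P` and their gradients are linearly dependent modulo `P`,
then some nonzero constant combination of forms of equal degree is singular along a prime
of controlled height containing all the `F i`. -/
theorem exists_isPrime_sum_smul_pderiv_mem {K σ ι : Type*} [Field K] [IsAlgClosed K] [Finite σ]
    [Fintype ι] [Nonempty ι] (P : Ideal (MvPolynomial σ K)) [P.IsPrime]
    (F : ι → MvPolynomial σ K) (deg : ι → ℕ) (hdeg : ∀ i, 0 < deg i)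
    (hF : ∀ i, (F i).IsHomogeneous (deg i)) (hFP : ∀ i, F i ∈ P)
    (c : ι → MvPolynomial σ K) (hc : ∀ i, c i ∉ P)
    (hcF : ∀ j, ∑ i, c i * pderiv j (F i) ∈ P) :
    ∃ (i₀ : ι) (a : ι → K), a i₀ ≠ 0 ∧ (∀ i, a i ≠ 0 → deg i = deg i₀) ∧
      ∃ Q : Ideal (MvPolynomial σ K), Q.IsPrime ∧ (∀ i, F i ∈ Q) ∧
        (∀ j, ∑ i, C (a i) * pderiv j (F i) ∈ Q) ∧
        Q.height ≤ P.height + Fintype.card ι + Fintype.card ι := by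
  obtain ⟨i₀, hi₀⟩ := Finite.exists_max deg
  have hcard : ∀ g : ι → MvPolynomial (σ ⊕ ι) K, (Set.range g).encard ≤ Fintype.card ι := by
    intro g
    rw [← Set.image_univ]
    exact (Set.encard_image_le _ _).trans (by simp)
  have hren : ∀ (b : ι → MvPolynomial σ K) f, aeval (Sum.elim X b) (rename Sum.inl f) = f := by
    intro b f
    rw [aeval_rename, Sum.elim_comp_inl, aeval_X_left]
    rfl
  have hsurj : ∀ b : ι → MvPolynomial σ K,
      Function.Surjective (aeval (R := K) (Sum.elim X b)).toRingHom :=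
    fun b f ↦ ⟨rename Sum.inl f, hren b f⟩
  let φ := (aeval (R := K) (Sum.elim X c)).toRingHom
  let w : σ ⊕ ι → ℕ := Sum.elim (fun _ ↦ 1) fun i ↦ deg i₀ - deg i
  let E : σ → MvPolynomial (σ ⊕ ι) K := fun j ↦
    ∑ i, X (Sum.inr i) * rename Sum.inl (pderiv j (F i))
  have hE : ∀ (b : ι → MvPolynomial σ K) j,
      aeval (Sum.elim X b) (E j) = ∑ i, b i * pderiv j (F i) := by
    intro b j
    simp only [E, map_sum, map_mul, hren, aeval_X, Sum.elim_inr]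
  have hEw : ∀ j, IsWeightedHomogeneous w (E j) (deg i₀ - 1) := by
    intro j
    refine IsWeightedHomogeneous.sum _ _ _ fun i _ ↦ ?_
    have h := (isWeightedHomogeneous_X K w (Sum.inr i)).mul
      (IsWeightedHomogeneous.rename (w := w) (e := Sum.inl) ((hF i).pderiv (i := j)))
    have : w (Sum.inr i) + (deg i - 1) = deg i₀ - 1 := by
      have := hi₀ i
      have := hdeg i
      simp only [w, Sum.elim_inr]
      lia
    rwa [this] at h
  obtain ⟨P', hP', hP'P, hhom, a, ha₀, ha, haP'⟩ :=
    exists_isPrime_le_weightedHomogeneous_eval_eq_zero w (P.comap φ) (Sum.inr i₀)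
      (by simp [w]) (fun h ↦ hc i₀ (by simpa [φ] using h))
  let b : ι → MvPolynomial σ K := fun i ↦ C (a (Sum.inr i))
  let s := Set.range fun i ↦
    (X (Sum.inr i) - rename Sum.inl (b i) : MvPolynomial (σ ⊕ ι) K)
  have hs : P' ⊔ Ideal.span s ≠ ⊤ := by
    have h : P' ⊔ Ideal.span s ≤ RingHom.ker (eval a) := by
      refine sup_le haP' (Ideal.span_le.mpr ?_)
      rintro _ ⟨i, rfl⟩
      simp [b]
    exact ne_top_of_le_ne_top (RingHom.ker_ne_top _) h
  obtain ⟨q, hq, hP'q, hsq, hqht⟩ := exists_isPrime_height_le_height_add_encard K P' s hs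
  let ψ := (aeval (R := K) (Sum.elim X b)).toRingHom
  have hker : RingHom.ker ψ ≤ q := (ker_aeval_sumElim_X b).le.trans (Ideal.span_le.mpr hsq)
  have hQ : (q.map ψ).IsPrime := Ideal.map_isPrime_of_surjective (hsurj b) hker
  have hψ : ∀ f ∈ q, aeval (Sum.elim X b) f ∈ q.map ψ := fun f hf ↦ Ideal.mem_map_of_mem ψ hf
  refine ⟨i₀, fun i ↦ a (Sum.inr i), ha₀, fun i hi ↦ ?_, q.map ψ, hQ, fun i ↦ ?_, fun j ↦ ?_, ?_⟩
  · have h0 : w (Sum.inr i) = 0 := by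
      by_contra hw
      exact hi (ha _ hw)
    have := hi₀ i
    simp only [w, Sum.elim_inr] at h0
    lia
  · rw [← hren b (F i)]
    refine hψ _ (hP'q (hhom (deg i) _ ?_ (IsWeightedHomogeneous.rename (hF i))))
    change aeval (Sum.elim X c) _ ∈ P
    rw [hren]
    exact hFP i
  · rw [← hE b j]
    refine hψ _ (hP'q (hhom _ _ ?_ (hEw j)))
    change aeval (Sum.elim X c) _ ∈ P
    rw [hE]
    exact hcF j
  · have hcomap : (q.map ψ).comap ψ = q := by
      rw [Ideal.comap_map_of_surjective _ (hsurj b), ← RingHom.ker_eq_comap_bot,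
        sup_eq_left.mpr hker]
    calc (q.map ψ).height ≤ ((q.map ψ).comap ψ).height :=
          Ideal.height_le_height_comap_of_surjective ψ (hsurj b) _
      _ ≤ P'.height + s.encard := by rwa [hcomap]
      _ ≤ (P.comap φ).height + Fintype.card ι :=
        add_le_add (Ideal.height_mono hP'P) (hcard _)
      _ ≤ P.height + Fintype.card ι + Fintype.card ι := by
        gcongr
        refine (Ideal.height_comap_le_height_add_encard φ (hsurj c) _
          (ker_aeval_sumElim_X c) P).trans ?_
        gcongr
        exact hcard _

theorem pderiv_mem_of_mem_sq {K σ : Type*} [CommSemiring K] {P : Ideal (MvPolynomial σ K)}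
    {f : MvPolynomial σ K} (hf : f ∈ P ^ 2) (j : σ) : pderiv j f ∈ P := by
  rw [pow_two] at hf
  induction hf using Submodule.mul_induction_on' with
  | mem_mul_mem g hg h hh =>
    rw [Derivation.leibniz]
    exact P.add_mem (P.mul_mem_right _ hg) (P.mul_mem_right _ hh)
  | add g _ h _ ihg ihh => rw [map_add]; exact P.add_mem ihg ihh

open IsLocalRing in
/-- A linear dependence of `F` modulo the square of the maximal ideal of the local ring at `P`
yields a linear dependence of the gradients of `F` modulo `P`. -/
theorem exists_sum_mul_pderiv_mem {K σ ι : Type*} [Field K] [Fintype ι]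
    (P : Ideal (MvPolynomial σ K)) [hP : P.IsPrime] (F : ι → MvPolynomial σ K) (hF : ∀ i, F i ∈ P)
    (c : ι → Localization.AtPrime P) (i₀ : ι) (hc : c i₀ ∉ maximalIdeal (Localization.AtPrime P))
    (hcF : ∑ i, c i * algebraMap _ (Localization.AtPrime P) (F i) ∈
      maximalIdeal (Localization.AtPrime P) ^ 2) :
    ∃ c' : ι → MvPolynomial σ K, c' i₀ ∉ P ∧ ∀ j, ∑ i, c' i * pderiv j (F i) ∈ P := by
  obtain ⟨b, hb⟩ := IsLocalization.exist_integer_multiples_of_finite P.primeCompl c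
  choose c' hc' using hb
  have hc₀ : c' i₀ ∉ P := by
    intro h
    have := (IsLocalization.AtPrime.to_map_mem_maximal_iff (Localization.AtPrime P) P (c' i₀)).mpr h
    rw [hc', Algebra.smul_def] at this
    exact b.2 ((IsLocalization.AtPrime.to_map_mem_maximal_iff (Localization.AtPrime P) P _).mp
      ((Ideal.IsPrime.mem_or_mem inferInstance this).resolve_right hc))
  have hmem : algebraMap _ (Localization.AtPrime P) (∑ i, c' i * F i) ∈
      (P ^ 2).map (algebraMap _ (Localization.AtPrime P)) := by
    have : algebraMap _ (Localization.AtPrime P) (∑ i, c' i * F i) =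
        (b : MvPolynomial σ K) • ∑ i, c i * algebraMap _ (Localization.AtPrime P) (F i) := by
      simp_rw [map_sum, map_mul, hc', Finset.smul_sum, smul_mul_assoc]
    rw [this, Ideal.map_pow, Localization.AtPrime.map_eq_maximalIdeal, Algebra.smul_def]
    exact Ideal.mul_mem_left _ _ hcF
  rw [IsLocalization.mem_map_algebraMap_iff P.primeCompl] at hmem
  obtain ⟨⟨x, s⟩, hx⟩ := hmem
  rw [← map_mul] at hx
  have hx := IsLocalization.injective (Localization.AtPrime P) P.primeCompl_le_nonZeroDivisors hx
  refine ⟨c', hc₀, fun j ↦ ?_⟩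
  have hd := pderiv_mem_of_mem_sq x.2 j
  rw [← hx, Derivation.leibniz] at hd
  have h1 : ∑ i, c' i * F i ∈ P := P.sum_mem fun i _ ↦ P.mul_mem_left _ (hF i)
  have h2 := (P.add_mem_iff_right (P.mul_mem_right _ h1)).mp hd
  have h3 := (hP.mem_or_mem h2).resolve_left s.2
  simp_rw [map_sum, Derivation.leibniz, smul_eq_mul, Finset.sum_add_distrib] at h3
  exact (P.add_mem_iff_left (P.sum_mem fun i _ ↦ P.mul_mem_right _ (hF i))).mp h3

open IsLocalRing in
/-- If forms `F i` in a prime `P` fail to cut out a regular local ring at `P`, then a nonzero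
combination of those of some fixed degree is singular along a prime of controlled height. -/
theorem exists_isPrime_singular_of_not_isRegularLocalRing {K σ ι : Type*} [Field K] [IsAlgClosed K]
    [Finite σ] [Fintype ι] (P : Ideal (MvPolynomial σ K)) [P.IsPrime]
    (F : ι → MvPolynomial σ K) (deg : ι → ℕ) (hdeg : ∀ i, 0 < deg i)
    (hF : ∀ i, (F i).IsHomogeneous (deg i)) (hFP : ∀ i, F i ∈ P)
    (hreg : ¬ IsRegularLocalRing (Localization.AtPrime P ⧸
      Ideal.span (algebraMap _ (Localization.AtPrime P) '' Set.range F))) :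
    ∃ (i₀ : ι) (a : ι → K), a i₀ ≠ 0 ∧ (∀ i, a i ≠ 0 → deg i = deg i₀) ∧
      ∃ Q : Ideal (MvPolynomial σ K), Q.IsPrime ∧ ∑ i, a i • F i ∈ Q ∧
        (∀ j, pderiv j (∑ i, a i • F i) ∈ Q) ∧
        Q.height ≤ P.height + Fintype.card ι + Fintype.card ι := by
  classical
  have hdep : ∃ c : ι → Localization.AtPrime P,
      ∑ i, c i * algebraMap _ (Localization.AtPrime P) (F i) ∈
        maximalIdeal (Localization.AtPrime P) ^ 2 ∧
      ∃ i, c i ∉ maximalIdeal (Localization.AtPrime P) := by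
    by_contra! hc
    refine hreg ?_
    rw [← Set.range_comp]
    exact isRegularLocalRing_quotient_span_range _ (fun i ↦
      (IsLocalization.AtPrime.to_map_mem_maximal_iff (Localization.AtPrime P) P _).mpr (hFP i)) hc
  obtain ⟨c, hcF, k, hck⟩ := hdep
  obtain ⟨c', hc'k, hc'⟩ := exists_sum_mul_pderiv_mem P F hFP c k hck hcF
  have : Nonempty {i // c' i ∉ P} := ⟨⟨k, hc'k⟩⟩
  obtain ⟨i₀, a, ha₀, ha, Q, hQ, hFQ, hdQ, hht⟩ := exists_isPrime_sum_smul_pderiv_mem P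
    (fun i : {i // c' i ∉ P} ↦ F i) (fun i ↦ deg i) (fun i ↦ hdeg i) (fun i ↦ hF i)
    (fun i ↦ hFP i) (fun i ↦ c' i) (fun i ↦ i.2) (fun j ↦ by
      have h := hc' j
      rw [← Fintype.sum_subtype_add_sum_subtype (fun i ↦ c' i ∉ P)] at h
      refine (P.add_mem_iff_left (P.sum_mem fun i _ ↦ ?_)).mp h
      exact P.mul_mem_right _ (not_not.mp i.2))
  let a' : ι → K := fun i ↦ if h : c' i ∉ P then a ⟨i, h⟩ else 0
  have ha' : ∀ i : {i // c' i ∉ P}, a' i = a i := fun i ↦ dif_pos i.2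
  have hsum : ∑ i, a' i • F i = ∑ i : {i // c' i ∉ P}, C (a i) * F i := by
    rw [← Fintype.sum_subtype_add_sum_subtype (fun i ↦ c' i ∉ P), add_eq_left.mpr]
    · exact Fintype.sum_congr _ _ fun i ↦ by rw [ha', smul_eq_C_mul]
    · exact Finset.sum_eq_zero fun i _ ↦ by simp only [a', dif_neg i.2, zero_smul]
  refine ⟨i₀, a', by rwa [ha'], fun i hi ↦ ?_, Q, hQ, ?_, fun j ↦ ?_, hht.trans ?_⟩
  · by_cases h : c' i ∉ P
    · exact ha ⟨i, h⟩ (by rwa [← ha'])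
    · exact absurd (dif_neg h) hi
  · rw [hsum]
    exact Q.sum_mem fun i _ ↦ Q.mul_mem_left _ (hFQ i)
  · rw [hsum]
    simpa [Derivation.leibniz] using hdQ j
  · gcongr <;> exact Fintype.card_subtype_le _

theorem not_serreReg_quotient_of_pderiv_mem {K σ : Type*} [Field K] [PerfectField K] [Finite σ]
    {η : ℕ} {G : MvPolynomial σ K} (hG : G ≠ 0) (Q : Ideal (MvPolynomial σ K)) [hQ : Q.IsPrime]
    (hGQ : G ∈ Q) (hdG : ∀ j, pderiv j G ∈ Q) (hQη : Q.height ≤ η) :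
    ¬ SerreReg η (MvPolynomial σ K ⧸ Ideal.span {G}) := by
  intro h
  have hle : Ideal.span {G} ≤ Q := (Ideal.span_singleton_le_iff_mem Q).mpr hGQ
  have hprime : (Q.map (Ideal.Quotient.mk (Ideal.span {G}))).IsPrime :=
    Ideal.isPrime_map_quotientMk_of_isPrime hle
  have hcomap : Q = (Q.map (Ideal.Quotient.mk (Ideal.span {G}))).comap
      (Ideal.Quotient.mk (Ideal.span {G})) := by
    rw [Ideal.comap_map_of_surjective _ Ideal.Quotient.mk_surjective, ← RingHom.ker_eq_comap_bot,
      Ideal.mk_ker, sup_eq_left.mpr hle]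
  have hht : (Q.map (Ideal.Quotient.mk (Ideal.span {G}))).height ≤ η := by
    refine (Ideal.height_le_height_comap_of_surjective _ Ideal.Quotient.mk_surjective _).trans ?_
    rwa [← hcomap]
  have hreg := (isRegularLocal_iff _).mp (h ⟨_, hprime⟩ (by
    rwa [← PrimeSpectrum.height_eq_orderHeight]))
  rw [isRegularLocalRing_localization_quotient_iff rfl _ Q hcomap, Set.image_singleton] at hreg
  refine not_isRegularLocalRing_quotient ?_
    (map_mem_maximalIdeal_sq_of_pderiv_mem Q hGQ hdG (Localization.AtPrime Q)) hreg
  rwa [Ne, IsLocalization.to_map_eq_zero_iff _ Q.primeCompl_le_nonZeroDivisors]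

theorem HasCollapse.mono_s14 {K : Type*} [CommSemiring K] {N k l : ℕ} {F : MvPolynomial (Fin N) K}
    (hF : HasCollapse k F) (hkl : k ≤ l) : HasCollapse l F := by
  obtain ⟨f, g, hf, hg, rfl⟩ := hF
  obtain ⟨l, rfl⟩ := Nat.exists_eq_add_of_le hkl
  refine ⟨Fin.append f 0, Fin.append g 0, fun i ↦ ?_, fun i ↦ ?_, ?_⟩
  · refine Fin.addCases (fun i ↦ ?_) (fun i ↦ ?_) i
    · simpa using hf i
    · exact ⟨1, one_pos, by simpa using isHomogeneous_zero _ _ _⟩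
  · refine Fin.addCases (fun i ↦ ?_) (fun i ↦ ?_) i
    · simpa using hg i
    · exact ⟨1, one_pos, by simpa using isHomogeneous_zero _ _ _⟩
  · simp [Fin.sum_univ_add]

theorem card_le_sum_finrank {K W ι J : Type*} [Field K] [AddCommGroup W] [Module K W]
    [Fintype ι] [Fintype J] (V : J → Submodule K W) [∀ j, Module.Finite K (V j)] (y : ι → W)
    (hy : LinearIndependent K y) (j : ι → J) (hj : ∀ i, y i ∈ V (j i)) :
    Fintype.card ι ≤ ∑ k, Module.finrank K (V k) := by
  classical
  rw [Fintype.card_congr (Equiv.sigmaFiberEquiv j).symm, Fintype.card_sigma]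
  refine Finset.sum_le_sum fun k _ ↦ ?_
  let v : {i // j i = k} → V k := fun i ↦ ⟨y i, by simpa only [i.2] using hj i⟩
  have hv : LinearIndependent K v :=
    .of_comp (V k).subtype (hy.comp _ Subtype.val_injective)
  exact hv.fintype_card_le_finrank

/-- If `A` is increasing and satisfies property `PAa_d`, then
`Ā(η,δ) = |δ| - 1 + A(η + 3|δ|)` satisfies property `PAb_d`: whenever every nonzero
element of every graded piece `V_j` of a graded vector space `V` with dimension
vector `δ` has strength at least `Ā(η,δ)`, every sequence of `K`-linearly
independent forms in `V` is an `R_η`-sequence. -/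
theorem PAa_implies_PAb {K : Type*} [Field K] [IsAlgClosed K]
    (d : ℕ) (hd : 2 ≤ d)
    (A : ℕ → ℕ) (hApos : ∀ η, 1 ≤ η → 0 < A η)
    (hAmono : ∀ η η', η ≤ η' → A η ≤ A η')
    (hPAa : ∀ (η : ℕ), 1 ≤ η → ∀ (N : ℕ) (F : MvPolynomial (Fin N) K), F ≠ 0 →
      ∀ e : ℕ, 0 < e → e ≤ d → F.IsHomogeneous e →
      ¬ HasCollapse (A η) F →
      SerreReg η (MvPolynomial (Fin N) K ⧸ Ideal.span {F})) :
    ∀ (η : ℕ), 1 ≤ η → ∀ (N : ℕ) (δ : Fin d → ℕ)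
      (V : Fin d → Submodule K (MvPolynomial (Fin N) K)),
      (∀ i : Fin d, ∀ f ∈ V i, f.IsHomogeneous ((i : ℕ) + 1)) →
      (∀ i : Fin d, Module.finrank K (V i) = δ i) →
      (∀ j : Fin d, ∀ G ∈ V j, G ≠ 0 →
        ¬ HasCollapse ((∑ i, δ i) - 1 + A (η + 3 * ∑ i, δ i)) G) →
      ∀ (n : ℕ) (y : Fin n → MvPolynomial (Fin N) K),
        (∀ i : Fin n, ∃ j : Fin d, y i ∈ V j) → LinearIndependent K y →
        IsSerreSeq η y := by

  intro η hη N δ V hVhom hVδ hVstr n y hy hlin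
  choose j hj using hy
  have hyhom : ∀ i, (y i).IsHomogeneous ((j i : ℕ) + 1) := fun i ↦ hVhom _ _ (hj i)
  have hfin : ∀ k, Module.Finite K (V k) := fun k ↦ by
    have : Module.Finite K (homogeneousSubmodule (Fin N) K ((k : ℕ) + 1)) :=
      Module.Finite.iff_fg.mpr (homogeneousSubmodule_fg _ _ _)
    have hle : V k ≤ homogeneousSubmodule (Fin N) K ((k : ℕ) + 1) := fun f hf ↦ hVhom k f hf
    exact Submodule.finiteDimensional_of_le hle
  have hn : n ≤ ∑ i, δ i := by
    simpa [hVδ] using card_le_sum_finrank V y hlin j hj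
  refine ⟨?_, fun m hm ↦ ?_⟩
  · refine ne_top_of_le_ne_top (RingHom.ker_ne_top (constantCoeff (R := K) (σ := Fin N))) ?_
    rw [Ideal.span_le]
    rintro _ ⟨i, rfl⟩
    exact (hyhom i).coeff_eq_zero (by simp)
  · set s := y '' {i : Fin n | (i : ℕ) < m} with hs
    intro p hp
    let F : {i : Fin n // (i : ℕ) < m} → MvPolynomial (Fin N) K := fun i ↦ y i
    have hrange : s = Set.range F := by
      rw [hs, Set.image_eq_range]
      rfl
    have hcard : Fintype.card {i : Fin n // (i : ℕ) < m} ≤ n := by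
      simpa using Fintype.card_subtype_le fun i : Fin n ↦ (i : ℕ) < m
    let P := p.asIdeal.comap (Ideal.Quotient.mk (Ideal.span s))
    have hPs : ∀ f ∈ s, f ∈ P := fun f hf ↦ by
      have h0 : Ideal.Quotient.mk (Ideal.span s) f = 0 :=
        Ideal.Quotient.eq_zero_iff_mem.mpr (Ideal.subset_span hf)
      simp [P, h0]
    have hht : P.height ≤ η + n := by
      refine (Ideal.height_comap_le_height_add_encard _ Ideal.Quotient.mk_surjective s
        Ideal.mk_ker p.asIdeal).trans ?_
      rw [PrimeSpectrum.height_eq_orderHeight]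
      refine add_le_add hp ((Set.encard_image_le _ _).trans ?_)
      exact (Set.encard_le_encard (Set.subset_univ _)).trans (by simp)
    rw [isRegularLocal_iff, isRegularLocalRing_localization_quotient_iff rfl p.asIdeal P rfl]
    by_contra hreg
    obtain ⟨i₀, a, ha₀, ha, Q, hQ, hGQ, hdQ, hQht⟩ :=
      exists_isPrime_singular_of_not_isRegularLocalRing P F (fun i ↦ (j i : ℕ) + 1)
        (fun i ↦ Nat.succ_pos _) (fun i ↦ hyhom i)
        (fun i ↦ hPs _ (hrange ▸ Set.mem_range_self i)) (by rwa [← hrange])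
    have hGV : ∑ i, a i • F i ∈ V (j i₀) := by
      refine Submodule.sum_mem _ fun i _ ↦ ?_
      by_cases hai : a i = 0
      · simp [hai]
      · have hji : j i = j i₀ := Fin.ext (Nat.succ_injective (ha i hai))
        exact Submodule.smul_mem _ _ (hji ▸ hj i)
    have hG : ∑ i, a i • F i ≠ 0 := fun h ↦
      ha₀ (Fintype.linearIndependent_iff.mp (hlin.comp _ Subtype.val_injective) a h i₀)
    refine not_serreReg_quotient_of_pderiv_mem hG Q hGQ hdQ (η := η + 3 * ∑ i, δ i) ?_
      (hPAa _ (by lia) N _ hG ((j i₀ : ℕ) + 1) (by lia) (by lia) (hVhom _ _ hGV)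
        fun h ↦ hVstr _ _ hGV hG (h.mono_s14 (by lia)))
    refine hQht.trans ?_
    calc P.height + Fintype.card {i : Fin n // (i : ℕ) < m} +
          Fintype.card {i : Fin n // (i : ℕ) < m} ≤ (η + n) + n + n := by gcongr
      _ ≤ ((η + 3 * ∑ i, δ i : ℕ) : ℕ∞) := by
        norm_cast
        lia
end

section
/- Let d ≥ 2 and let f: ℤ_{>0} → ℤ_{>0} be strictly increasing in the sense that f(m+n) ≥ f(m) + n for all m, n ∈ ℤ_{>0}. Define ψ_{1,σ}(ε) = ε + 2f((d−1)σ + ε) and, for 2 ≤ i ≤ d−1, ψ_{i,σ}(ε) = ψ_{i−1,ε}^{ε}(ε) + 2f((d−i)σ + i·ψ_{i−1,ε}^{ε}(ε)); also define ψ̃_1(ε) = 2f((d+1)ε), ψ̃_i(ε) = 2f((d+1)·ψ̃_{i−1}^{ε}(ε)) for 2 ≤ i ≤ d−1, φ_i(ε) = ψ_{i,ε}^{ε}(ε) and φ̃_i(ε) = ψ̃_i^{ε}(ε), where superscripts denote iterated composition. Then for all ε ≥ σ ≥ 1 and 1 ≤ i ≤ d−1: (1) ψ_{i,σ}(ε)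 ≤ ψ̃_i(ε); (2) for every k ≥ 1 and 2 ≤ i ≤ d−1, ψ_{i−1,ε}^{k}(ε) ≤ ψ̃_{i−1}^{k}(ε); (3) φ_i(ε) ≤ φ̃_i(ε). -/
/-- `psi d f i σ ε = ψ_{i,σ}(ε)`: `ψ_{1,σ}(ε) = ε + 2f((d-1)σ + ε)` and, for
`i ≥ 2`, `ψ_{i,σ}(ε) = ψ_{i-1,ε}^[ε](ε) + 2f((d-i)σ + i·ψ_{i-1,ε}^[ε](ε))`
(index `0` is an auxiliary identity). -/
def psi (d : ℕ) (f : ℕ → ℕ) : ℕ → ℕ → ℕ → ℕ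
  | 0, _, ε => ε
  | i+1, σ, ε =>
    (psi d f i ε)^[ε] ε + 2 * f ((d - (i + 1)) * σ + (i + 1) * ((psi d f i ε)^[ε] ε))

/-- `psiT d f i ε = ψ̃_i(ε)`: `ψ̃_1(ε) = 2f((d+1)ε)` and, for `i ≥ 2`,
`ψ̃_i(ε) = 2f((d+1)·ψ̃_{i-1}^[ε](ε))` (index `0` is an auxiliary identity). -/
def psiT (d : ℕ) (f : ℕ → ℕ) : ℕ → ℕ → ℕ
  | 0, ε => ε
  | i+1, ε => 2 * f ((d + 1) * ((psiT d f i)^[ε] ε))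

theorem le_iterate_of_expanding {g : ℕ → ℕ} {a : ℕ} (hg : ∀ x, a ≤ x → x ≤ g x) (k : ℕ) {x : ℕ}
    (hx : a ≤ x) : x ≤ g^[k] x := by
  induction k with
  | zero => exact le_rfl
  | succ k ih =>
    rw [Function.iterate_succ_apply']
    exact ih.trans (hg _ (hx.trans ih))

theorem iterate_le_iterate_of_expanding {g h : ℕ → ℕ} {a : ℕ} (hg : ∀ x, a ≤ x → x ≤ g x)
    (hgh : ∀ x, a ≤ x → g x ≤ h x) (hh : ∀ x y, a ≤ x → x ≤ y → h x ≤ h y) (k : ℕ) {x y : ℕ}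
    (hx : a ≤ x) (hxy : x ≤ y) : g^[k] x ≤ h^[k] y := by
  induction k with
  | zero => exact hxy
  | succ k ih =>
    rw [Function.iterate_succ_apply', Function.iterate_succ_apply']
    have hk : a ≤ g^[k] x := hx.trans (le_iterate_of_expanding hg k hx)
    exact (hgh _ hk).trans (hh _ _ hk ih)

theorem iterate_self_le_iterate_self {g : ℕ → ℕ} {a : ℕ} (hg : ∀ x, a ≤ x → x ≤ g x)
    (hmono : ∀ x y, a ≤ x → x ≤ y → g x ≤ g y) {x y : ℕ} (hx : a ≤ x) (hxy : x ≤ y) :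
    g^[x] x ≤ g^[y] y := by
  obtain ⟨c, rfl⟩ := Nat.exists_eq_add_of_le' hxy
  rw [Function.iterate_add_apply]
  have h₁ : g^[x] x ≤ g^[x] (c + x) :=
    iterate_le_iterate_of_expanding hg (fun _ _ => le_rfl) hmono x hx hxy
  exact h₁.trans (le_iterate_of_expanding hg c
    ((hx.trans hxy).trans (le_iterate_of_expanding hg x (hx.trans hxy))))

theorem le_psi (d : ℕ) (f : ℕ → ℕ) (i σ x : ℕ) : x ≤ psi d f i σ x := by
  induction i generalizing σ x with
  | zero => exact le_rfl
  | succ i ih =>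
    rw [psi]
    exact Nat.le_add_right_of_le
      (le_iterate_of_expanding (a := 0) (fun y _ => ih x y) x (Nat.zero_le x))

theorem monotone_of_add_le {f : ℕ → ℕ} (hf : ∀ m n, 1 ≤ m → 1 ≤ n → f m + n ≤ f (m + n))
    {x y : ℕ} (hx : 1 ≤ x) (hxy : x ≤ y) : f x ≤ f y := by
  obtain rfl | hlt := hxy.eq_or_lt
  · exact le_rfl
  · have h := hf x (y - x) hx (by omega)
    rw [Nat.add_sub_cancel' hxy] at h
    omega

theorem le_of_add_le {f : ℕ → ℕ} (hfpos : ∀ m, 1 ≤ m → 1 ≤ f m)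
    (hf : ∀ m n, 1 ≤ m → 1 ≤ n → f m + n ≤ f (m + n)) {x : ℕ} (hx : 1 ≤ x) : x ≤ f x := by
  obtain rfl | hlt := hx.eq_or_lt
  · exact hfpos 1 le_rfl
  · have h := hf 1 (x - 1) le_rfl (by omega)
    rw [Nat.add_sub_cancel' hx] at h
    have := hfpos 1 le_rfl
    omega

theorem psiT_expanding_and_monotone (d : ℕ) {f : ℕ → ℕ} (hfpos : ∀ m, 1 ≤ m → 1 ≤ f m)
    (hf : ∀ m n, 1 ≤ m → 1 ≤ n → f m + n ≤ f (m + n)) (i : ℕ) :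
    (∀ x, 1 ≤ x → x ≤ psiT d f i x) ∧
      ∀ x y, 1 ≤ x → x ≤ y → psiT d f i x ≤ psiT d f i y := by
  induction i with
  | zero => exact ⟨fun _ _ => le_rfl, fun _ _ _ h => h⟩
  | succ i ih =>
    obtain ⟨hexp, hmono⟩ := ih
    have hle : ∀ x, 1 ≤ x → x ≤ (d + 1) * (psiT d f i)^[x] x := fun x hx =>
      (le_iterate_of_expanding hexp x hx).trans (Nat.le_mul_of_pos_left _ d.succ_pos)
    refine ⟨fun x hx => ?_, fun x y hx hxy => ?_⟩
    · rw [psiT]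
      have h := le_of_add_le hfpos hf (hx.trans (hle x hx))
      have := hle x hx
      omega
    · rw [psiT, psiT]
      exact Nat.mul_le_mul_left 2 (monotone_of_add_le hf (hx.trans (hle x hx))
        (Nat.mul_le_mul_left _ (iterate_self_le_iterate_self hexp hmono hx hxy)))

theorem psi_le_psiT_of_le {d : ℕ} {f : ℕ → ℕ} (hfpos : ∀ m, 1 ≤ m → 1 ≤ f m)
    (hf : ∀ m n, 1 ≤ m → 1 ≤ n → f m + n ≤ f (m + n)) {i : ℕ} (hi : i ≤ d) {σ x : ℕ}
    (hx : 1 ≤ x) (hσx : σ ≤ x) : psi d f i σ x ≤ psiT d f i x := by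
  induction i generalizing σ x with
  | zero => exact le_rfl
  | succ i ih =>
    have hAB : (psi d f i x)^[x] x ≤ (psiT d f i)^[x] x :=
      iterate_le_iterate_of_expanding (fun y _ => le_psi d f i x y)
        (fun y hy => ih (by omega) (hx.trans hy) hy)
        (fun y z hy => (psiT_expanding_and_monotone d hfpos hf i).2 y z (hx.trans hy))
        x le_rfl le_rfl
    have hxA : x ≤ (psi d f i x)^[x] x :=
      le_iterate_of_expanding (fun y _ => le_psi d f i x y) x le_rfl
    rw [psi, psiT]
    generalize (psi d f i x)^[x] x = A at *
    generalize (psiT d f i)^[x] x = B at *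
    have hA : 1 ≤ A := hx.trans hxA
    have hN : (d - (i + 1)) * σ + (i + 1) * A + A ≤ (d + 1) * B := calc
      _ ≤ (d - (i + 1)) * A + (i + 1) * A + A := by gcongr; exact hσx.trans hxA
      _ = (d + 1) * A := by rw [← Nat.add_mul, Nat.sub_add_cancel hi, Nat.succ_mul]
      _ ≤ (d + 1) * B := Nat.mul_le_mul_left _ hAB
    have hpos : 1 ≤ (d - (i + 1)) * σ + (i + 1) * A :=
      Nat.le_add_left_of_le (Nat.mul_pos i.succ_pos hA)
    have h₁ := hf _ A hpos hA
    have h₂ := monotone_of_add_le hf (Nat.le_add_right_of_le hpos) hN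
    omega

theorem psi_iterate_le_psiT_iterate {d : ℕ} {f : ℕ → ℕ} (hfpos : ∀ m, 1 ≤ m → 1 ≤ f m)
    (hf : ∀ m n, 1 ≤ m → 1 ≤ n → f m + n ≤ f (m + n)) {i : ℕ} (hi : i ≤ d) {ε : ℕ}
    (hε : 1 ≤ ε) (k : ℕ) : (psi d f i ε)^[k] ε ≤ (psiT d f i)^[k] ε :=
  iterate_le_iterate_of_expanding (fun y _ => le_psi d f i ε y)
    (fun _ hy => psi_le_psiT_of_le hfpos hf hi (hε.trans hy) hy)
    (fun y z hy => (psiT_expanding_and_monotone d hfpos hf i).2 y z (hε.trans hy))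
    k le_rfl le_rfl

/-- If `f : ℤ_{>0} → ℤ_{>0}` is strictly increasing in the sense that
`f(m+n) ≥ f(m) + n`, then for all `ε ≥ σ ≥ 1` and `1 ≤ i ≤ d-1`:
(1) `ψ_{i,σ}(ε) ≤ ψ̃_i(ε)`; (2) for `2 ≤ i` and `k ≥ 1`,
`ψ_{i-1,ε}^[k](ε) ≤ ψ̃_{i-1}^[k](ε)`; (3) `φ_i(ε) ≤ φ̃_i(ε)`. -/
theorem psi_le_psiT (d : ℕ) (hd : 2 ≤ d) (f : ℕ → ℕ) (hfpos : ∀ m, 1 ≤ m → 1 ≤ f m)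
    (hf : ∀ m n, 1 ≤ m → 1 ≤ n → f m + n ≤ f (m + n))
    (σ ε : ℕ) (hσ : 1 ≤ σ) (hσε : σ ≤ ε) :
    ∀ i, 1 ≤ i → i ≤ d - 1 →
      (psi d f i σ ε ≤ psiT d f i ε) ∧
      (2 ≤ i → ∀ k, 1 ≤ k → (psi d f (i - 1) ε)^[k] ε ≤ (psiT d f (i - 1))^[k] ε) ∧
      ((psi d f i ε)^[ε] ε ≤ (psiT d f i)^[ε] ε) := by
  intro i _ hid
  have hε : 1 ≤ ε := hσ.trans hσε
  exact ⟨psi_le_psiT_of_le hfpos hf (by omega) hε hσε,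
    fun _ k _ => psi_iterate_le_psiT_iterate hfpos hf (by omega) hε k,
    psi_iterate_le_psiT_iterate hfpos hf (by omega) hε ε⟩
end

section
/- Let d ≥ 2, k ≥ 1 and d₁ ≥ d+1 be integers, and let f: ℤ_{≥2} → ℤ_{≥2} be strictly increasing (f(m+n) ≥ f(m)+n) with f(σ) ≤ d₁↑^k (d₁^σ) for all σ ≥ 2. Define ψ_1(ε) = 2f((d+1)ε), ψ_i(ε) = 2f((d+1)·ψ_{i−1}^{ε}(ε)) for 2 ≤ i ≤ d−1, and φ_i(ε) = ψ_i^{ε}(ε), where superscripts denote iterated composition. Then for all σ ≥ 2, φ_1(φ_2(⋯(φ_{d−1}(σ))⋯)) ≤ d₁↑^{k+2d−1}(d₁^σ). -/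
/-- Knuth's up-arrow `knuth a k b = a ↑^k b`, with `a ↑^1 b = a ^ b`,
`a ↑^(k+1) 1 = a` and `a ↑^(k+1) (b+1) = a ↑^k (a ↑^(k+1) b)`. -/
def knuth (a : ℕ) : ℕ → ℕ → ℕ
  | 0, b => a ^ b
  | 1, b => a ^ b
  | _+2, 0 => 1
  | _+2, 1 => a
  | k+2, b+2 => knuth a (k+1) (knuth a (k+2) (b+1))
  termination_by k b => (k, b)

/-- `psiA f d i` is the function `ψ_i`: `ψ_1 ε = 2 f ((d+1) ε)` and
`ψ_{i+1} ε = 2 f ((d+1) · ψ_i^[ε] ε)` (the index `0` is an auxiliary identity). -/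
def psiA (f : ℕ → ℕ) (d : ℕ) : ℕ → ℕ → ℕ
  | 0, ε => ε
  | i+1, ε => 2 * f ((d + 1) * ((psiA f d i)^[ε] ε))

/-- `chainA f d m σ = φ_1 (φ_2 (⋯ (φ_m σ)))` where `φ_i ε = ψ_i^[ε] ε`. -/
def chainA (f : ℕ → ℕ) (d : ℕ) : ℕ → ℕ → ℕ
  | 0, σ => σ
  | m+1, σ => chainA f d m ((psiA f d (m+1))^[σ] σ)

theorem knuth_zero_right (a : ℕ) : ∀ j, knuth a j 0 = 1
  | 0 => by simp [knuth]
  | 1 => by simp [knuth]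
  | _ + 2 => by simp [knuth]

theorem knuth_one_right (a : ℕ) : ∀ j, knuth a j 1 = a
  | 0 => by simp [knuth]
  | 1 => by simp [knuth]
  | _ + 2 => by simp [knuth]

theorem knuth_one_left (a b : ℕ) : knuth a 1 b = a ^ b := by simp [knuth]

theorem knuth_succ_succ {a j : ℕ} (hj : 1 ≤ j) (b : ℕ) :
    knuth a (j + 1) (b + 1) = knuth a j (knuth a (j + 1) b) := by
  obtain ⟨j, rfl⟩ := Nat.exists_eq_add_of_le' hj
  cases b with
  | zero => rw [knuth_zero_right, knuth_one_right, knuth_one_right]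
  | succ b => rw [knuth]

theorem knuth_succ_add {a j : ℕ} (hj : 1 ≤ j) (n c : ℕ) :
    knuth a (j + 1) (n + c) = (knuth a j)^[n] (knuth a (j + 1) c) := by
  induction n with
  | zero => simp
  | succ n ih =>
    rw [Function.iterate_succ_apply', ← ih, ← knuth_succ_succ hj, Nat.add_right_comm]

theorem StrictMono.lt_apply_of_zero_lt {g : ℕ → ℕ} (hg : StrictMono g) (h0 : 0 < g 0) (x : ℕ) :
    x < g x := by
  induction x with
  | zero => exact h0
  | succ x ih => exact (Nat.succ_le_of_lt ih).trans_lt (hg x.lt_succ_self)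

theorem knuth_strictMono {a : ℕ} (ha : 2 ≤ a) (j : ℕ) : StrictMono (knuth a j) := by
  have pow_mono : StrictMono fun b => a ^ b := pow_right_strictMono₀ (by omega)
  induction j with
  | zero => intro x y h; simpa [knuth] using pow_mono h
  | succ j ih =>
    rcases Nat.eq_zero_or_pos j with rfl | hj
    · intro x y h; simpa [knuth] using pow_mono h
    · refine strictMono_nat_of_lt_succ fun n => ?_
      rw [knuth_succ_succ hj]
      exact ih.lt_apply_of_zero_lt (by simp [knuth_zero_right]) _

theorem lt_knuth {a : ℕ} (ha : 2 ≤ a) (j x : ℕ) : x < knuth a j x :=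
  (knuth_strictMono ha j).lt_apply_of_zero_lt (by simp [knuth_zero_right]) x

theorem knuth_le_succ {a : ℕ} (ha : 2 ≤ a) (j x : ℕ) : knuth a j x ≤ knuth a (j + 1) x := by
  rcases Nat.eq_zero_or_pos j with rfl | hj
  · simp [knuth]
  · cases x with
    | zero => simp [knuth_zero_right]
    | succ x =>
      rw [knuth_succ_succ hj]
      exact (knuth_strictMono ha j).monotone (lt_knuth ha (j + 1) x)

theorem knuth_mono_left {a : ℕ} (ha : 2 ≤ a) : Monotone (knuth a) :=
  monotone_nat_of_le_succ fun j x => knuth_le_succ ha j x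

theorem pow_le_knuth {a j : ℕ} (ha : 2 ≤ a) (hj : 1 ≤ j) (x : ℕ) : a ^ x ≤ knuth a j x :=
  knuth_one_left a x ▸ knuth_mono_left ha hj x

theorem mul_le_knuth {a j x : ℕ} (ha : 2 ≤ a) (hj : 1 ≤ j) (hx : 1 ≤ x) :
    a * x ≤ knuth a j x := by
  refine le_trans ?_ (pow_le_knuth ha hj x)
  obtain ⟨m, rfl⟩ := Nat.exists_eq_add_of_le' hx
  rw [pow_succ']
  exact Nat.mul_le_mul_left a (Nat.lt_pow_self (by omega))

theorem pow_mul_le_iterate_knuth {a j x : ℕ} (ha : 2 ≤ a) (hj : 1 ≤ j) (hx : 1 ≤ x) (n : ℕ) :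
    a ^ n * x ≤ (knuth a j)^[n] x := by
  induction n with
  | zero => simp
  | succ n ih =>
    rw [Function.iterate_succ_apply', pow_succ', mul_assoc]
    exact (mul_le_knuth ha hj (Nat.mul_pos (by positivity) hx)).trans
      ((knuth_strictMono ha j).monotone ih)

theorem iterate_knuth_le_iterate_knuth {a j l : ℕ} (ha : 2 ≤ a) (hjl : j ≤ l) (n : ℕ) {x y : ℕ}
    (hxy : x ≤ y) : (knuth a j)^[n] x ≤ (knuth a l)^[n] y :=
  ((knuth_strictMono ha j).monotone.iterate n hxy).trans
    ((knuth_strictMono ha j).monotone.iterate_le_of_le (knuth_mono_left ha hjl) n y)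

theorem two_le_iterate {g : ℕ → ℕ} (hg : ∀ x, 2 ≤ x → 2 ≤ g x) (n : ℕ) {x : ℕ} (hx : 2 ≤ x) :
    2 ≤ g^[n] x := by
  induction n with
  | zero => exact hx
  | succ n ih => rw [Function.iterate_succ_apply']; exact hg _ ih

theorem iterate_le_iterate_of_two_le {g G : ℕ → ℕ} (hg : ∀ x, 2 ≤ x → 2 ≤ g x)
    (hG : Monotone G) (h : ∀ x, 2 ≤ x → g x ≤ G x) (n : ℕ) {x : ℕ} (hx : 2 ≤ x) :
    g^[n] x ≤ G^[n] x := by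
  induction n with
  | zero => exact le_rfl
  | succ n ih =>
    rw [Function.iterate_succ_apply', Function.iterate_succ_apply']
    exact (h _ (two_le_iterate hg n hx)).trans (hG ih)

theorem two_le_psiA {f : ℕ → ℕ} (hf2 : ∀ σ, 2 ≤ σ → 2 ≤ f σ) (d i : ℕ) :
    ∀ ε, 2 ≤ ε → 2 ≤ psiA f d i ε := by
  induction i with
  | zero => intro ε h; simpa [psiA] using h
  | succ i ih =>
    intro ε h
    rw [psiA]
    have h1 := two_le_iterate ih ε h
    have h2 := hf2 ((d + 1) * (psiA f d i)^[ε] ε) (by nlinarith)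
    omega

section Bounds

variable {a d k : ℕ} {f : ℕ → ℕ}

theorem two_mul_apply_le (ha : 2 ≤ a) (hk : 1 ≤ k) (hda : d + 1 ≤ a)
    (hfle : ∀ σ, 2 ≤ σ → f σ ≤ knuth a k (a ^ σ)) {y : ℕ} (hy : 2 ≤ y) :
    2 * f ((d + 1) * y) ≤ (knuth a k)^[4] y := by
  have mono := (knuth_strictMono ha k).monotone
  have h1 : (d + 1) * y ≤ knuth a k y :=
    (Nat.mul_le_mul_right y hda).trans (mul_le_knuth ha hk (by omega))
  have h2 : a ^ ((d + 1) * y) ≤ knuth a k (knuth a k y) :=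
    (pow_le_knuth ha hk _).trans (mono h1)
  have h3 : f ((d + 1) * y) ≤ knuth a k (knuth a k (knuth a k y)) :=
    (hfle _ (by nlinarith)).trans (mono h2)
  calc 2 * f ((d + 1) * y) ≤ a * knuth a k (knuth a k (knuth a k y)) := Nat.mul_le_mul ha h3
    _ ≤ (knuth a k)^[4] y := mul_le_knuth ha hk (Nat.zero_lt_of_lt (lt_knuth ha _ _))

theorem iterate_psiA_le_of_psiA_le (ha : 2 ≤ a) {i j : ℕ} (hj : 1 ≤ j)
    (hf2 : ∀ σ, 2 ≤ σ → 2 ≤ f σ)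
    (h : ∀ ε, 2 ≤ ε → psiA f d i ε ≤ (knuth a j)^[4] ε) {ε : ℕ} (hε : 2 ≤ ε) :
    (psiA f d i)^[ε] ε ≤ knuth a (j + 1) (5 * ε) := by
  have mono := (knuth_strictMono ha j).monotone
  calc (psiA f d i)^[ε] ε ≤ ((knuth a j)^[4])^[ε] ε :=
        iterate_le_iterate_of_two_le (two_le_psiA hf2 d i) (mono.iterate 4) h ε hε
    _ = (knuth a j)^[4 * ε] ε := by rw [Function.iterate_mul]
    _ ≤ (knuth a j)^[4 * ε] (knuth a (j + 1) ε) := mono.iterate _ (lt_knuth ha _ _).le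
    _ = knuth a (j + 1) (5 * ε) := by rw [← knuth_succ_add hj]; congr 1; ring

theorem psiA_le (ha : 3 ≤ a) (hk : 1 ≤ k) (hda : d + 1 ≤ a) (hf2 : ∀ σ, 2 ≤ σ → 2 ≤ f σ)
    (hfle : ∀ σ, 2 ≤ σ → f σ ≤ knuth a k (a ^ σ)) (i : ℕ) :
    ∀ ε, 2 ≤ ε → psiA f d (i + 1) ε ≤ (knuth a (k + i))^[4] ε := by
  have ha2 : 2 ≤ a := by omega
  induction i with
  | zero =>
    intro ε hε
    have h0 : psiA f d 0 = id := by funext x; simp [psiA]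
    rw [psiA, h0, Function.iterate_id]
    exact two_mul_apply_le ha2 hk hda hfle hε
  | succ i ih =>
    intro ε hε
    rw [psiA]
    have hφ := iterate_psiA_le_of_psiA_le ha2 (by omega) hf2 ih hε
    have ha3 : 3 ^ 3 ≤ a ^ 3 := Nat.pow_le_pow_left ha 3
    calc 2 * f ((d + 1) * (psiA f d (i + 1))^[ε] ε)
        ≤ (knuth a k)^[4] ((psiA f d (i + 1))^[ε] ε) :=
          two_mul_apply_le ha2 hk hda hfle (two_le_iterate (two_le_psiA hf2 d _) ε hε)
      _ ≤ (knuth a (k + i))^[4] (knuth a (k + i + 1) (5 * ε)) :=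
          iterate_knuth_le_iterate_knuth ha2 (by omega) 4 hφ
      _ = knuth a (k + i + 1) (4 + 5 * ε) := (knuth_succ_add (by omega) 4 _).symm
      _ ≤ knuth a (k + i + 1) ((knuth a (k + i + 1))^[3] ε) :=
          (knuth_strictMono ha2 _).monotone
            (le_trans (by nlinarith) (pow_mul_le_iterate_knuth ha2 (by omega) (by omega) 3))
      _ = (knuth a (k + (i + 1)))^[4] ε := rfl

theorem iterate_psiA_le (ha : 3 ≤ a) (hk : 1 ≤ k) (hda : d + 1 ≤ a)
    (hf2 : ∀ σ, 2 ≤ σ → 2 ≤ f σ) (hfle : ∀ σ, 2 ≤ σ → f σ ≤ knuth a k (a ^ σ)) (i : ℕ)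
    {ε : ℕ} (hε : 2 ≤ ε) :
    (psiA f d (i + 1))^[ε] ε ≤ (knuth a (k + i + 1))^[3] ε := by
  have ha2 : 2 ≤ a := by omega
  have ha3 : 3 ^ 2 ≤ a ^ 2 := Nat.pow_le_pow_left ha 2
  exact (iterate_psiA_le_of_psiA_le ha2 (by omega) hf2 (psiA_le ha hk hda hf2 hfle i) hε).trans
    ((knuth_strictMono ha2 _).monotone
      (le_trans (by nlinarith) (pow_mul_le_iterate_knuth ha2 (by omega) (by omega) 2)))

theorem chainA_le (ha : 3 ≤ a) (hk : 1 ≤ k) (hda : d + 1 ≤ a)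
    (hf2 : ∀ σ, 2 ≤ σ → 2 ≤ f σ) (hfle : ∀ σ, 2 ≤ σ → f σ ≤ knuth a k (a ^ σ)) {N : ℕ} (m : ℕ)
    (hN : k + m ≤ N) : ∀ σ, 2 ≤ σ → chainA f d m σ ≤ (knuth a N)^[3 * m] σ := by
  have ha2 : 2 ≤ a := by omega
  induction m with
  | zero => intro σ _; simp [chainA]
  | succ m ih =>
    intro σ hσ
    rw [chainA, Nat.mul_succ, Function.iterate_add_apply]
    refine (ih (by omega) _ (two_le_iterate (two_le_psiA hf2 d _) σ hσ)).trans ?_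
    exact (knuth_strictMono ha2 N).monotone.iterate _
      ((iterate_psiA_le ha hk hda hf2 hfle m hσ).trans
        (iterate_knuth_le_iterate_knuth ha2 (by omega) 3 le_rfl))

end Bounds

/-- If `f : ℤ_{≥2} → ℤ_{≥2}` is strictly increasing (`f (m+n) ≥ f m + n`) and
`f σ ≤ d₁ ↑^k (d₁ ^ σ)`, then `φ_1 (φ_2 (⋯ (φ_{d-1} σ))) ≤ d₁ ↑^(k+2d-1) (d₁ ^ σ)`. -/
theorem chain_le_knuth (d k d₁ : ℕ) (hd : 2 ≤ d) (hk : 1 ≤ k) (hd₁ : d + 1 ≤ d₁)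
    (f : ℕ → ℕ) (hf2 : ∀ σ, 2 ≤ σ → 2 ≤ f σ)
    (hfinc : ∀ m n, 2 ≤ m → 1 ≤ n → f m + n ≤ f (m + n))
    (hfle : ∀ σ, 2 ≤ σ → f σ ≤ knuth d₁ k (d₁ ^ σ)) :
    ∀ σ, 2 ≤ σ → chainA f d (d - 1) σ ≤ knuth d₁ (k + 2 * d - 1) (d₁ ^ σ) := by
  have ha2 : 2 ≤ d₁ := by omega
  intro σ hσ
  have hexp : 3 * (d - 1) + σ ≤ d₁ ^ σ := by
    obtain ⟨s, rfl⟩ := Nat.exists_eq_add_of_le' hσ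
    have h1 : s + 1 ≤ d₁ ^ s := Nat.lt_pow_self (by omega)
    have h2 : 3 * (d - 1) + 6 ≤ 3 * d₁ := by omega
    have h3 : (s + 1) * d₁ ^ 2 ≤ d₁ ^ (s + 2) := by
      rw [pow_add]
      exact Nat.mul_le_mul_right _ h1
    have h4 : 3 * d₁ ≤ d₁ ^ 2 := by nlinarith
    have h5 : s ≤ s * d₁ ^ 2 := Nat.le_mul_of_pos_right s (by positivity)
    linarith
  calc chainA f d (d - 1) σ
      ≤ (knuth d₁ (k + (d - 1)))^[3 * (d - 1)] σ :=
        chainA_le (by omega) hk hd₁ hf2 hfle (d - 1) le_rfl σ hσ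
    _ ≤ (knuth d₁ (k + (d - 1)))^[3 * (d - 1)] (knuth d₁ (k + (d - 1) + 1) σ) :=
        iterate_knuth_le_iterate_knuth ha2 le_rfl _ (lt_knuth ha2 _ _).le
    _ = knuth d₁ (k + (d - 1) + 1) (3 * (d - 1) + σ) := (knuth_succ_add (by omega) _ _).symm
    _ ≤ knuth d₁ (k + (d - 1) + 1) (d₁ ^ σ) := (knuth_strictMono ha2 _).monotone hexp
    _ ≤ knuth d₁ (k + 2 * d - 1) (d₁ ^ σ) := knuth_mono_left ha2 (by omega) _
end
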